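/- Let G be a locally finite, transient, vertex-transitive simple connected graph and fix a starting vertex a. There exists a constant C > 0 depending only on G such that for every initial rotor configuration ρ, every n ≥ 1, and every vertex x: S_n(ρ,x)/n ≥ G(a,x) − C(log n)^{-2}, where S_n is the total visit count of n sequential rotor walks with empty sink and G(a,x) is the Green function (with the convention that values are compared in [0,∞]). -/

import Mathlib

open MeasureTheory Filter ENNReal Set

namespace RotorWalk

variable {V : Type*} [DecidableEq V]

/-- One step of the rotor walk with local mechanisms `τ`:
the rotor at the current position is advanced and the walker follows it. -/
def step (τ : V → V → V) (p : V × (V → V)) : V × (V → V) :=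
  (τ p.1 (p.2 p.1), Function.update p.2 p.1 (τ p.1 (p.2 p.1)))

/-- Trajectory (position, rotor configuration) of the rotor walk started at `a`
with initial rotor configuration `ρ`. -/
def traj (τ : V → V → V) (a : V) (ρ : V → V) : ℕ → V × (V → V)
  | 0 => (a, ρ)
  | t + 1 => step τ (traj τ a ρ t)

/-- Position of the walker at time `t`. -/
def pos (τ : V → V → V) (a : V) (ρ : V → V) (t : ℕ) : V := (traj τ a ρ t).1

/-- Rotor configuration at time `t`. -/
def conf (τ : V → V → V) (a : V) (ρ : V → V) (t : ℕ) : V → V := (traj τ a ρ t).2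

/-- The walk has not hit the sink `Z` up to and including time `t`. -/
def aliveAt (τ : V → V → V) (Z : Set V) (a : V) (ρ : V → V) (t : ℕ) : Prop :=
  ∀ s ≤ t, pos τ a ρ s ∉ Z

/-- Odometer: the number of visits to `x` strictly before hitting the sink `Z`. -/
noncomputable def odometer (τ : V → V → V) (Z : Set V) (a : V) (ρ : V → V) (x : V) : ℕ∞ :=
  {t : ℕ | aliveAt τ Z a ρ t ∧ pos τ a ρ t = x}.encard

/-- Number of traversals of the directed edge `(y, x)` strictly before hitting `Z`. -/
noncomputable def edgeCount (τ : V → V → V) (Z : Set V) (a : V) (ρ : V → V) (y x : V) : ℕ∞ :=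
  {t : ℕ | aliveAt τ Z a ρ t ∧ pos τ a ρ t = y ∧ pos τ a ρ (t + 1) = x}.encard

open Classical in
/-- The final rotor configuration: the configuration at the hitting time of `Z` if the walk
hits `Z`, and otherwise the pointwise eventual value of the rotor configuration
(which exists when the walk is transient). -/
noncomputable def finalConf (τ : V → V → V) (Z : Set V) (a : V) (ρ : V → V) : V → V :=
  if ∃ t, pos τ a ρ t ∈ Z then conf τ a ρ (sInf {t | pos τ a ρ t ∈ Z})
  else fun x => if h : ∃ v, ∀ᶠ t in atTop, conf τ a ρ t x = v then h.choose else ρ x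

/-- Total number of visits to `x` by `n` sequential rotor walks (rotors not reset). -/
noncomputable def Svis (τ : V → V → V) (Z : Set V) (a : V) (ρ : V → V) (n : ℕ) (x : V) : ℕ∞ :=
  ∑ i ∈ Finset.range n, odometer τ Z a ((finalConf τ Z a)^[i] ρ) x

/-- Total number of traversals of the directed edge `(y,x)` by `n` sequential rotor walks. -/
noncomputable def Sedge (τ : V → V → V) (Z : Set V) (a : V) (ρ : V → V) (n : ℕ) (y x : V) : ℕ∞ :=
  ∑ i ∈ Finset.range n, edgeCount τ Z a ((finalConf τ Z a)^[i] ρ) y x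

/-- The rotor walk is transient: every vertex is visited finitely often (before hitting `Z`). -/
def IsTransientWalk (τ : V → V → V) (Z : Set V) (a : V) (ρ : V → V) : Prop :=
  ∀ x : V, {t : ℕ | aliveAt τ Z a ρ t ∧ pos τ a ρ t = x}.Finite

open Classical in
/-- Total number of visits to `x` by `n` sequential rotor walks with empty sink,
set to `⊤` if one of the `n` walks fails to be transient. -/
noncomputable def SvisT (τ : V → V → V) (a : V) (ρ : V → V) (n : ℕ) (x : V) : ℕ∞ :=
  if ∀ i < n, IsTransientWalk τ ∅ a ((finalConf τ ∅ a)^[i] ρ) then Svis τ ∅ a ρ n x else ⊤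

/-- The local mechanisms map neighbors to neighbors and have a single orbit on each
neighborhood (off the sink). -/
def ValidMechanism (G : SimpleGraph V) (Z : Set V) (τ : V → V → V) : Prop :=
  ∀ x ∉ Z, (∀ y, G.Adj x y → G.Adj x (τ x y)) ∧
    ∀ y, G.Adj x y → ∀ z, G.Adj x z → ∃ i : ℕ, (τ x)^[i] y = z

/-- A rotor configuration: every rotor (off the sink) points to a neighbor. -/
def ValidConfig (G : SimpleGraph V) (Z : Set V) (ρ : V → V) : Prop :=
  ∀ x ∉ Z, G.Adj x (ρ x)

/-- Time-`t` distribution of the simple random walk started at `a` and killed on `Z`. -/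
noncomputable def srw (G : SimpleGraph V) [G.LocallyFinite] (Z : Set V) (a : V) :
    ℕ → V → ℝ≥0∞
  | 0 => Set.indicator {a} 1
  | t + 1 => fun x =>
      ∑' y : V, Set.indicator {y | G.Adj y x ∧ y ∉ Z}
        (fun y => srw G Z a t y / (G.degree y : ℝ≥0∞)) y

/-- Green function: the expected number of visits to a vertex, strictly before hitting `Z`,
of the simple random walk started at `a`. -/
noncomputable def green (G : SimpleGraph V) [G.LocallyFinite] (Z : Set V) (a : V) : V → ℝ≥0∞ :=
  Set.indicator Zᶜ (fun x => ∑' t : ℕ, srw G Z a t x)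

/-- The graph is transient: the Green function (with empty sink) is finite. -/
def TransientGraph (G : SimpleGraph V) [G.LocallyFinite] : Prop :=
  ∀ a x : V, green G ∅ a x < ⊤

/-- A `Z`-oriented spanning forest, encoded as a rotor configuration: off `Z` it points to a
neighbor, on `Z` it is normalized to the identity, and every vertex eventually reaches `Z`. -/
def IsOSF (G : SimpleGraph V) (Z : Set V) (ρ : V → V) : Prop :=
  (∀ x ∉ Z, G.Adj x (ρ x)) ∧ (∀ x ∈ Z, ρ x = x) ∧ ∀ x : V, ∃ n : ℕ, ρ^[n] x ∈ Z

/-- An oriented spanning forest of an infinite graph: every vertex has out-degree one along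
an edge and there is no directed cycle. -/
def IsOSFInf (G : SimpleGraph V) (ρ : V → V) : Prop :=
  (∀ x, G.Adj x (ρ x)) ∧ ∀ x : V, ∀ n > 0, ρ^[n] x ≠ x

/-- A spanning forest of the ball of radius `R` around `a`, oriented toward the boundary
sphere (the sink), normalized to the identity outside the open ball. -/
def IsOSFBall (G : SimpleGraph V) (a : V) (R : ℕ) (ρ : V → V) : Prop :=
  (∀ x, G.dist a x < R → G.Adj x (ρ x)) ∧
  (∀ x, ¬ G.dist a x < R → ρ x = x) ∧
  ∀ x, G.dist a x < R → ∃ n : ℕ, G.dist a (ρ^[n] x) = R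

instance : MeasurableSpace (V → V) := ⊤

/-- `μ` is the oriented wired uniform spanning forest measure of `G` (with respect to the
exhaustion by balls around `a`): it is a probability measure supported on oriented spanning
forests whose finite-dimensional marginals are the limits of the uniform measures on
boundary-oriented spanning forests of the balls. -/
def IsOWUSF (G : SimpleGraph V) (a : V) (μ : Measure (V → V)) : Prop :=
  IsProbabilityMeasure μ ∧
  (∀ᵐ ρ ∂μ, IsOSFInf G ρ) ∧
  ∀ B : Finset (V × V),
    Tendsto (fun R : ℕ =>
        (({ρ : V → V | IsOSFBall G a R ρ ∧ ∀ e ∈ B, ρ e.1 = e.2}.ncard : ℝ) /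
          ({ρ : V → V | IsOSFBall G a R ρ}.ncard : ℝ))) atTop
      (nhds ((μ {ρ : V → V | ∀ e ∈ B, ρ e.1 = e.2}).toReal))

/-- Vertex-transitivity. -/
def VertexTransitive (G : SimpleGraph V) : Prop :=
  ∀ u v : V, ∃ φ : G ≃g G, φ u = v

/-- `μ` is stationary for the rotor walk (empty sink) started at `a`: almost every walk is
transient and the final rotor configuration again has law `μ`. -/
def RWStationary (τ : V → V → V) (a : V) (μ : Measure (V → V)) : Prop :=
  (∀ᵐ ρ ∂μ, IsTransientWalk τ ∅ a ρ) ∧ μ.map (finalConf τ ∅ a) = μ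


end RotorWalk

namespace RotorWalk
set_option linter.unusedSectionVars false

/-- A homogeneous (loops allowed) simple random walk structure. -/
structure TW (Γ X : Type*) [Group Γ] [MulAction Γ X] where
  nb : X → Finset X
  d : ℕ
  d_pos : 0 < d
  card_nb : ∀ x, (nb x).card = d
  symm : ∀ x y, y ∈ nb x → x ∈ nb y
  inv : ∀ (γ : Γ) x y, y ∈ nb x → γ • y ∈ nb (γ • x)

section dotsec
variable {X : Type*}

noncomputable def dot (f g : X →₀ ℝ) : ℝ := Finsupp.linearCombination ℝ (g : X → ℝ) f

lemma dot_eq (f g : X →₀ ℝ) : dot f g = f.sum fun x c => c * g x := by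
  simp [dot, Finsupp.linearCombination_apply]

lemma dot_add_left (f f' g : X →₀ ℝ) : dot (f + f') g = dot f g + dot f' g := by simp [dot]
lemma dot_sub_left (f f' g : X →₀ ℝ) : dot (f - f') g = dot f g - dot f' g := by simp [dot]
lemma dot_smul_left (c : ℝ) (f g : X →₀ ℝ) : dot (c • f) g = c * dot f g := by simp [dot]
lemma dot_single_left (x : X) (c : ℝ) (g : X →₀ ℝ) : dot (Finsupp.single x c) g = c * g x := by
  simp [dot]

lemma dot_eq_sum (f g : X →₀ ℝ) (s : Finset X) (hs : f.support ⊆ s) :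
    dot f g = ∑ x ∈ s, f x * g x := by
  rw [dot_eq, Finsupp.sum_of_support_subset f hs]
  simp

lemma dot_comm (f g : X →₀ ℝ) : dot f g = dot g f := by
  classical
  rw [dot_eq_sum f g (f.support ∪ g.support) Finset.subset_union_left,
    dot_eq_sum g f (f.support ∪ g.support) Finset.subset_union_right]
  exact Finset.sum_congr rfl fun x _ => mul_comm _ _

lemma dot_add_right (f g g' : X →₀ ℝ) : dot f (g + g') = dot f g + dot f g' := by
  rw [dot_comm, dot_add_left, dot_comm g, dot_comm g']
lemma dot_sub_right (f g g' : X →₀ ℝ) : dot f (g - g') = dot f g - dot f g' := by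
  rw [dot_comm, dot_sub_left, dot_comm g, dot_comm g']
lemma dot_smul_right (c : ℝ) (f g : X →₀ ℝ) : dot f (c • g) = c * dot f g := by
  rw [dot_comm, dot_smul_left, dot_comm g]
lemma dot_single_right (x : X) (c : ℝ) (g : X →₀ ℝ) : dot g (Finsupp.single x c) = c * g x := by
  rw [dot_comm, dot_single_left]

lemma dot_self_eq_sum (f : X →₀ ℝ) : dot f f = ∑ x ∈ f.support, f x ^ 2 := by
  rw [dot_eq_sum f f _ subset_rfl]; exact Finset.sum_congr rfl fun x _ => by ring

lemma dot_self_nonneg (f : X →₀ ℝ) : 0 ≤ dot f f := by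
  rw [dot_self_eq_sum]; exact Finset.sum_nonneg fun x _ => sq_nonneg _

lemma dot_self_eq_zero {f : X →₀ ℝ} (h : dot f f = 0) : f = 0 := by
  rw [dot_self_eq_sum, Finset.sum_eq_zero_iff_of_nonneg (fun x _ => sq_nonneg _)] at h
  ext x
  by_contra hx
  exact hx (by simpa using h x (Finsupp.mem_support_iff.2 hx))

lemma dot_cs (f g : X →₀ ℝ) : dot f g ^ 2 ≤ dot f f * dot g g := by
  classical
  rw [dot_eq_sum f g (f.support ∪ g.support) Finset.subset_union_left,
    dot_eq_sum g g (f.support ∪ g.support) Finset.subset_union_right,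
    dot_eq_sum f f (f.support ∪ g.support) Finset.subset_union_left]
  simpa [sq] using Finset.sum_mul_sq_le_sq_mul_sq (f.support ∪ g.support) f g

lemma dot_sub_self (f g : X →₀ ℝ) : dot (f - g) (f - g) = dot f f - 2 * dot f g + dot g g := by
  rw [dot_sub_left, dot_sub_right, dot_sub_right, dot_comm g f]; ring

lemma dot_add_self (f g : X →₀ ℝ) : dot (f + g) (f + g) = dot f f + 2 * dot f g + dot g g := by
  rw [dot_add_left, dot_add_right, dot_add_right, dot_comm g f]; ring

lemma two_dot_le (f g : X →₀ ℝ) : 2 * dot f g ≤ dot f f + dot g g := by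
  have := dot_self_nonneg (f - g); rw [dot_sub_self] at this; linarith

lemma dot_mapDomain {Γ : Type*} [Group Γ] [MulAction Γ X] (γ : Γ) (f g : X →₀ ℝ) :
    dot (f.mapDomain (γ • ·)) (g.mapDomain (γ • ·)) = dot f g := by
  induction f using Finsupp.induction_linear with
  | zero => simp [dot]
  | add f f' h h' => rw [Finsupp.mapDomain_add, dot_add_left, dot_add_left, h, h']
  | single x c =>
    rw [Finsupp.mapDomain_single, dot_single_left, dot_single_left,
      Finsupp.mapDomain_apply (MulAction.injective γ)]
end dotsec

namespace TW
variable {Γ X : Type*} [Group Γ] [MulAction Γ X] (T : TW Γ X)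

lemma dR_pos : (0:ℝ) < T.d := by exact_mod_cast T.d_pos

/-- averaging operator -/
noncomputable def A {W : Type*} [AddCommGroup W] [Module ℝ W] (f : X → W) : X → W :=
  fun x => (1 / (T.d:ℝ)) • ∑ y ∈ T.nb x, f y

/-- transition operator on finitely supported functions -/
noncomputable def P : (X →₀ ℝ) →ₗ[ℝ] (X →₀ ℝ) :=
  Finsupp.linearCombination ℝ (T.A fun y => Finsupp.single y 1)

lemma P_single (x : X) (c : ℝ) : T.P (Finsupp.single x c) =
    c • ((1 / (T.d:ℝ)) • ∑ y ∈ T.nb x, Finsupp.single y 1) := by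
  simp only [P, Finsupp.linearCombination_single, A]

lemma lc_P {W : Type*} [AddCommGroup W] [Module ℝ W] (f : X → W) (ξ : X →₀ ℝ) :
    Finsupp.linearCombination ℝ f (T.P ξ) = Finsupp.linearCombination ℝ (T.A f) ξ := by
  induction ξ using Finsupp.induction_linear with
  | zero => simp
  | add f f' h h' => rw [map_add, map_add, map_add, h, h']
  | single x c =>
    rw [P_single, map_smul, map_smul, map_sum, Finsupp.linearCombination_single]
    simp [A]

lemma P_symm (f g : X →₀ ℝ) : dot (T.P f) g = dot f (T.P g) := by
  classical
  induction f using Finsupp.induction_linear with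
  | zero => simp [dot]
  | add f f' h h' => rw [map_add, dot_add_left, dot_add_left, h, h']
  | single x c =>
    induction g using Finsupp.induction_linear with
    | zero => simp [dot]
    | add f f' h h' => rw [map_add, dot_add_right, dot_add_right, h, h']
    | single y c' =>
      rw [dot_single_right, dot_single_left, P_single, P_single]
      simp only [Finsupp.smul_apply, Finsupp.finsetSum_apply, Finsupp.single_apply, smul_eq_mul,
        Finset.sum_ite_eq']
      have : y ∈ T.nb x ↔ x ∈ T.nb y := ⟨T.symm _ _, T.symm _ _⟩
      simp only [this]; ring

lemma Pn_symm (n : ℕ) (f g : X →₀ ℝ) : dot ((T.P ^ n) f) g = dot f ((T.P ^ n) g) := by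
  induction n generalizing f g with
  | zero => simp
  | succ n ih =>
    rw [pow_succ, Module.End.mul_apply, ih, P_symm, ← Module.End.mul_apply, ← pow_succ', pow_succ]

noncomputable def p (n : ℕ) (x y : X) : ℝ := (T.P ^ n) (Finsupp.single x 1) y

lemma p_eq_dot (n : ℕ) (x y : X) :
    T.p n x y = dot ((T.P ^ n) (Finsupp.single x 1)) (Finsupp.single y 1) := by
  rw [dot_single_right, one_mul]; rfl

lemma p_symm (n : ℕ) (x y : X) : T.p n x y = T.p n y x := by
  rw [p_eq_dot, Pn_symm, dot_comm, ← p_eq_dot]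

lemma dot_Pn_Pn (m n : ℕ) (f g : X →₀ ℝ) :
    dot ((T.P ^ m) f) ((T.P ^ n) g) = dot ((T.P ^ (m+n)) f) g := by
  rw [← Pn_symm, add_comm, pow_add]; rfl

lemma dot_pp (m n : ℕ) (x y : X) : dot ((T.P ^ m) (Finsupp.single x 1))
    ((T.P ^ n) (Finsupp.single y 1)) = T.p (m+n) x y := by
  rw [dot_Pn_Pn, p_eq_dot]

lemma lc_Pn {W : Type*} [AddCommGroup W] [Module ℝ W] (n : ℕ) (f : X → W) (ξ : X →₀ ℝ) :
    Finsupp.linearCombination ℝ f ((T.P ^ n) ξ) = Finsupp.linearCombination ℝ (T.A^[n] f) ξ := by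
  induction n generalizing ξ with
  | zero => simp
  | succ n ih =>
    rw [pow_succ, Module.End.mul_apply, ih, lc_P, Function.iterate_succ_apply']

noncomputable def E {W : Type*} [AddCommGroup W] [Module ℝ W] (n : ℕ) (f : X → W) (x : X) : W :=
  Finsupp.linearCombination ℝ f ((T.P ^ n) (Finsupp.single x 1))

lemma E_eq {W : Type*} [AddCommGroup W] [Module ℝ W] (n : ℕ) (f : X → W) (x : X) :
    T.E n f x = T.A^[n] f x := by
  rw [E, lc_Pn, Finsupp.linearCombination_single, one_smul]

lemma E_eq' {W : Type*} [AddCommGroup W] [Module ℝ W] (n : ℕ) (f : X → W) :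
    T.E n f = T.A^[n] f := by
  ext x; rw [E_eq]

lemma E_add_time {W : Type*} [AddCommGroup W] [Module ℝ W] (m n : ℕ) (f : X → W) :
    T.E (m+n) f = T.E m (T.E n f) := by
  rw [E_eq', E_eq', E_eq', Function.iterate_add_apply]

lemma p_eq_E [DecidableEq X] (n : ℕ) (x y : X) :
    T.p n x y = T.E n (fun z => if z = y then (1:ℝ) else 0) x := by
  rw [p_eq_dot, dot, E]
  congr 1
  congr 1
  ext z
  simp [Finsupp.single_apply, eq_comm]

lemma E_add {W : Type*} [AddCommGroup W] [Module ℝ W] (n : ℕ) (f g : X → W) (x : X) :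
    T.E n (fun y => f y + g y) x = T.E n f x + T.E n g x := by
  simp only [E, Finsupp.linearCombination_apply, Finsupp.sum, smul_add, Finset.sum_add_distrib]

lemma E_sub {W : Type*} [AddCommGroup W] [Module ℝ W] (n : ℕ) (f g : X → W) (x : X) :
    T.E n (fun y => f y - g y) x = T.E n f x - T.E n g x := by
  simp only [E, Finsupp.linearCombination_apply, Finsupp.sum, smul_sub, Finset.sum_sub_distrib]

lemma E_lin {W W' : Type*} [AddCommGroup W] [Module ℝ W] [AddCommGroup W'] [Module ℝ W']
    (n : ℕ) (L : W →ₗ[ℝ] W') (f : X → W) (x : X) :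
    T.E n (fun y => L (f y)) x = L (T.E n f x) := by
  simp only [E, Finsupp.linearCombination_apply, Finsupp.sum, map_sum, map_smul]

lemma E_mul (n : ℕ) (c : ℝ) (f : X → ℝ) (x : X) :
    T.E n (fun y => c * f y) x = c * T.E n f x := by
  simpa using T.E_lin n (LinearMap.mulLeft ℝ c) f x

lemma A_const {W : Type*} [AddCommGroup W] [Module ℝ W] (c : W) :
    T.A (fun _ => c) = fun _ => c := by
  ext x
  have := T.dR_pos
  simp only [A, Finset.sum_const, T.card_nb, ← Nat.cast_smul_eq_nsmul ℝ, smul_smul]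
  rw [one_div, inv_mul_cancel₀ this.ne', one_smul]

lemma E_const {W : Type*} [AddCommGroup W] [Module ℝ W] (n : ℕ) (c : W) (x : X) :
    T.E n (fun _ => c) x = c := by
  rw [E_eq']
  induction n with
  | zero => rfl
  | succ n ih => rw [Function.iterate_succ_apply, A_const, ih]

lemma A_mono {f g : X → ℝ} (h : ∀ y, f y ≤ g y) (x : X) : T.A f x ≤ T.A g x := by
  have := T.dR_pos
  simp only [A, smul_eq_mul]
  exact mul_le_mul_of_nonneg_left (Finset.sum_le_sum fun y _ => h y) (by positivity)

lemma E_mono (n : ℕ) {f g : X → ℝ} (h : ∀ y, f y ≤ g y) (x : X) : T.E n f x ≤ T.E n g x := by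
  rw [E_eq', E_eq']
  induction n generalizing x with
  | zero => exact h x
  | succ n ih => rw [Function.iterate_succ_apply', Function.iterate_succ_apply']; exact T.A_mono ih x

lemma E_nonneg (n : ℕ) {f : X → ℝ} (h : ∀ y, 0 ≤ f y) (x : X) : 0 ≤ T.E n f x := by
  have := T.E_mono n h x
  rwa [E_const] at this

lemma p_nonneg (n : ℕ) (x y : X) : 0 ≤ T.p n x y := by
  classical
  rw [p_eq_E]; exact T.E_nonneg n (fun z => by split_ifs <;> simp) x

lemma E_eq_sum {W : Type*} [AddCommGroup W] [Module ℝ W] (n : ℕ) (f : X → W) (x : X) :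
    T.E n f x = ∑ y ∈ ((T.P ^ n) (Finsupp.single x 1)).support, T.p n x y • f y := by
  simp only [E, Finsupp.linearCombination_apply, Finsupp.sum, p]

lemma sum_p (n : ℕ) (x : X) :
    ∑ y ∈ ((T.P ^ n) (Finsupp.single x 1)).support, T.p n x y = 1 := by
  have := T.E_const n (1:ℝ) x
  rw [E_eq_sum] at this; simpa using this

lemma p_sum_le (n : ℕ) (x : X) (s : Finset X) : ∑ y ∈ s, T.p n x y ≤ 1 := by
  classical
  rw [← T.sum_p n x]
  rw [← Finset.sum_filter_add_sum_filter_not s (· ∈ ((T.P ^ n) (Finsupp.single x 1)).support)]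
  rw [Finset.sum_eq_zero (s := s.filter (· ∉ _))]
  · rw [add_zero]
    exact Finset.sum_le_sum_of_subset_of_nonneg (fun y hy => (Finset.mem_filter.1 hy).2)
      fun y _ _ => T.p_nonneg n x y
  · intro y hy
    have := (Finset.mem_filter.1 hy).2
    simpa [p] using this

lemma P_map (γ : Γ) (f : X →₀ ℝ) :
    T.P (f.mapDomain (γ • ·)) = (T.P f).mapDomain (γ • ·) := by
  classical
  induction f using Finsupp.induction_linear with
  | zero => simp
  | add f f' h h' => rw [Finsupp.mapDomain_add, map_add, map_add, Finsupp.mapDomain_add, h, h']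
  | single x c =>
    rw [Finsupp.mapDomain_single, P_single, P_single, Finsupp.mapDomain_smul,
      Finsupp.mapDomain_smul, Finsupp.mapDomain_finsetSum]
    simp only [Finsupp.mapDomain_single]
    congr 2
    symm
    apply Finset.sum_bij (fun y _ => γ • y)
    · exact fun y hy => T.inv γ x y hy
    · intro y _ z _ h; exact MulAction.injective γ h
    · intro y hy
      refine ⟨γ⁻¹ • y, ?_, by simp⟩
      have := T.inv γ⁻¹ _ _ hy
      simpa using this
    · intros; rfl

lemma Pn_map (n : ℕ) (γ : Γ) (f : X →₀ ℝ) :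
    (T.P ^ n) (f.mapDomain (γ • ·)) = ((T.P ^ n) f).mapDomain (γ • ·) := by
  induction n generalizing f with
  | zero => simp
  | succ n ih => rw [pow_succ, Module.End.mul_apply, Module.End.mul_apply, P_map, ih]

lemma p_inv (n : ℕ) (γ : Γ) (x y : X) : T.p n (γ • x) (γ • y) = T.p n x y := by
  rw [p_eq_dot, p_eq_dot, ← dot_mapDomain γ _ (Finsupp.single y 1), ← Pn_map,
    Finsupp.mapDomain_single, Finsupp.mapDomain_single]

lemma E_inv {W : Type*} [AddCommGroup W] [Module ℝ W] (n : ℕ) (γ : Γ) (f : X → W) (x : X) :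
    T.E n f (γ • x) = T.E n (fun y => f (γ • y)) x := by
  have : Finsupp.single (γ • x) (1:ℝ) = (Finsupp.single x 1).mapDomain (γ • ·) := by
    rw [Finsupp.mapDomain_single]
  rw [E, this, Pn_map, Finsupp.linearCombination_mapDomain]; rfl

variable [MulAction.IsPretransitive Γ X]

/-- return probabilities -/
noncomputable def u (a : X) (n : ℕ) : ℝ := T.p (2*n) a a

lemma u_eq (a x : X) (n : ℕ) : T.p (2*n) x x = T.u a n := by
  obtain ⟨γ, rfl⟩ := MulAction.exists_smul_eq Γ a x
  rw [p_inv]; rfl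

lemma dot_self_pp (a x : X) (n : ℕ) : dot ((T.P ^ n) (Finsupp.single x 1))
    ((T.P ^ n) (Finsupp.single x 1)) = T.u a n := by
  rw [dot_pp, ← two_mul, u_eq]

lemma u_nonneg (a : X) (n : ℕ) : 0 ≤ T.u a n := T.p_nonneg _ _ _

lemma p_even_le (a x y : X) (n : ℕ) : T.p (2*n) x y ≤ T.u a n := by
  have := two_dot_le ((T.P ^ n) (Finsupp.single x 1)) ((T.P ^ n) (Finsupp.single y 1))
  rw [dot_pp, T.dot_self_pp a, T.dot_self_pp a, ← two_mul] at this
  linarith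

lemma p_succ (n : ℕ) (x y : X) : T.p (n+1) x y = T.A (fun z => T.p n z y) x := by
  classical
  rw [p_eq_E, add_comm, E_add_time, E_eq]
  simp only [Function.iterate_one]
  congr 1
  ext z; rw [p_eq_E]

lemma p_odd_le (a x y : X) (n : ℕ) : T.p (2*n+1) x y ≤ T.u a n := by
  rw [p_succ]
  refine (T.A_mono (fun z => T.p_even_le a z y n) x).trans ?_
  rw [A_const]

lemma u_succ_le (a : X) (n : ℕ) : T.u a (n+1) ≤ T.u a n := by
  have : T.u a (n+1) = T.A (fun z => T.p (2*n+1) z a) a := by rw [← p_succ]; rfl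
  rw [this]
  refine (T.A_mono (fun z => T.p_odd_le a z a n) a).trans ?_
  rw [A_const]

lemma u_anti (a : X) : Antitone (T.u a) := antitone_nat_of_succ_le (T.u_succ_le a)

noncomputable def w (a : X) (n : ℕ) : ℝ := T.u a n - T.u a (n+1)

lemma w_nonneg (a : X) (n : ℕ) : 0 ≤ T.w a n := sub_nonneg.2 (T.u_succ_le a n)

/-- `w` as a pairing -/
lemma w_eq_dot (a : X) (m n : ℕ) : T.w a (m+n) = dot ((T.P ^ (2*m)) (Finsupp.single a 1))
    ((T.P ^ (2*n)) (Finsupp.single a 1) - (T.P ^ (2*n+2)) (Finsupp.single a 1)) := by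
  rw [dot_sub_right, dot_pp, dot_pp, w, u, u]
  congr 2 <;> ring

lemma w_diff (a : X) (n : ℕ) : T.w a n - T.w a (n+1) =
    dot ((T.P ^ n) (Finsupp.single a 1) - (T.P ^ (n+2)) (Finsupp.single a 1))
      ((T.P ^ n) (Finsupp.single a 1) - (T.P ^ (n+2)) (Finsupp.single a 1)) := by
  rw [dot_sub_self, dot_pp, dot_pp, dot_pp, w, w, u, u, u]
  rw [show n + (n+2) = 2*(n+1) by ring, show n+2+(n+2) = 2*(n+1+1) by ring, ← two_mul]
  ring

lemma w_anti (a : X) : Antitone (T.w a) :=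
  antitone_nat_of_succ_le fun n => by
    have := T.w_diff a n
    have h2 := dot_self_nonneg ((T.P ^ n) (Finsupp.single a 1) - (T.P ^ (n+2)) (Finsupp.single a 1))
    linarith

/-- polarised form of `w` -/
lemma w_pos_form (a : X) (m n : ℕ) : T.w a (m+n) =
    dot ((T.P ^ (2*m)) (Finsupp.single a 1)) ((T.P ^ (2*n)) (Finsupp.single a 1))
    - dot ((T.P ^ (2*m+1)) (Finsupp.single a 1)) ((T.P ^ (2*n+1)) (Finsupp.single a 1)) := by
  rw [dot_pp, dot_pp, w, u, u]; congr 2 <;> ring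

lemma u_sum_w (a : X) (m n : ℕ) : T.u a m - T.u a (m+n) = ∑ i ∈ Finset.range n, T.w a (m+i) := by
  induction n with
  | zero => simp
  | succ n ih => rw [Finset.sum_range_succ, ← ih, w]; ring_nf

lemma n_mul_w_le (a : X) (n : ℕ) : n * T.w a (2*n) ≤ T.u a n := by
  have h := T.u_sum_w a n n
  have h2 : ∑ i ∈ Finset.range n, T.w a (2*n) ≤ ∑ i ∈ Finset.range n, T.w a (n+i) :=
    Finset.sum_le_sum fun i hi => T.w_anti a (by have := Finset.mem_range.1 hi; omega)
  rw [Finset.sum_const, Finset.card_range, nsmul_eq_mul, ← h] at h2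
  have := T.u_nonneg a (n+n)
  linarith

/-- two-step average of the kernel -/
lemma two_step (a x : X) (n : ℕ) : T.E 2 (fun z => T.p (2*n) z x) x = T.u a (n+1) := by
  classical
  have : (fun z => T.p (2*n) z x) = T.E (2*n) (fun z => if z = x then (1:ℝ) else 0) := by
    ext z; rw [p_eq_E]
  rw [this, ← E_add_time, ← p_eq_E, ← T.u_eq a x]; congr 1; ring

/-- a two-step neighbour -/
def two (x y : X) : Prop := ∃ z ∈ T.nb x, y ∈ T.nb z

lemma two_step_diff (a x y : X) (n : ℕ) (h : T.two x y) :
    T.u a n - T.p (2*n) x y ≤ T.d ^ 2 * T.w a n := by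
  obtain ⟨z, hz, hy⟩ := h
  have hd := T.dR_pos
  have h1 : T.E 2 (fun z => T.u a n - T.p (2*n) z x) x = T.w a n := by
    rw [E_sub, E_const, T.two_step a]; rfl
  rw [E_eq] at h1
  simp only [Function.iterate_succ, Function.comp, Function.iterate_zero, id, A, smul_eq_mul] at h1
  set f : X → ℝ := fun z => T.u a n - T.p (2*n) z x with hf
  have f0 : ∀ z, 0 ≤ f z := fun z => sub_nonneg.2 (T.p_even_le a z x n)
  have h2 : f y ≤ ∑ y ∈ T.nb z, f y := Finset.single_le_sum (fun i _ => f0 i) hy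
  have h3 : 1 / (T.d:ℝ) * ∑ y ∈ T.nb z, f y ≤ ∑ z ∈ T.nb x, 1 / (T.d:ℝ) * ∑ y ∈ T.nb z, f y :=
    Finset.single_le_sum (f := fun z => 1 / (T.d:ℝ) * ∑ y ∈ T.nb z, f y)
      (fun i _ => mul_nonneg (by positivity) (Finset.sum_nonneg fun i _ => f0 i)) hz
  have h4 : T.u a n - T.p (2*n) x y = f y := by rw [hf]; simp only; rw [p_symm]
  rw [h4, ← h1]
  calc f y ≤ _ := h2
    _ = T.d * (1 / (T.d:ℝ) * ∑ y ∈ T.nb z, f y) := by field_simp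
    _ ≤ T.d * ∑ z ∈ T.nb x, 1 / (T.d:ℝ) * ∑ y ∈ T.nb z, f y := by gcongr
    _ = _ := by field_simp

lemma dist_eq (a x y : X) (n : ℕ) :
    dot ((T.P ^ n) (Finsupp.single x 1) - (T.P ^ n) (Finsupp.single y 1))
      ((T.P ^ n) (Finsupp.single x 1) - (T.P ^ n) (Finsupp.single y 1)) =
    2 * (T.u a n - T.p (2*n) x y) := by
  rw [dot_sub_self, T.dot_self_pp a, T.dot_self_pp a, dot_pp, ← two_mul]; ring

/-- chains of two-steps -/
inductive Chain2 (x : X) : ℕ → X → Prop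
  | nil : Chain2 x 0 x
  | cons {r : ℕ} {y z : X} : Chain2 x r y → T.two y z → Chain2 x (r+1) z

lemma chain_diff (a x y : X) (n r : ℕ) (h : T.Chain2 x r y) :
    T.u a n - T.p (2*n) x y ≤ r ^ 2 * (T.d ^ 2 * T.w a n) := by
  induction h with
  | nil => rw [T.u_eq a]; simp
  | @cons r y z hxy hyz ih =>
    have h1 := T.two_step_diff a y z n hyz
    set D := (T.d:ℝ)^2 * T.w a n
    have hD : 0 ≤ D := mul_nonneg (by positivity) (T.w_nonneg a n)
    set f := (T.P ^ n) (Finsupp.single x 1) - (T.P ^ n) (Finsupp.single y 1)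
    set g := (T.P ^ n) (Finsupp.single y 1) - (T.P ^ n) (Finsupp.single z 1)
    have e1 : dot f f ≤ 2 * (r^2 * D) := by rw [T.dist_eq a]; linarith
    have e2 : dot g g ≤ 2 * D := by rw [T.dist_eq a]; linarith
    have e3 : dot (f+g) (f+g) = 2 * (T.u a n - T.p (2*n) x z) := by
      rw [← T.dist_eq a]; congr 1 <;> simp [f, g]
    have e4 : dot f g ≤ 2 * r * D := by
      apply abs_le_of_sq_le_sq' _ (by positivity) |>.2
      calc dot f g ^ 2 ≤ dot f f * dot g g := dot_cs f g
        _ ≤ (2 * (r^2 * D)) * (2 * D) := by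
          gcongr; exact dot_self_nonneg g
        _ = _ := by ring
    rw [dot_add_self] at e3
    push_cast
    nlinarith

lemma P_apply (f : X →₀ ℝ) (x : X) : T.P f x = T.A f x := by
  have h : dot (Finsupp.single x 1) (T.P f) = T.P f x := by rw [dot_single_left, one_mul]
  rw [← h, ← P_symm, dot, lc_P, Finsupp.linearCombination_single, one_smul]

lemma A_sq_le (f : X → ℝ) (x : X) : T.A f x ^ 2 ≤ T.A (fun y => f y ^ 2) x := by
  have hd := T.dR_pos
  have h := sq_sum_le_card_mul_sum_sq (s := T.nb x) (f := f)
  rw [T.card_nb] at h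
  simp only [A, smul_eq_mul]
  rw [mul_pow]
  calc (1 / (T.d:ℝ))^2 * (∑ y ∈ T.nb x, f y)^2 ≤ (1 / (T.d:ℝ))^2 * (T.d * ∑ y ∈ T.nb x, f y ^ 2) := by
        gcongr
    _ = _ := by field_simp

lemma P_contr (f : X →₀ ℝ) : dot (T.P f) (T.P f) ≤ dot f f := by
  have key : ∀ g : X →₀ ℝ, dot g g = Finsupp.linearCombination ℝ (fun _ => (1:ℝ)) (g * g) := by
    intro g
    rw [Finsupp.linearCombination_apply, Finsupp.sum_of_support_subset (s := g.support) _ _ _ (by simp),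
      dot_self_eq_sum]
    · exact Finset.sum_congr rfl fun x _ => by simp [sq]
    · intro x; simp
  have h1 : Finsupp.linearCombination ℝ (fun _ => (1:ℝ)) (T.P (f * f)) =
      Finsupp.linearCombination ℝ (fun _ => (1:ℝ)) (f * f) := by
    rw [lc_P, A_const]
  rw [key, key, ← h1, ← sub_nonneg, ← map_sub, Finsupp.linearCombination_apply]
  apply Finset.sum_nonneg
  intro x _
  have := T.A_sq_le f x
  have e : (T.P (f*f)) x = T.A (fun y => f y ^ 2) x := by
    rw [P_apply]; congr 1; ext y; simp [sq]
  have e2 := T.P_apply f x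
  simp only [Finsupp.sub_apply, Finsupp.mul_apply, smul_eq_mul, mul_one, e, e2]
  nlinarith

lemma cs_of_quad {x y z : ℝ} (h : ∀ t : ℝ, 0 ≤ x + 2 * t * y + t ^ 2 * z) : y ^ 2 ≤ x * z := by
  have := discrim_le_zero (a := z) (b := 2*y) (c := x) (fun t => by have := h t; nlinarith)
  rw [discrim] at this; nlinarith

lemma w_logconvex (a : X) (n : ℕ) : T.w a (n+1) ^ 2 ≤ T.w a n * T.w a (n+2) := by
  apply cs_of_quad
  intro t
  set f := (T.P ^ n) (Finsupp.single a 1)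
  set g := (T.P ^ (n+2)) (Finsupp.single a 1)
  have hf : T.P f = (T.P ^ (n+1)) (Finsupp.single a 1) := by rw [pow_succ']; rfl
  have hg : T.P g = (T.P ^ (n+3)) (Finsupp.single a 1) := by
    rw [pow_succ' _ (n+2)]; rfl
  have h := T.P_contr (f + t • g)
  rw [map_add, map_smul, dot_add_self, dot_add_self, dot_smul_right, dot_smul_right, dot_smul_right,
    dot_smul_right, dot_smul_left, dot_smul_left, hf, hg] at h
  simp only [f, g, dot_pp] at h
  simp only [w, u]
  rw [show n+(n+2) = 2*(n+1) by ring, show n+2+(n+2) = 2*(n+2) by ring,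
    show n+1+(n+1) = 2*(n+1) by ring, show n+1+(n+3) = 2*(n+2) by ring,
    show n+3+(n+3) = 2*(n+3) by ring, ← two_mul] at h
  rw [show n+1+1 = n+2 by ring, show n+2+1 = n+3 by ring]
  nlinarith

end TW
end RotorWalk

namespace RotorWalk
set_option linter.unusedSectionVars false
section rotor
variable {V : Type*} [DecidableEq V]

/-- number of times the rotor at `y` started at `r` points to `z` in its first `m` moves -/
def rN (τ : V → V → V) (y r z : V) (m : ℕ) : ℕ :=
  ((Finset.range m).filter (fun i => (τ y)^[i+1] r = z)).card

lemma rN_succ (τ : V → V → V) (y r z : V) (m : ℕ) :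
    rN τ y r z (m+1) = rN τ y r z m + if (τ y)^[m+1] r = z then 1 else 0 := by
  unfold rN
  rw [Finset.range_add_one, Finset.filter_insert]
  split_ifs
  · rw [Finset.card_insert_of_notMem (fun h => by have := (Finset.mem_filter.1 h).1; simp at this)]
  · rfl

lemma rN_zero (τ : V → V → V) (y r z : V) : rN τ y r z 0 = 0 := by
  rw [rN, Finset.range_zero, Finset.filter_empty, Finset.card_empty]

lemma rN_mono (τ : V → V → V) (y r z : V) : Monotone (rN τ y r z) :=
  monotone_nat_of_le_succ fun m => by rw [rN_succ]; omega

lemma rN_add (τ : V → V → V) (y r z : V) (m k : ℕ) :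
    rN τ y r z (m+k) = rN τ y r z m + rN τ y ((τ y)^[m] r) z k := by
  induction k with
  | zero => simp [rN_zero]
  | succ k ih =>
    rw [← add_assoc, rN_succ, ih, rN_succ, ← Function.iterate_add_apply]
    rw [show k + 1 + m = m + k + 1 by ring, add_assoc]

def cnt (τ : V → V → V) (a : V) (ρ : V → V) (t : ℕ) (y : V) : ℕ :=
  ((Finset.range t).filter (fun s => pos τ a ρ s = y)).card

lemma cnt_zero (τ : V → V → V) (a : V) (ρ : V → V) (y : V) : cnt τ a ρ 0 y = 0 := by
  rw [cnt, Finset.range_zero, Finset.filter_empty, Finset.card_empty]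

lemma cnt_succ (τ : V → V → V) (a : V) (ρ : V → V) (t : ℕ) (y : V) :
    cnt τ a ρ (t+1) y = cnt τ a ρ t y + if pos τ a ρ t = y then 1 else 0 := by
  unfold cnt
  rw [Finset.range_add_one, Finset.filter_insert]
  split_ifs
  · rw [Finset.card_insert_of_notMem (fun h => by have := (Finset.mem_filter.1 h).1; simp at this)]
  · rfl

lemma conf_eq (τ : V → V → V) (a : V) (ρ : V → V) (t : ℕ) (y : V) :
    conf τ a ρ t y = (τ y)^[cnt τ a ρ t y] (ρ y) := by
  induction t with
  | zero => simp [conf, traj, cnt_zero]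
  | succ t ih =>
    rw [cnt_succ]
    have : conf τ a ρ (t+1) = Function.update (conf τ a ρ t) (pos τ a ρ t)
      (τ (pos τ a ρ t) (conf τ a ρ t (pos τ a ρ t))) := rfl
    rw [this]
    by_cases h : pos τ a ρ t = y
    · subst h
      simp [ih, Function.iterate_succ_apply']
    · rw [Function.update_of_ne (Ne.symm h), ih]; simp [h]

lemma pos_succ (τ : V → V → V) (a : V) (ρ : V → V) (t : ℕ) :
    pos τ a ρ (t+1) = (τ (pos τ a ρ t))^[cnt τ a ρ t (pos τ a ρ t) + 1] (ρ (pos τ a ρ t)) := by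
  have : pos τ a ρ (t+1) = τ (pos τ a ρ t) (conf τ a ρ t (pos τ a ρ t)) := rfl
  rw [this, conf_eq, Function.iterate_succ_apply']

lemma flow (τ : V → V → V) (a : V) (ρ : V → V) (t : ℕ) (z : V) (Y : Finset V) :
    (if a = z then 1 else 0) + ∑ y ∈ Y, rN τ y (ρ y) z (cnt τ a ρ t y) ≤ cnt τ a ρ (t+1) z := by
  induction t with
  | zero =>
    have : pos τ a ρ 0 = a := rfl
    simp [cnt_succ, rN_zero, cnt_zero, this]
  | succ t ih =>
    rw [cnt_succ τ a ρ (t+1)]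
    have : ∑ y ∈ Y, rN τ y (ρ y) z (cnt τ a ρ (t+1) y) ≤
      ∑ y ∈ Y, rN τ y (ρ y) z (cnt τ a ρ t y) + if pos τ a ρ (t+1) = z then 1 else 0 := by
      have h1 : ∀ y ∈ Y, rN τ y (ρ y) z (cnt τ a ρ (t+1) y) = rN τ y (ρ y) z (cnt τ a ρ t y) +
          if pos τ a ρ t = y then (if pos τ a ρ (t+1) = z then 1 else 0) else 0 := by
        intro y _
        rw [cnt_succ]
        by_cases h : pos τ a ρ t = y
        · simp only [h, if_true]
          rw [rN_succ, pos_succ, h]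
        · simp [h]
      rw [Finset.sum_congr rfl h1, Finset.sum_add_distrib, Finset.sum_ite_eq]
      split_ifs <;> simp
    omega

/-- total number of visits -/
noncomputable def od (τ : V → V → V) (a : V) (ρ : V → V) (x : V) : ℕ :=
  {t : ℕ | pos τ a ρ t = x}.ncard

lemma aliveAt_empty (τ : V → V → V) (a : V) (ρ : V → V) (t : ℕ) : aliveAt τ ∅ a ρ t := by
  intro s _; simp

lemma odometer_eq {τ : V → V → V} {a : V} {ρ : V → V} (h : IsTransientWalk τ ∅ a ρ) (x : V) :
    odometer τ ∅ a ρ x = (od τ a ρ x : ℕ∞) := by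
  have := h x
  simp only [aliveAt_empty, true_and] at this
  simp only [odometer, aliveAt_empty, true_and, od]
  rw [Set.Finite.cast_ncard_eq this]

lemma cnt_eventually {τ : V → V → V} {a : V} {ρ : V → V} (h : IsTransientWalk τ ∅ a ρ) (x : V) :
    ∀ᶠ t in atTop, cnt τ a ρ t x = od τ a ρ x := by
  have hf := h x
  simp only [aliveAt_empty, true_and] at hf
  obtain ⟨M, hM⟩ := hf.bddAbove
  filter_upwards [eventually_gt_atTop M] with t ht
  rw [od, cnt, ← Set.ncard_coe_finset]
  congr 1
  ext s
  simp only [Finset.coe_filter, Finset.mem_range, Set.mem_ofPred_eq]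
  exact ⟨fun h => h.2, fun h => ⟨lt_of_le_of_lt (hM h) ht, h⟩⟩

lemma finalConf_eq {τ : V → V → V} {a : V} {ρ : V → V} (h : IsTransientWalk τ ∅ a ρ) (x : V) :
    finalConf τ ∅ a ρ x = (τ x)^[od τ a ρ x] (ρ x) := by
  have h1 : ∀ᶠ t in atTop, conf τ a ρ t x = (τ x)^[od τ a ρ x] (ρ x) := by
    filter_upwards [cnt_eventually h x] with t ht
    rw [conf_eq, ht]
  unfold finalConf
  have hex : ∃ v, ∀ᶠ t in atTop, conf τ a ρ t x = v := ⟨_, h1⟩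
  simp only [mem_empty_iff_false, exists_const, if_false, dif_pos hex]
  obtain ⟨t, ht, ht'⟩ := (hex.choose_spec.and h1).exists
  rw [← ht, ht']

lemma od_flow {τ : V → V → V} {a : V} {ρ : V → V} (h : IsTransientWalk τ ∅ a ρ) (z : V)
    (Y : Finset V) :
    (if a = z then 1 else 0) + ∑ y ∈ Y, rN τ y (ρ y) z (od τ a ρ y) ≤ od τ a ρ z := by
  have h1 : ∀ᶠ t in atTop, ∀ y ∈ Y, cnt τ a ρ t y = od τ a ρ y :=
    (Finset.eventually_all Y).2 fun y _ => cnt_eventually h y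
  have h2 := (tendsto_add_atTop_nat 1).eventually (cnt_eventually h z)
  obtain ⟨t, ht, ht'⟩ := (h1.and h2).exists
  rw [← ht', Finset.sum_congr rfl fun y hy => by rw [← ht y hy]]
  exact flow τ a ρ t z Y

noncomputable def U (τ : V → V → V) (a : V) (ρ : V → V) (n : ℕ) (x : V) : ℕ :=
  ∑ i ∈ Finset.range n, od τ a ((finalConf τ ∅ a)^[i] ρ) x

lemma iter_conf {τ : V → V → V} {a : V} {ρ : V → V} {n : ℕ}
    (h : ∀ i < n, IsTransientWalk τ ∅ a ((finalConf τ ∅ a)^[i] ρ)) (x : V) :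
    (finalConf τ ∅ a)^[n] ρ x = (τ x)^[U τ a ρ n x] (ρ x) := by
  induction n with
  | zero => simp [U]
  | succ n ih =>
    rw [Function.iterate_succ_apply', finalConf_eq (h n (by omega)),
      ih (fun i hi => h i (by omega)), ← Function.iterate_add_apply, U, U, Finset.sum_range_succ,
      add_comm]

lemma U_flow {τ : V → V → V} {a : V} {ρ : V → V} {n : ℕ}
    (h : ∀ i < n, IsTransientWalk τ ∅ a ((finalConf τ ∅ a)^[i] ρ)) (z : V) (Y : Finset V) :
    (if a = z then n else 0) + ∑ y ∈ Y, rN τ y (ρ y) z (U τ a ρ n y) ≤ U τ a ρ n z := by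
  induction n with
  | zero => simp [U, rN_zero]
  | succ n ih =>
    have h0 : ∀ i < n, IsTransientWalk τ ∅ a ((finalConf τ ∅ a)^[i] ρ) := fun i hi => h i (by omega)
    have ih := ih h0
    have h1 := od_flow (h n (by omega)) z Y
    have h2 : ∀ y, U τ a ρ (n+1) y = U τ a ρ n y + od τ a ((finalConf τ ∅ a)^[n] ρ) y :=
      fun y => by rw [U, Finset.sum_range_succ]; rfl
    have h3 : ∑ y ∈ Y, rN τ y (ρ y) z (U τ a ρ (n+1) y) = ∑ y ∈ Y, rN τ y (ρ y) z (U τ a ρ n y) +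
      ∑ y ∈ Y, rN τ y ((finalConf τ ∅ a)^[n] ρ y) z (od τ a ((finalConf τ ∅ a)^[n] ρ) y) := by
      rw [← Finset.sum_add_distrib]
      refine Finset.sum_congr rfl fun y _ => ?_
      rw [h2, rN_add, iter_conf h0]
    rw [h3, h2 z]
    split_ifs at * <;> omega

lemma Svis_eq {τ : V → V → V} {a : V} {ρ : V → V} {n : ℕ}
    (h : ∀ i < n, IsTransientWalk τ ∅ a ((finalConf τ ∅ a)^[i] ρ)) (x : V) :
    Svis τ ∅ a ρ n x = (U τ a ρ n x : ℕ∞) := by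
  rw [Svis, U, Nat.cast_sum]
  exact Finset.sum_congr rfl fun i hi => odometer_eq (h i (Finset.mem_range.1 hi)) x

variable {G : SimpleGraph V} [G.LocallyFinite]

lemma iter_adj {τ : V → V → V} (hτ : ValidMechanism G ∅ τ) {y r : V} (hr : G.Adj y r) (i : ℕ) :
    G.Adj y ((τ y)^[i] r) := by
  induction i with
  | zero => exact hr
  | succ i ih => rw [Function.iterate_succ_apply']; exact (hτ y (by simp)).1 _ ih

lemma hit {τ : V → V → V} (hτ : ValidMechanism G ∅ τ) {y r z : V} (hr : G.Adj y r)
    (hz : G.Adj y z) : ∃ i < G.degree y, (τ y)^[i] r = z := by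
  classical
  have hex := (hτ y (by simp)).2 r hr z hz
  refine ⟨Nat.find hex, ?_, Nat.find_spec hex⟩
  by_contra hlt
  push Not at hlt
  set i := Nat.find hex with hi
  have hspec : (τ y)^[i] r = z := Nat.find_spec hex
  have hc : (G.neighborFinset y).card < (Finset.range (i+1)).card := by
    rw [Finset.card_range, G.card_neighborFinset_eq_degree]; omega
  obtain ⟨j, hj, k, hk, hjk, he⟩ := Finset.exists_ne_map_eq_of_card_lt_of_maps_to hc
    (f := fun j => (τ y)^[j] r) (fun j _ => by simpa using iter_adj hτ hr j)
  have key : ∀ j k, j < k → k ≤ i → (τ y)^[j] r = (τ y)^[k] r → False := by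
    intro j k hjk hk he
    have : (τ y)^[i - k + j] r = z := by
      rw [Function.iterate_add_apply, he, ← Function.iterate_add_apply, ← hspec]
      congr 1; omega
    exact Nat.find_min hex (m := i - k + j) (by omega) this
  rw [Finset.mem_range] at hj hk
  rcases lt_or_gt_of_ne hjk with h | h
  · exact key j k h (by omega) he
  · exact key k j h (by omega) he.symm

lemma rN_lower {τ : V → V → V} (hτ : ValidMechanism G ∅ τ) {y r z : V} (hr : G.Adj y r)
    (hz : G.Adj y z) (m : ℕ) : (m:ℝ) / G.degree y - 1 ≤ rN τ y r z m := by
  have hd : 0 < G.degree y := by rw [G.degree_pos_iff_exists_adj]; exact ⟨z, hz⟩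
  have h1 : ∀ r, G.Adj y r → 1 ≤ rN τ y r z (G.degree y) := by
    intro r hr
    obtain ⟨i, hi, h⟩ := hit hτ ((hτ y (by simp)).1 _ hr) hz
    rw [rN, Nat.one_le_iff_ne_zero, ← Nat.pos_iff_ne_zero, Finset.card_pos]
    exact ⟨i, Finset.mem_filter.2 ⟨by simpa using hi, by rw [Function.iterate_succ_apply, h]⟩⟩
  have h2 : ∀ q, q ≤ rN τ y r z (q * G.degree y) := by
    intro q
    induction q with
    | zero => simp
    | succ q ih =>
      rw [add_mul, one_mul, rN_add]
      have := h1 _ (iter_adj hτ hr (q * G.degree y))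
      omega
  have h3 : m / G.degree y ≤ rN τ y r z m := (h2 _).trans (rN_mono _ _ _ _ (Nat.div_mul_le_self _ _))
  have h4 : (m:ℝ) / G.degree y < (m / G.degree y : ℕ) + 1 := by
    rw [div_lt_iff₀ (by exact_mod_cast hd)]
    exact_mod_cast Nat.lt_mul_of_div_lt (Nat.lt_succ_self _) hd
  have h5 : ((m / G.degree y : ℕ):ℝ) ≤ rN τ y r z m := by exact_mod_cast h3
  linarith

/-- iteration from below -/
def lowIter (G : SimpleGraph V) [G.LocallyFinite] (τ : V → V → V) (a : V) (ρ : V → V) (n : ℕ) :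
    ℕ → V → ℕ
  | 0 => fun _ => 0
  | t + 1 => fun z => (if a = z then n else 0) +
      ∑ y ∈ G.neighborFinset z, rN τ y (ρ y) z (lowIter G τ a ρ n t y)

lemma lowIter_le {τ : V → V → V} {a : V} {ρ : V → V} {n : ℕ}
    (h : ∀ i < n, IsTransientWalk τ ∅ a ((finalConf τ ∅ a)^[i] ρ)) (t : ℕ) (z : V) :
    lowIter G τ a ρ n t z ≤ U τ a ρ n z := by
  induction t generalizing z with
  | zero => simp [lowIter]
  | succ t ih =>
    rw [lowIter]
    refine le_trans ?_ (U_flow h z (G.neighborFinset z))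
    exact Nat.add_le_add_left (Finset.sum_le_sum fun y _ => rN_mono _ _ _ _ (ih y)) _

lemma rotor_lower {τ : V → V → V} (hτ : ValidMechanism G ∅ τ) {a : V} {ρ : V → V}
    (hρ : ValidConfig G ∅ ρ) {n d : ℕ} (hd : ∀ x, G.degree x = d)
    (h : ∀ i < n, IsTransientWalk τ ∅ a ((finalConf τ ∅ a)^[i] ρ))
    (g : ℕ → V → ℝ) (g0 : ∀ z, g 0 z = if a = z then 1 else 0)
    (gs : ∀ s z, g (s+1) z = (1 / (d:ℝ)) * ∑ y ∈ G.neighborFinset z, g s y) (t : ℕ) (x : V) :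
    n * ∑ s ∈ Finset.range t, g s x - d * t ≤ U τ a ρ n x := by
  have key : ∀ t x, n * ∑ s ∈ Finset.range t, g s x - d * t ≤ lowIter G τ a ρ n t x := by
    intro t
    induction t with
    | zero => simp [lowIter]
    | succ t ih =>
      intro x
      rw [lowIter]
      have dpos : (0:ℝ) < d := by
        rw [← hd a]; exact_mod_cast (G.degree_pos_iff_exists_adj a).2 ⟨_, hρ a (by simp)⟩
      have h1 : ∑ y ∈ G.neighborFinset x,
          ((n * ∑ s ∈ Finset.range t, g s y - d * t) / d - 1) ≤
          ∑ y ∈ G.neighborFinset x, (rN τ y (ρ y) x (lowIter G τ a ρ n t y) : ℝ) := by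
        refine Finset.sum_le_sum fun y hy => ?_
        have hy' : G.Adj y x := by simpa [G.adj_comm] using hy
        refine le_trans ?_ (rN_lower hτ (hρ y (by simp)) hy' _)
        rw [hd]
        gcongr
        exact ih y
      have h2 : ∑ y ∈ G.neighborFinset x,
          ((n * ∑ s ∈ Finset.range t, g s y - d * t) / d - 1) =
          n * ∑ s ∈ Finset.range t, g (s+1) x - d * t - d := by
        simp only [Finset.sum_sub_distrib, sub_div, Finset.sum_const,
          G.card_neighborFinset_eq_degree, hd, nsmul_eq_mul, gs]
        rw [← Finset.sum_div, ← Finset.mul_sum, Finset.sum_comm, ← Finset.mul_sum]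
        field_simp
      push_cast
      rw [Finset.sum_range_succ', g0]
      rw [h2] at h1
      split_ifs <;> simp <;> linarith
  exact (key t x).trans (by exact_mod_cast lowIter_le h t x)

end rotor
end RotorWalk

namespace RotorWalk
set_option linter.unusedSectionVars false
section reduction
variable {V : Type*} [DecidableEq V] {G : SimpleGraph V} [G.LocallyFinite]
variable {Γ : Type*} [Group Γ] [MulAction Γ V] [MulAction.IsPretransitive Γ V] (T : TW Γ V)

lemma p_zero_eq (x a : V) : T.p 0 x a = if a = x then 1 else 0 := by
  simp [TW.p, Finsupp.single_apply, eq_comm]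

lemma srw_eq (hnb : ∀ x, T.nb x = G.neighborFinset x) (a : V) (t : ℕ) (x : V) :
    srw G ∅ a t x = ENNReal.ofReal (T.p t x a) := by
  have hdeg : ∀ y, G.degree y = T.d := fun y => by
    rw [← T.card_nb y, hnb, G.card_neighborFinset_eq_degree]
  induction t generalizing x with
  | zero =>
    rw [p_zero_eq, srw]
    by_cases h : a = x
    · simp [h]
    · rw [Set.indicator_of_notMem (by simpa using Ne.symm h)]; simp [h]
  | succ t ih =>
    rw [srw, T.p_succ]
    have h1 : ∀ y, Set.indicator {y | G.Adj y x ∧ y ∉ (∅:Set V)}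
        (fun y => srw G ∅ a t y / (G.degree y : ℝ≥0∞)) y =
        if y ∈ G.neighborFinset x then ENNReal.ofReal (T.p t y a / T.d) else 0 := by
      classical
      intro y
      rw [Set.indicator_apply]
      have : y ∈ {y | G.Adj y x ∧ y ∉ (∅:Set V)} ↔ y ∈ G.neighborFinset x := by
        simp [G.adj_comm]
      simp only [this]
      split_ifs
      · rw [ih, hdeg, ENNReal.ofReal_div_of_pos T.dR_pos, ENNReal.ofReal_natCast]
      · rfl
    simp only [h1]
    rw [tsum_eq_sum (s := G.neighborFinset x) (by intro b hb; simp [hb])]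
    rw [Finset.sum_congr rfl (fun y hy => if_pos hy), ← ENNReal.ofReal_sum_of_nonneg]
    · congr 1
      rw [TW.A, hnb, ← Finset.sum_div, smul_eq_mul]; ring
    · intro y _; exact div_nonneg (T.p_nonneg _ _ _) T.dR_pos.le

set_option maxHeartbeats 400000 in
lemma main_of_heat (hnb : ∀ x, T.nb x = G.neighborFinset x)
    (τ : V → V → V) (hτ : ValidMechanism G ∅ τ) (a : V) (C1 : ℝ)
    (hC : ∀ t x, T.p t x a ≤ C1 * ((t:ℝ)+1) ^ (-(5/4):ℝ)) :
    ∃ C : ℝ≥0∞, 0 < C ∧ C ≠ ⊤ ∧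
      ∀ ρ : V → V, ValidConfig G ∅ ρ → ∀ n : ℕ, 1 ≤ n → ∀ x : V,
        green G ∅ a x - C / (ENNReal.ofReal (Real.log n)) ^ 2 ≤
          (SvisT τ a ρ n x : ℝ≥0∞) / (n : ℝ≥0∞) := by
  have hdeg : ∀ y, G.degree y = T.d := fun y => by
    rw [← T.card_nb y, hnb, G.card_neighborFinset_eq_degree]
  have hC1 : 0 ≤ C1 := by
    have := (T.p_nonneg 0 a a).trans (hC 0 a); simpa using this
  have hsum : Summable (fun t : ℕ => ((t:ℝ)+1) ^ (-(9/8):ℝ)) := by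
    have := (summable_nat_add_iff 1).2 (Real.summable_nat_rpow.2 (show (-(9/8):ℝ) < -1 by norm_num))
    simpa using this
  set S := ∑' t : ℕ, ((t:ℝ)+1) ^ (-(9/8):ℝ) with hS
  have hS0 : 0 ≤ S := tsum_nonneg fun t => by positivity
  set K : ℝ := C1 * S + T.d with hK
  have hK0 : 0 < K := by have := T.dR_pos; positivity
  refine ⟨ENNReal.ofReal (K * 32^2), by rw [ENNReal.ofReal_pos]; positivity, ENNReal.ofReal_ne_top, ?_⟩
  intro ρ hρ n hn x
  rw [SvisT]
  split_ifs with htr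
  swap
  · have : ((⊤:ℕ∞) : ℝ≥0∞) / (n:ℝ≥0∞) = ⊤ := by
      rw [ENat.toENNReal_top]; exact ENNReal.top_div_of_ne_top (by simp)
    rw [this]; exact le_top
  rcases Nat.lt_or_ge 1 n with hn1 | hn1
  swap
  · have : n = 1 := by omega
    subst this
    have : ENNReal.ofReal (K * 32^2) / (ENNReal.ofReal (Real.log (1:ℕ))) ^ 2 = ⊤ := by
      simp only [Nat.cast_one, Real.log_one, ENNReal.ofReal_zero, ne_eq, OfNat.ofNat_ne_zero,
        not_false_eq_true, zero_pow]
      rw [ENNReal.div_zero]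
      simpa using hK0
    rw [this]; simp
  rw [tsub_le_iff_right, Svis_eq htr]
  set N := Nat.sqrt n with hN
  have hnR : (1:ℝ) < n := by exact_mod_cast hn1
  have hlog : 0 < Real.log n := Real.log_pos hnR
  have hg : green G ∅ a x = ∑' t, ENNReal.ofReal (T.p t x a) := by
    rw [green, Set.indicator_of_mem (by simp)]
    exact tsum_congr fun t => srw_eq T hnb a t x
  have hNlt : (n:ℝ) ^ (1/2:ℝ) ≤ (N:ℝ) + 1 := by
    rw [← Real.sqrt_eq_rpow, Real.sqrt_le_left (by positivity)]
    have := Nat.lt_succ_sqrt n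
    have : n ≤ (N+1)^2 := by rw [sq]; exact this.le
    exact_mod_cast this
  have hNle : (N:ℝ) ≤ (n:ℝ) ^ (1/2:ℝ) := by
    rw [← Real.sqrt_eq_rpow]; exact Real.nat_sqrt_le_real_sqrt
  set δ : ℝ := (n:ℝ) ^ (-(1/16):ℝ) with hδ
  have tail : ∀ t : ℕ, T.p (t + N) x a ≤ C1 * δ * ((t:ℝ)+1) ^ (-(9/8):ℝ) := by
    intro t
    refine (hC (t+N) x).trans ?_
    push_cast
    rw [mul_assoc]
    gcongr
    have e : (-(5/4):ℝ) = -(1/8) + -(9/8) := by norm_num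
    rw [e, Real.rpow_add (by positivity)]
    have h1 : ((t:ℝ)+N+1) ^ (-(1/8):ℝ) ≤ δ := by
      have : δ = ((n:ℝ)^(1/2:ℝ)) ^ (-(1/8):ℝ) := by
        rw [← Real.rpow_mul (by positivity), hδ]; norm_num
      rw [this]
      apply Real.rpow_le_rpow_of_nonpos (by positivity) _ (by norm_num)
      have : (0:ℝ) ≤ t := by positivity
      linarith
    have h2 : ((t:ℝ)+N+1) ^ (-(9/8):ℝ) ≤ ((t:ℝ)+1) ^ (-(9/8):ℝ) := by
      apply Real.rpow_le_rpow_of_nonpos (by positivity) _ (by norm_num)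
      have : (0:ℝ) ≤ N := by positivity
      linarith
    gcongr
  have htail : ∑' t, ENNReal.ofReal (T.p (t+N) x a) ≤ ENNReal.ofReal (C1 * δ * S) := by
    calc _ ≤ ∑' t:ℕ, ENNReal.ofReal (C1 * δ * ((t:ℝ)+1) ^ (-(9/8):ℝ)) :=
          ENNReal.tsum_le_tsum fun t => ENNReal.ofReal_le_ofReal (tail t)
      _ = ENNReal.ofReal (∑' t:ℕ, C1 * δ * ((t:ℝ)+1) ^ (-(9/8):ℝ)) :=
          (ENNReal.ofReal_tsum_of_nonneg (fun t => by positivity) (hsum.mul_left _)).symm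
      _ = _ := by rw [tsum_mul_left]
  have hhead := rotor_lower (G := G) hτ hρ (n := n) (d := T.d) hdeg htr (fun s z => T.p s z a)
    (fun z => p_zero_eq T z a) (fun s z => by rw [T.p_succ, TW.A, hnb, smul_eq_mul]) N x
  have hδn : (N:ℝ) ≤ n * δ := by
    refine hNle.trans ?_
    have : (n:ℝ) * δ = n ^ (15/16:ℝ) := by
      rw [hδ]; nth_rewrite 1 [← Real.rpow_one (n:ℝ)]
      rw [← Real.rpow_add (by positivity)]; norm_num
    rw [this]
    exact Real.rpow_le_rpow_of_exponent_le hnR.le (by norm_num)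
  have hhead2 : ∑ s ∈ Finset.range N, T.p s x a ≤ (U τ a ρ n x : ℝ) / n + T.d * δ := by
    have hn0 : (0:ℝ) < n := by linarith
    rw [← sub_le_iff_le_add, le_div_iff₀ hn0]
    have := mul_le_mul_of_nonneg_left hδn T.dR_pos.le
    nlinarith
  have hsplit : green G ∅ a x = ENNReal.ofReal (∑ s ∈ Finset.range N, T.p s x a) +
      ∑' t, ENNReal.ofReal (T.p (t+N) x a) := by
    rw [hg, ENNReal.ofReal_sum_of_nonneg fun s _ => T.p_nonneg _ _ _]
    exact (Summable.sum_add_tsum_nat_add' (f := fun t => ENNReal.ofReal (T.p t x a)) ENNReal.summable).symm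
  have hlogb : K * δ ≤ K * 32^2 / (Real.log n)^2 := by
    rw [le_div_iff₀ (by positivity), mul_assoc]
    gcongr
    have h1 : Real.log n ≤ (n:ℝ)^(1/32:ℝ) / (1/32) := Real.log_le_rpow_div (by positivity) (by norm_num)
    have h2 : Real.log n ≤ 32 * (n:ℝ)^(1/32:ℝ) := by linarith
    calc δ * Real.log n ^ 2 ≤ δ * (32 * (n:ℝ)^(1/32:ℝ))^2 := by gcongr
      _ = 32^2 * (δ * ((n:ℝ)^(1/32:ℝ) * (n:ℝ)^(1/32:ℝ))) := by ring
      _ = 32^2 := by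
        rw [hδ, ← Real.rpow_add (by positivity), ← Real.rpow_add (by positivity)]; norm_num
  rw [hsplit]
  calc _ ≤ ENNReal.ofReal ((U τ a ρ n x : ℝ) / n + T.d * δ) + ENNReal.ofReal (C1 * δ * S) :=
        add_le_add (ENNReal.ofReal_le_ofReal hhead2) htail
    _ = ENNReal.ofReal ((U τ a ρ n x : ℝ) / n) + ENNReal.ofReal (K * δ) := by
        have := T.dR_pos
        rw [← ENNReal.ofReal_add (by positivity) (by positivity),
          ← ENNReal.ofReal_add (by positivity) (by positivity)]
        congr 1; rw [hK]; ring
    _ ≤ _ := by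
        refine add_le_add ?_ ?_
        · rw [ENNReal.ofReal_div_of_pos (by linarith)]; simp
        · rw [← ENNReal.ofReal_pow hlog.le, ← ENNReal.ofReal_div_of_pos (by positivity)]
          exact ENNReal.ofReal_le_ofReal hlogb
end reduction
end RotorWalk

namespace RotorWalk
set_option linter.unusedSectionVars false
namespace TW
variable {Γ X : Type*} [Group Γ] [MulAction Γ X] [MulAction.IsPretransitive Γ X] (T : TW Γ X)

lemma u_le_one (a : X) (n : ℕ) : T.u a n ≤ 1 := by
  simpa [u] using T.p_sum_le (2*n) a {a}

lemma heat_dich (a : X) (c : ℝ) (hc : 0 < c)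
    (hg : ∀ r : ℕ, 1 ≤ r → ∃ s : Finset X, (∀ y ∈ s, ∃ k ≤ r, T.Chain2 a k y) ∧
      c * ((r:ℝ)^2) ^ (5/4:ℝ) ≤ s.card) (n : ℕ) (hn : 1 ≤ n)
    (h3 : T.u a n ≤ 3 * T.u a (2*n)) :
    T.u a (2*n) ≤ (1 + 2/c) * (48 * (T.d:ℝ)^2) ^ (5/4:ℝ) * ((2*n:ℕ):ℝ) ^ (-(5/4):ℝ) := by
  have hd : 1 ≤ T.d := T.d_pos
  have hdR : (1:ℝ) ≤ T.d := by exact_mod_cast hd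
  have hn0 : (0:ℝ) < n := by exact_mod_cast hn
  rw [Real.rpow_neg (by positivity), ← div_eq_mul_inv, le_div_iff₀ (by positivity)]
  have hu1 := T.u_le_one a (2*n)
  have hu0 := T.u_nonneg a (2*n)
  rcases Nat.lt_or_ge n (6 * T.d^2) with hlt | hge
  · have h1 : ((2*n:ℕ):ℝ) ^ (5/4:ℝ) ≤ (48 * (T.d:ℝ)^2) ^ (5/4:ℝ) := by
      gcongr
      have : (2*n) ≤ 48 * T.d^2 := by omega
      exact_mod_cast this
    have h2 : 0 ≤ (2/c) * (48 * (T.d:ℝ)^2) ^ (5/4:ℝ) := by positivity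
    calc _ ≤ 1 * ((2*n:ℕ):ℝ) ^ (5/4:ℝ) := by gcongr
      _ ≤ _ := by linarith
  · set q := n / (6 * T.d^2) with hq
    have hq1 : 1 ≤ q := (Nat.one_le_div_iff (by positivity)).2 hge
    set r := Nat.sqrt q with hr
    have hr1 : 1 ≤ r := by rw [hr, Nat.le_sqrt]; exact hq1
    have hr2 : r^2 * (6 * T.d^2) ≤ n := by
      calc r^2 * (6 * T.d^2) ≤ q * (6 * T.d^2) := by
            gcongr; exact Nat.sqrt_le' q
        _ ≤ n := Nat.div_mul_le_self _ _
    have hr3 : n ≤ 24 * T.d^2 * r^2 := by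
      have h1 : q < (r+1)^2 := Nat.lt_succ_sqrt' q
      have h2 : n < (r+1)^2 * (6 * T.d^2) := (Nat.div_lt_iff_lt_mul (by positivity)).1 h1
      have h3 : (r+1)^2 ≤ 4 * r^2 := by nlinarith
      have := Nat.mul_le_mul_right (6 * T.d^2) h3
      nlinarith
    obtain ⟨s, hs, hcard⟩ := hg r hr1
    have hlow : ∀ y ∈ s, T.u a (2*n) / 2 ≤ T.p (2*(2*n)) a y := by
      intro y hy
      obtain ⟨k, hk, hch⟩ := hs y hy
      have h1 := T.chain_diff a a y (2*n) k hch
      have h2 := T.n_mul_w_le a n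
      have hw := T.w_nonneg a (2*n)
      have h4 : (k:ℝ)^2 * (T.d^2 * T.w a (2*n)) ≤ r^2 * (T.d^2 * T.w a (2*n)) := by gcongr
      have h5 : (r:ℝ)^2 * (6 * T.d^2) ≤ n := by exact_mod_cast hr2
      have h6 := mul_le_mul_of_nonneg_right h5 hw
      nlinarith
    have h7 : s.card * (T.u a (2*n) / 2) ≤ 1 := by
      calc (s.card:ℝ) * (T.u a (2*n) / 2) = ∑ y ∈ s, T.u a (2*n) / 2 := by simp
        _ ≤ ∑ y ∈ s, T.p (2*(2*n)) a y := Finset.sum_le_sum hlow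
        _ ≤ 1 := T.p_sum_le _ _ _
    have h8 : c * ((r:ℝ)^2) ^ (5/4:ℝ) * (T.u a (2*n) / 2) ≤ 1 :=
      (mul_le_mul_of_nonneg_right hcard (by positivity)).trans h7
    have h9 : ((2*n:ℕ):ℝ) ^ (5/4:ℝ) ≤ (48 * (T.d:ℝ)^2) ^ (5/4:ℝ) * ((r:ℝ)^2) ^ (5/4:ℝ) := by
      rw [← Real.mul_rpow (by positivity) (by positivity)]
      gcongr
      have : 2 * n ≤ 48 * T.d^2 * r^2 := by nlinarith
      exact_mod_cast this
    have h10 : T.u a (2*n) * ((r:ℝ)^2) ^ (5/4:ℝ) ≤ 2 / c := by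
      rw [le_div_iff₀ hc]; nlinarith
    calc _ ≤ T.u a (2*n) * ((48 * (T.d:ℝ)^2) ^ (5/4:ℝ) * ((r:ℝ)^2) ^ (5/4:ℝ)) := by gcongr
      _ = (T.u a (2*n) * ((r:ℝ)^2) ^ (5/4:ℝ)) * (48 * (T.d:ℝ)^2) ^ (5/4:ℝ) := by ring
      _ ≤ (1 + 2/c) * (48 * (T.d:ℝ)^2) ^ (5/4:ℝ) := by
        gcongr; linarith

lemma heat_of_growth (a : X) (c : ℝ) (hc : 0 < c)
    (hg : ∀ r : ℕ, 1 ≤ r → ∃ s : Finset X, (∀ y ∈ s, ∃ k ≤ r, T.Chain2 a k y) ∧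
      c * ((r:ℝ)^2) ^ (5/4:ℝ) ≤ s.card) :
    ∃ C1 : ℝ, ∀ t x, T.p t x a ≤ C1 * ((t:ℝ)+1) ^ (-(5/4):ℝ) := by
  have hd : 1 ≤ T.d := T.d_pos
  have hdR : (1:ℝ) ≤ T.d := by exact_mod_cast hd
  set C := (1 + 2/c) * (48 * (T.d:ℝ)^2) ^ (5/4:ℝ) with hC
  have hC1 : 1 ≤ C := by
    have h1 : (1:ℝ) ≤ (48 * (T.d:ℝ)^2) ^ (5/4:ℝ) := Real.one_le_rpow (by nlinarith) (by norm_num)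
    have : 0 ≤ 2 / c := by positivity
    rw [hC]; nlinarith
  have hpow : ∀ k, T.u a (2^k) ≤ C * ((2^k:ℕ):ℝ) ^ (-(5/4):ℝ) := by
    intro k
    induction k with
    | zero => simpa using (T.u_le_one a 1).trans hC1
    | succ k ih =>
      by_cases h3 : T.u a (2^k) ≤ 3 * T.u a (2*2^k)
      · have := T.heat_dich a c hc hg (2^k) Nat.one_le_two_pow h3
        rwa [← pow_succ'] at this
      · push Not at h3
        rw [← pow_succ'] at h3
        have e : ((2^(k+1):ℕ):ℝ) ^ (-(5/4):ℝ) = ((2^k:ℕ):ℝ) ^ (-(5/4):ℝ) * 2 ^ (-(5/4):ℝ) := by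
          rw [← Real.mul_rpow (by positivity) (by positivity)]; push_cast; rw [pow_succ]
        have e2 : (1/3:ℝ) ≤ 2 ^ (-(5/4):ℝ) := by
          have : (2:ℝ) ^ (-(3/2):ℝ) ≤ 2 ^ (-(5/4):ℝ) :=
            Real.rpow_le_rpow_of_exponent_le (by norm_num) (by norm_num)
          refine le_trans ?_ this
          rw [Real.rpow_neg (by norm_num), one_div]
          apply inv_anti₀ (by positivity)
          have e3 : (2:ℝ)^(3/2:ℝ) = √(8) := by
            rw [Real.sqrt_eq_rpow, show (8:ℝ) = 2^(3:ℝ) by norm_num, ← Real.rpow_mul (by norm_num)]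
            norm_num
          rw [e3, Real.sqrt_le_left (by norm_num)]; norm_num
        rw [e, ← mul_assoc]
        calc T.u a (2^(k+1)) ≤ T.u a (2^k) * (1/3) := by linarith
          _ ≤ (C * ((2^k:ℕ):ℝ) ^ (-(5/4):ℝ)) * 2 ^ (-(5/4):ℝ) := by gcongr
  refine ⟨C * 8 ^ (5/4:ℝ), fun t x => ?_⟩
  have hpt : T.p t x a ≤ T.u a (t/2) := by
    rcases Nat.even_or_odd' t with ⟨m, rfl | rfl⟩
    · rw [Nat.mul_div_cancel_left _ (by norm_num)]; exact T.p_even_le a x a m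
    · rw [show (2*m+1)/2 = m by omega]; exact T.p_odd_le a x a m
  refine hpt.trans ?_
  rw [Real.rpow_neg (by positivity), mul_assoc, ← div_eq_mul_inv, ← Real.div_rpow (by positivity) (by positivity)]
  rcases Nat.lt_or_ge t 2 with h2 | h2
  · have : (1:ℝ) ≤ (8 / ((t:ℝ)+1)) ^ (5/4:ℝ) := by
      apply Real.one_le_rpow _ (by norm_num)
      rw [le_div_iff₀ (by positivity)]
      have : (t:ℝ) < 2 := by exact_mod_cast h2
      linarith
    calc _ ≤ (1:ℝ) := T.u_le_one a _
      _ ≤ _ := by nlinarith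
  · set k := Nat.log 2 (t/2) with hk
    have h1 : 2^k ≤ t/2 := Nat.pow_log_le_self 2 (by omega)
    have h3 : t/2 < 2^(k+1) := Nat.lt_pow_succ_log_self (by norm_num) _
    refine (T.u_anti a h1).trans ((hpow k).trans ?_)
    gcongr
    rw [Real.rpow_neg (by positivity), ← Real.inv_rpow (by positivity)]
    gcongr
    rw [inv_eq_one_div, div_le_div_iff₀ (by positivity) (by positivity)]
    have : t + 1 ≤ 8 * 2^k := by rw [pow_succ] at h3; omega
    have : ((t + 1 : ℕ):ℝ) ≤ (8 * 2^k : ℕ) := by exact_mod_cast this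
    push_cast at *; linarith
end TW
end RotorWalk

namespace RotorWalk
set_option linter.unusedSectionVars false
namespace TW
variable {Γ X : Type*} [Group Γ] [MulAction Γ X] [MulAction.IsPretransitive Γ X] (T : TW Γ X)

noncomputable def Q (f g : X →₀ ℝ) : ℝ := dot f g - dot f (T.P g)

lemma Q_self_nonneg (f : X →₀ ℝ) : 0 ≤ T.Q f f := by
  have h1 := two_dot_le f (T.P f)
  have h2 := T.P_contr f
  rw [Q]; linarith

lemma Q_cs (f g : X →₀ ℝ) : T.Q f g ^ 2 ≤ T.Q f f * T.Q g g := by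
  apply cs_of_quad
  intro t
  have h := T.Q_self_nonneg (f + t • g)
  have e : dot g (T.P f) = dot f (T.P g) := by rw [← P_symm, dot_comm]
  have e2 := dot_comm g f
  simp only [Q, map_add, map_smul, dot_add_left, dot_add_right, dot_smul_left, dot_smul_right] at *
  rw [e, e2] at h
  nlinarith

noncomputable def gsum (a : X) (n : ℕ) : X →₀ ℝ :=
  ∑ t ∈ Finset.range n, (T.P ^ t) (Finsupp.single a 1)

lemma gsum_sub (a : X) (n : ℕ) :
    T.gsum a n - T.P (T.gsum a n) = Finsupp.single a 1 - (T.P ^ n) (Finsupp.single a 1) := by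
  induction n with
  | zero => simp [gsum]
  | succ n ih =>
    have : T.gsum a (n+1) = T.gsum a n + (T.P ^ n) (Finsupp.single a 1) := by
      rw [gsum, Finset.sum_range_succ]; rfl
    rw [this, map_add, pow_succ', Module.End.mul_apply]
    rw [add_sub_add_comm, ih]; abel

lemma Q_gsum (a : X) (n : ℕ) (f : X →₀ ℝ) :
    T.Q f (T.gsum a n) = f a - dot f ((T.P ^ n) (Finsupp.single a 1)) := by
  rw [Q, ← dot_sub_right, gsum_sub, dot_sub_right, dot_single_right, one_mul]

lemma cap (a : X) (K : ℝ) (hK : ∀ n, ∑ t ∈ Finset.range n, T.p t a a ≤ K) (f : X →₀ ℝ) :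
    f a ^ 2 ≤ K * T.Q f f := by
  have hsm : Summable fun t => T.p t a a :=
    summable_of_sum_range_le (fun t => T.p_nonneg t a a) hK
  have hp0 : ∀ x, Tendsto (fun n => T.p n a x) atTop (nhds 0) := by
    intro x
    have hu : Tendsto (fun n => T.u a n) atTop (nhds 0) :=
      hsm.tendsto_atTop_zero.comp (tendsto_id.const_mul_atTop' (by norm_num : 0 < 2))
    have h2 : Tendsto (fun n => T.u a (n/2)) atTop (nhds 0) :=
      hu.comp (Nat.tendsto_div_const_atTop (by norm_num))
    refine squeeze_zero (fun n => T.p_nonneg n a x) (fun n => ?_) h2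
    rcases Nat.even_or_odd' n with ⟨m, rfl | rfl⟩
    · rw [Nat.mul_div_cancel_left _ (by norm_num)]; exact T.p_even_le a a x m
    · rw [show (2*m+1)/2 = m by omega]; exact T.p_odd_le a a x m
  have hd0 : Tendsto (fun n => dot f ((T.P ^ n) (Finsupp.single a 1))) atTop (nhds 0) := by
    have : ∀ n, dot f ((T.P ^ n) (Finsupp.single a 1)) = ∑ x ∈ f.support, f x * T.p n a x :=
      fun n => dot_eq_sum _ _ _ subset_rfl
    simp only [this]
    have := tendsto_finsetSum f.support (fun x _ => (hp0 x).const_mul (f x))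
    simpa using this
  have hlim : Tendsto (fun n => (f a - dot f ((T.P ^ n) (Finsupp.single a 1)))^2) atTop
      (nhds (f a ^ 2)) := by
    have := (tendsto_const_nhds (x := f a)).sub hd0
    simpa using this.pow 2
  refine le_of_tendsto' hlim fun n => ?_
  rw [← Q_gsum]
  refine (T.Q_cs _ _).trans ?_
  rw [mul_comm]
  refine mul_le_mul_of_nonneg_right ?_ (T.Q_self_nonneg f)
  rw [Q_gsum]
  have e : T.gsum a n a = ∑ t ∈ Finset.range n, T.p t a a := by
    simp [gsum, Finsupp.finsetSum_apply, p]
  have h1 : 0 ≤ dot (T.gsum a n) ((T.P ^ n) (Finsupp.single a 1)) := by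
    have : dot (T.gsum a n) ((T.P ^ n) (Finsupp.single a 1)) =
      ∑ t ∈ Finset.range n, T.p (t+n) a a := by
      rw [gsum, dot, map_sum]
      exact Finset.sum_congr rfl fun t _ => T.dot_pp t n a a
    rw [this]; exact Finset.sum_nonneg fun t _ => T.p_nonneg _ _ _
  have := hK n
  linarith

noncomputable def carre (f : X →₀ ℝ) : X →₀ ℝ := T.P (f * f) - (2:ℝ) • (f * T.P f) + f * f

lemma A_apply (f : X → ℝ) (x : X) : T.A f x = (1 / (T.d:ℝ)) * ∑ y ∈ T.nb x, f y := rfl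

lemma carre_apply (f : X →₀ ℝ) (x : X) :
    T.carre f x = T.A (fun y => (f y - f x)^2) x := by
  have h1 : (T.P (f*f)) x = T.A (fun y => f y * f y) x := by
    rw [P_apply]; rfl
  have h2 := T.P_apply f x
  have h3 : (1 / (T.d:ℝ)) * ∑ y ∈ T.nb x, (f x)^2 = f x ^ 2 := by
    have := T.dR_pos
    rw [Finset.sum_const, T.card_nb, nsmul_eq_mul]; field_simp
  simp only [carre, Finsupp.add_apply, Finsupp.sub_apply, Finsupp.smul_apply, Finsupp.mul_apply,
    h1, h2, A_apply, smul_eq_mul]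
  simp only [sub_sq, Finset.sum_add_distrib, Finset.sum_sub_distrib]
  rw [mul_add, mul_sub, h3, ← Finset.sum_mul, ← Finset.mul_sum]
  simp only [sq]; ring

lemma two_Q_eq (f : X →₀ ℝ) (s : Finset X) (hs : (T.carre f).support ⊆ s) :
    2 * T.Q f f = ∑ x ∈ s, T.carre f x := by
  have key : ∀ g h : X →₀ ℝ, dot g h = Finsupp.linearCombination ℝ (fun _ => (1:ℝ)) (g * h) := by
    intro g h
    rw [Finsupp.linearCombination_apply, Finsupp.sum_of_support_subset (s := g.support) _ _ _ (by simp),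
      dot_eq_sum g h _ subset_rfl]
    · exact Finset.sum_congr rfl fun x _ => by simp
    · intro x; simp; tauto
  have h1 : Finsupp.linearCombination ℝ (fun _ => (1:ℝ)) (T.P (f * f)) =
      Finsupp.linearCombination ℝ (fun _ => (1:ℝ)) (f * f) := by
    rw [lc_P, A_const]
  have h2 : ∑ x ∈ s, T.carre f x = Finsupp.linearCombination ℝ (fun _ => (1:ℝ)) (T.carre f) := by
    rw [Finsupp.linearCombination_apply, Finsupp.sum_of_support_subset (s := s) _ hs _ (by simp)]
    simp
  rw [h2, carre, map_add, map_sub, map_smul, h1, ← key, ← key, Q, smul_eq_mul]; ring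

noncomputable def tent (δ : X → ℕ) (j : ℕ) (x : X) : ℝ := max 0 (1 - δ x / 2^j)

lemma tent_diff (δ : X → ℕ) (j : ℕ) (x y : X) (h1 : δ x ≤ δ y + 1) (h2 : δ y ≤ δ x + 1) :
    |tent δ j y - tent δ j x| ≤ if δ x ≤ 2^j then (1/2:ℝ)^j else 0 := by
  have h1' : (δ x:ℝ) ≤ δ y + 1 := by exact_mod_cast h1
  have h2' : (δ y:ℝ) ≤ δ x + 1 := by exact_mod_cast h2
  have hp : (0:ℝ) < 2^j := by positivity
  split_ifs with h
  · have h3 : |tent δ j y - tent δ j x| ≤ |(1 - (δ y:ℝ)/2^j) - (1 - δ x/2^j)| := by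
      rw [tent, tent, max_comm, max_comm (0:ℝ)]; exact abs_max_sub_max_le_abs _ _ _
    refine h3.trans ?_
    · rw [show (1 - (δ y:ℝ)/2^j) - (1 - δ x/2^j) = ((δ x:ℝ) - δ y) / 2^j by ring, abs_div,
        abs_of_pos hp, one_div, inv_pow, ← one_div]
      gcongr
      rw [abs_le]; constructor <;> linarith
  · push Not at h
    have h' : 2^j ≤ δ y := by omega
    have e1 : (2:ℝ)^j ≤ δ x := by exact_mod_cast h.le
    have e2 : (2:ℝ)^j ≤ δ y := by exact_mod_cast h'
    have e3 : tent δ j y = 0 := max_eq_left (by rw [sub_nonpos, le_div_iff₀ hp]; linarith)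
    have e4 : tent δ j x = 0 := max_eq_left (by rw [sub_nonpos, le_div_iff₀ hp]; linarith)
    simp [e3, e4]

lemma pow_sum_bound (k : ℕ) :
    ∑ i ∈ Finset.range k, ∑ j ∈ Finset.range k, (1/2:ℝ)^i * (1/2)^j * 4^(min i j) ≤ 4 * k := by
  induction k with
  | zero => simp
  | succ k ih =>
    have e : ∑ i ∈ Finset.range (k+1), ∑ j ∈ Finset.range (k+1), (1/2:ℝ)^i * (1/2)^j * 4^(min i j) =
      ∑ i ∈ Finset.range k, ∑ j ∈ Finset.range k, (1/2:ℝ)^i * (1/2)^j * 4^(min i j) +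
      2 * ∑ i ∈ Finset.range k, (1/2:ℝ)^i * (1/2)^k * 4^(min i k) + 1 := by
      rw [Finset.sum_range_succ]
      simp only [Finset.sum_range_succ _ k, Finset.sum_add_distrib, min_self]
      have : (1/2:ℝ)^k * (1/2)^k * 4^k = 1 := by rw [← mul_pow, ← mul_pow]; norm_num
      rw [this]
      have : ∑ x ∈ Finset.range k, (1 / 2:ℝ) ^ k * (1 / 2) ^ x * 4 ^ min k x =
        ∑ x ∈ Finset.range k, (1 / 2:ℝ) ^ x * (1 / 2) ^ k * 4 ^ min x k :=
        Finset.sum_congr rfl fun x _ => by rw [min_comm]; ring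
      rw [this]; ring
    have e2 : ∑ i ∈ Finset.range k, (1/2:ℝ)^i * (1/2)^k * 4^(min i k) ≤ 1 := by
      have : ∀ i ∈ Finset.range k, (1/2:ℝ)^i * (1/2)^k * 4^(min i k) = (1/2)^k * 2^i := by
        intro i hi
        rw [min_eq_left (Finset.mem_range.1 hi).le, mul_right_comm, ← mul_pow]; norm_num; ring
      rw [Finset.sum_congr rfl this, ← Finset.mul_sum, geom_sum_eq (by norm_num)]
      have h : (1/2:ℝ)^k * 2^k = 1 := by rw [← mul_pow]; norm_num
      have h5 : (0:ℝ) < (1/2)^k := by positivity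
      rw [show (2:ℝ) - 1 = 1 by norm_num, div_one, mul_sub, h]; linarith
    rw [e]; push_cast; linarith

lemma recurrent (a : X) (K : ℝ) (hK : ∀ n, ∑ t ∈ Finset.range n, T.p t a a ≤ K)
    (δ : X → ℕ) (ha : δ a = 0) (hδ : ∀ x, ∀ y ∈ T.nb x, δ y ≤ δ x + 1)
    (B : ℕ → Finset X) (hB : ∀ r x, x ∈ B r ↔ δ x ≤ r) (C : ℝ)
    (hC : ∀ r, 1 ≤ r → ((B r).card:ℝ) ≤ C * r^2) : False := by
  classical
  have hC0 : 0 ≤ C := by have := hC 1 le_rfl; simp at this; exact (Nat.cast_nonneg _).trans this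
  have hK0 : 0 ≤ K := by simpa using hK 0
  obtain ⟨k, hk⟩ := exists_nat_gt (K * (2 * C) + 1)
  have hk1 : (1:ℝ) < k := by
    have : 0 ≤ K * (2 * C) := by positivity
    linarith
  have hk0 : (0:ℝ) < k := by linarith
  have htent0 : ∀ j < k, ∀ x, x ∉ B (2^k) → tent δ j x = 0 := by
    intro j hj x hx
    rw [hB] at hx; push Not at hx
    refine max_eq_left ?_
    rw [sub_nonpos, le_div_iff₀ (by positivity), one_mul]
    have : 2^j ≤ 2^k := Nat.pow_le_pow_right (by norm_num) hj.le
    exact_mod_cast (by omega : 2^j ≤ δ x)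
  let F : X → ℝ := fun x => (1/(k:ℝ)) * ∑ j ∈ Finset.range k, tent δ j x
  have hF0 : ∀ x, F x ≠ 0 → x ∈ B (2^k) := by
    intro x hx; by_contra h
    apply hx
    simp only [F]
    rw [Finset.sum_eq_zero fun j hj => htent0 j (Finset.mem_range.1 hj) x h, mul_zero]
  let f : X →₀ ℝ := Finsupp.onFinset (B (2^k)) F hF0
  have fF : ∀ x, f x = F x := fun x => rfl
  have fa : f a = 1 := by
    rw [fF]; simp only [F, tent, ha]; simp; field_simp
  have hcap := T.cap a K hK f
  let h : X → ℝ := fun x => (1/(k:ℝ)) * ∑ j ∈ Finset.range k, if δ x ≤ 2^j then (1/2:ℝ)^j else 0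
  have hgrad : ∀ x, ∀ y ∈ T.nb x, (f y - f x)^2 ≤ h x ^ 2 := by
    intro x y hy
    have h1 : |f y - f x| ≤ h x := by
      rw [fF, fF]
      simp only [F, h]
      rw [← mul_sub, ← Finset.sum_sub_distrib, abs_mul, abs_of_pos (by positivity : 0 < 1/(k:ℝ))]
      gcongr
      refine (Finset.abs_sum_le_sum_abs _ _).trans (Finset.sum_le_sum fun j _ => ?_)
      exact tent_diff δ j x y (hδ y x (T.symm x y hy)) (hδ x y hy)
    exact sq_le_sq' (abs_le.1 h1).1 (abs_le.1 h1).2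
  have hcar : ∀ x, T.carre f x ≤ h x ^ 2 := by
    intro x
    rw [carre_apply, A_apply]
    have hd := T.dR_pos
    calc _ ≤ (1 / (T.d:ℝ)) * ∑ y ∈ T.nb x, h x ^ 2 := by
          exact mul_le_mul_of_nonneg_left (Finset.sum_le_sum fun y hy => hgrad x y hy) (by positivity)
      _ = h x ^ 2 := by rw [Finset.sum_const, T.card_nb, nsmul_eq_mul]; field_simp
  have hsupp : (T.carre f).support ⊆ B (2^k) := by
    intro x hx
    by_contra hxB
    have h0 : h x = 0 := by
      simp only [h]
      rw [Finset.sum_eq_zero, mul_zero]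
      intro j hj
      rw [if_neg]
      rw [hB] at hxB; push Not at hxB ⊢
      exact lt_of_le_of_lt (Nat.pow_le_pow_right (by norm_num) (Finset.mem_range.1 hj).le) hxB
    have h1 := hcar x
    rw [h0] at h1
    have h2 : 0 ≤ T.carre f x := by
      rw [carre_apply]
      have := T.A_mono (f := fun _ => 0) (g := fun y => (f y - f x)^2) (fun y => sq_nonneg _) x
      rwa [A_const] at this
    exact (Finsupp.mem_support_iff.1 hx) (le_antisymm (by simpa using h1) h2)
  have hQ := T.two_Q_eq f _ hsupp
  have hQ2 : ∑ x ∈ B (2^k), T.carre f x ≤ 4 * C / k := by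
    calc _ ≤ ∑ x ∈ B (2^k), h x ^ 2 := Finset.sum_le_sum fun x _ => hcar x
      _ = (1/(k:ℝ))^2 * ∑ i ∈ Finset.range k, ∑ j ∈ Finset.range k, (1/2:ℝ)^i * (1/2)^j *
          ∑ x ∈ B (2^k), (if δ x ≤ 2^i then 1 else 0) * (if δ x ≤ 2^j then 1 else 0) := by
        simp only [h, mul_pow]
        rw [← Finset.mul_sum]
        congr 1
        simp only [Finset.mul_sum]
        rw [Finset.sum_congr rfl fun x _ => by rw [sq, Finset.sum_mul_sum], Finset.sum_comm]
        refine Finset.sum_congr rfl fun i _ => ?_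
        rw [Finset.sum_comm]
        refine Finset.sum_congr rfl fun j _ => Finset.sum_congr rfl fun x _ => ?_
        split_ifs <;> simp
      _ ≤ (1/(k:ℝ))^2 * ∑ i ∈ Finset.range k, ∑ j ∈ Finset.range k, (1/2:ℝ)^i * (1/2)^j *
          (C * 4^(min i j)) := by
        gcongr with i hi j hj
        have e : ∑ x ∈ B (2^k), (if δ x ≤ 2^i then (1:ℝ) else 0) * (if δ x ≤ 2^j then 1 else 0) ≤
            (B (2^(min i j))).card := by
          rw [Finset.card_eq_sum_ones, Nat.cast_sum]
          calc _ = ∑ x ∈ (B (2^k)).filter (fun x => x ∈ B (2^(min i j))), (1:ℝ) := by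
                rw [Finset.sum_filter]
                refine Finset.sum_congr rfl fun x _ => ?_
                have : x ∈ B (2^(min i j)) ↔ δ x ≤ 2^i ∧ δ x ≤ 2^j := by
                  rw [hB, (pow_right_mono₀ (by norm_num : 1 ≤ 2)).map_min, le_min_iff]
                simp only [this]
                split_ifs <;> simp_all
            _ ≤ _ := by
                simp only [Nat.cast_one]
                apply Finset.sum_le_sum_of_subset_of_nonneg
                · intro x hx; exact (Finset.mem_filter.1 hx).2
                · intros; norm_num
        refine e.trans ((hC _ Nat.one_le_two_pow).trans ?_)
        push_cast
        rw [← pow_mul, mul_comm _ 2, pow_mul]; norm_num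
      _ = (1/(k:ℝ))^2 * (C * ∑ i ∈ Finset.range k, ∑ j ∈ Finset.range k, (1/2:ℝ)^i * (1/2)^j *
          4^(min i j)) := by
        congr 1
        rw [Finset.mul_sum]
        refine Finset.sum_congr rfl fun i _ => ?_
        rw [Finset.mul_sum]
        exact Finset.sum_congr rfl fun j _ => by ring
      _ ≤ (1/(k:ℝ))^2 * (C * (4 * k)) := by gcongr; exact pow_sum_bound k
      _ = _ := by field_simp
  rw [fa] at hcap
  have h3 : T.Q f f ≤ 2 * C / k := by
    have : 4 * C / k = 2 * (2 * C / k) := by ring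
    linarith
  have h4 : (1:ℝ)^2 ≤ K * (2 * C / k) := hcap.trans (by gcongr)
  rw [← mul_div_assoc, le_div_iff₀ hk0] at h4
  linarith
end TW
end RotorWalk

namespace RotorWalk
set_option linter.unusedSectionVars false
namespace TW
variable {Γ X : Type*} [Group Γ] [MulAction Γ X] [MulAction.IsPretransitive Γ X] (T : TW Γ X)

lemma u_small [Infinite X] (a : X) (hch : ∀ y, ∃ k, T.Chain2 a k y) (c : ℝ) (hc : 0 < c) :
    ∃ n, T.u a n < c := by
  by_contra hcon
  push Not at hcon
  obtain ⟨K, hK⟩ := exists_nat_gt (2 / c)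
  obtain ⟨s, hs⟩ := Infinite.exists_subset_card_eq X K
  choose k hk using hch
  set r := s.sup k with hr
  obtain ⟨n, hn⟩ := exists_nat_gt ((r:ℝ)^2 * T.d^2 * (2 / c))
  have hd := T.dR_pos
  have hn0 : (0:ℝ) < n := lt_of_le_of_lt (by positivity) hn
  have h2 := T.n_mul_w_le a n
  have h3 := T.u_le_one a n
  have hw := T.w_nonneg a (2*n)
  have hlow : ∀ y ∈ s, c / 2 ≤ T.p (2*(2*n)) a y := by
    intro y hy
    have h1 := T.chain_diff a a y (2*n) (k y) (hk y)
    have h4 : (k y:ℝ)^2 * (T.d^2 * T.w a (2*n)) ≤ r^2 * (T.d^2 * T.w a (2*n)) := by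
      have : k y ≤ r := Finset.le_sup hy
      gcongr
    have h5 : (r:ℝ)^2 * T.d^2 ≤ n * (c/2) := by
      have : (r:ℝ)^2 * T.d^2 = (r:ℝ)^2 * T.d^2 * (2/c) * (c/2) := by field_simp
      rw [this]; gcongr
    have h6 : (r:ℝ)^2 * (T.d^2 * T.w a (2*n)) ≤ c/2 := by
      calc (r:ℝ)^2 * (T.d^2 * T.w a (2*n)) = (r:ℝ)^2 * T.d^2 * T.w a (2*n) := by ring
        _ ≤ n * (c/2) * T.w a (2*n) := by gcongr
        _ = (c/2) * (n * T.w a (2*n)) := by ring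
        _ ≤ (c/2) * 1 := by gcongr; linarith
        _ = c/2 := by ring
    have := hcon (2*n)
    linarith
  have h7 : s.card * (c / 2) ≤ 1 := by
    calc (s.card:ℝ) * (c / 2) = ∑ y ∈ s, c / 2 := by simp
      _ ≤ ∑ y ∈ s, T.p (2*(2*n)) a y := Finset.sum_le_sum hlow
      _ ≤ 1 := T.p_sum_le _ _ _
  rw [hs] at h7
  rw [div_lt_iff₀ hc] at hK
  linarith

/-- support size at time n -/
noncomputable def sup (a : X) (n : ℕ) : Finset X := ((T.P ^ n) (Finsupp.single a 1)).support

lemma u_ge (a : X) (n : ℕ) : 1 ≤ (T.sup a n).card * T.u a n := by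
  have h1 := T.sum_p n a
  have h2 := sq_sum_le_card_mul_sum_sq (s := T.sup a n) (f := fun y => T.p n a y)
  have h3 := dot_self_eq_sum ((T.P ^ n) (Finsupp.single a 1))
  rw [T.dot_self_pp a] at h3
  rw [h3]
  have h4 : ∑ y ∈ T.sup a n, T.p n a y = 1 := h1
  rw [h4] at h2
  simpa [sup, p] using h2

lemma u_pos (a : X) (n : ℕ) : 0 < T.u a n := by
  have h1 := T.u_ge a n
  have h2 := T.u_nonneg a n
  rcases h2.lt_or_eq with h | h
  · exact h
  · rw [← h] at h1; norm_num at h1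

lemma w_pos [Infinite X] (a : X) (hch : ∀ y, ∃ k, T.Chain2 a k y) (n : ℕ) : 0 < T.w a n := by
  by_contra hcon
  have hz : T.w a n = 0 := le_antisymm (not_lt.1 hcon) (T.w_nonneg a n)
  have hback : ∀ j, ∀ m, m = n + 1 - j → 1 ≤ m → T.w a m = 0 := by
    intro j
    induction j with
    | zero =>
      intro m hm h1
      exact le_antisymm (by rw [← hz]; exact T.w_anti a (by omega)) (T.w_nonneg a m)
    | succ j ih =>
      intro m hm h1
      by_cases hj : n + 1 ≤ j
      · omega
      · have h2 := ih (m+1) (by omega) (by omega)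
        have h3 := T.w_logconvex a (m-1)
        rw [show m - 1 + 1 = m by omega, show m - 1 + 2 = m + 1 by omega, h2, mul_zero] at h3
        exact pow_eq_zero_iff (two_ne_zero) |>.1 (le_antisymm h3 (sq_nonneg _))
  have h1 : ∀ m, 1 ≤ m → T.w a m = 0 := by
    intro m hm
    rcases Nat.lt_or_ge n m with h | h
    · exact le_antisymm (by rw [← hz]; exact T.w_anti a (by omega)) (T.w_nonneg a m)
    · exact hback (n+1-m) m (by omega) hm
  have h2 : ∀ m, T.u a (1+m) = T.u a 1 := by
    intro m
    have := T.u_sum_w a 1 m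
    rw [Finset.sum_eq_zero fun i _ => h1 (1+i) (by omega)] at this
    linarith
  obtain ⟨m, hm⟩ := T.u_small a hch (T.u a 1) (T.u_pos a 1)
  have := T.u_anti a (show m ≤ 1 + m by omega)
  rw [h2] at this
  linarith

lemma ratio_mono [Infinite X] (a : X) (hch : ∀ y, ∃ k, T.Chain2 a k y) :
    Monotone (fun n => T.w a (n+1) / T.w a n) := by
  apply monotone_nat_of_le_succ
  intro n
  rw [div_le_div_iff₀ (T.w_pos a hch _) (T.w_pos a hch _)]
  have := T.w_logconvex a n
  nlinarith

lemma ratio_tendsto [Infinite X] (a : X) (hch : ∀ y, ∃ k, T.Chain2 a k y) (D : ℕ)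
    (hg : ∀ N0, ∃ N ≥ N0, ((T.sup a N).card : ℝ) ≤ (N:ℝ) ^ D) :
    Tendsto (fun n => T.w a (n+1) / T.w a n) atTop (nhds 1) := by
  have hm := T.ratio_mono a hch
  have hle : ∀ n, T.w a (n+1) / T.w a n ≤ 1 := fun n =>
    (div_le_one (T.w_pos a hch n)).2 (T.w_anti a (Nat.le_succ n))
  have hb : BddAbove (Set.range fun n => T.w a (n+1) / T.w a n) := ⟨1, by rintro _ ⟨n, rfl⟩; exact hle n⟩
  have ht := tendsto_atTop_ciSup hm hb
  set q := ⨆ n, T.w a (n+1) / T.w a n with hq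
  have hq1 : q ≤ 1 := ciSup_le hle
  rcases hq1.lt_or_eq with hlt | he
  swap
  · rwa [he] at ht
  exfalso
  have hq' : ∀ n, T.w a (n+1) ≤ q * T.w a n := by
    intro n
    have : T.w a (n+1) / T.w a n ≤ q := le_ciSup hb n
    rwa [div_le_iff₀ (T.w_pos a hch n)] at this
  have hq0 : 0 < q := lt_of_lt_of_le (div_pos (T.w_pos a hch 1) (T.w_pos a hch 0)) (le_ciSup hb 0)
  have hw : ∀ n, T.w a n ≤ q ^ n * T.w a 0 := by
    intro n
    induction n with
    | zero => simp
    | succ n ih =>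
      calc _ ≤ q * T.w a n := hq' n
        _ ≤ q * (q^n * T.w a 0) := by gcongr
        _ = _ := by ring
  -- u n ≤ q^n * C
  set C := T.w a 0 / (1 - q) with hC
  have hC0 : 0 < C := div_pos (T.w_pos a hch 0) (by linarith)
  have hu1 : ∀ n m, T.u a n - T.u a (n+m) ≤ q^n * C := by
    intro n m
    rw [T.u_sum_w]
    calc ∑ i ∈ Finset.range m, T.w a (n+i) ≤ ∑ i ∈ Finset.range m, q^n * T.w a 0 * q^i := by
          apply Finset.sum_le_sum; intro i _
          refine (hw _).trans (le_of_eq ?_); ring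
      _ = q^n * T.w a 0 * ∑ i ∈ Finset.range m, q^i := by rw [Finset.mul_sum]
      _ ≤ q^n * T.w a 0 * (1 / (1 - q)) := by
          have := (T.w_pos a hch 0).le
          gcongr
          rw [geom_sum_eq hlt.ne, ← neg_div_neg_eq]
          apply div_le_div_of_nonneg_right _ (by linarith) |>.trans_eq' _
          · exact 1 - q^m
          · have := pow_pos hq0 m; linarith
          · congr 1 <;> ring
      _ = _ := by rw [hC]; ring
  have hu : ∀ n, T.u a n ≤ q^n * C := by
    intro n
    apply _root_.le_of_forall_pos_le_add
    intro ε hε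
    obtain ⟨m, hm⟩ := T.u_small a hch ε hε
    have := hu1 n m
    have := T.u_anti a (show m ≤ n + m by omega)
    linarith
  have hlim : Tendsto (fun n : ℕ => (n:ℝ)^D * q^n * C) atTop (nhds 0) := by
    have := (tendsto_pow_const_mul_const_pow_of_abs_lt_one D (show |q| < 1 by rwa [abs_of_pos hq0])).mul_const C
    simpa using this
  obtain ⟨N0, hN0⟩ := eventually_atTop.1 (hlim.eventually (gt_mem_nhds (show (0:ℝ) < 1 by norm_num)))
  obtain ⟨N, hN, hcard⟩ := hg N0
  have h1 := hN0 N hN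
  have h2 := T.u_ge a N
  have h3 := hu N
  have h4 : ((T.sup a N).card : ℝ) * T.u a N ≤ (N:ℝ)^D * (q^N * C) :=
    mul_le_mul hcard h3 (T.u_nonneg a N) (by positivity)
  linarith
end TW
end RotorWalk

namespace RotorWalk
set_option linter.unusedSectionVars false

lemma hilbert_of_form {Γ : Type*} {F : Type u} [Group Γ] [AddCommGroup F] [Module ℝ F]
    (B : F →ₗ[ℝ] F →ₗ[ℝ] ℝ) (hs : ∀ x y, B x y = B y x) (hp : ∀ x, 0 ≤ B x x)
    (ρ : Γ →* (F ≃ₗ[ℝ] F)) (hρ : ∀ γ x y, B (ρ γ x) (ρ γ y) = B x y) :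
    ∃ (H : Type u) (_ : NormedAddCommGroup H) (_ : InnerProductSpace ℝ H) (_ : CompleteSpace H)
      (ι : F →ₗ[ℝ] H) (π : Γ →* (H ≃ₗᵢ[ℝ] H)), DenseRange ι ∧ (∀ x y, inner ℝ (ι x) (ι y) = B x y) ∧
      ∀ γ x, π γ (ι x) = ι (ρ γ x) := by
  let cd : PreInnerProductSpace.Core ℝ F :=
    { inner := fun x y => B x y
      conj_inner_symm := fun x y => by simpa using hs y x
      re_inner_nonneg := fun x => by simpa using hp x
      add_left := fun x y z => by simp
      smul_left := fun x y r => by simp }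
  let : SeminormedAddCommGroup F := @InnerProductSpace.Core.toSeminormedAddCommGroup ℝ F _ _ _ cd
  let : InnerProductSpace ℝ F := InnerProductSpace.ofCore cd
  let ι : F →ₗ[ℝ] UniformSpace.Completion F := (UniformSpace.Completion.toComplL (𝕜 := ℝ) (E := F)).toLinearMap
  have hι : ∀ x y, inner ℝ (ι x) (ι y) = B x y := fun x y => UniformSpace.Completion.inner_coe x y
  have hd : DenseRange ι := UniformSpace.Completion.denseRange_coe
  have hn : ∀ γ x, ‖ι (ρ γ x)‖ = ‖ι x‖ := by
    intro γ x
    rw [@norm_eq_sqrt_real_inner, @norm_eq_sqrt_real_inner _ _ _ (ι x), hι, hι, hρ]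
  have key : ∀ γ x, (ρ γ).extendOfIsometry ι ι hd hd (hn γ) (ι x) = ι (ρ γ x) := fun γ x =>
    LinearEquiv.extendOfIsometry_eq (ρ γ) ι ι hd hd (hn γ) x
  refine ⟨UniformSpace.Completion F, inferInstance, inferInstance, inferInstance, ι,
    ⟨⟨fun γ => (ρ γ).extendOfIsometry ι ι hd hd (hn γ), ?_⟩, ?_⟩, hd, hι, key⟩
  · ext z
    refine hd.induction_on (p := fun z => (ρ 1).extendOfIsometry ι ι hd hd (hn 1) z = z) z ?_ ?_
    · exact isClosed_eq (LinearIsometryEquiv.continuous _) continuous_id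
    · intro x; rw [key]; simp
  · intro γ γ'
    ext z
    refine hd.induction_on (p := fun z => (ρ (γ * γ')).extendOfIsometry ι ι hd hd (hn _) z =
      (ρ γ).extendOfIsometry ι ι hd hd (hn _) ((ρ γ').extendOfIsometry ι ι hd hd (hn _) z)) z ?_ ?_
    · exact isClosed_eq (LinearIsometryEquiv.continuous _)
        ((LinearIsometryEquiv.continuous _).comp (LinearIsometryEquiv.continuous _))
    · intro x; rw [key, key, key]; simp

end RotorWalk

namespace RotorWalk
set_option linter.unusedSectionVars false

lemma ulim_exists (f : ℕ → ℝ) (C : ℝ) (h : ∀ n, |f n| ≤ C) :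
    ∃ l, Tendsto f (hyperfilter ℕ : Filter ℕ) (nhds l) := by
  have hk : IsCompact (Set.Icc (-C) C) := isCompact_Icc
  obtain ⟨l, _, hl⟩ := hk.ultrafilter_le_nhds ((hyperfilter ℕ).map f) (by
    simp only [Ultrafilter.coe_map, le_principal_iff, mem_map]
    exact Filter.univ_mem' fun n => abs_le.1 (h n))
  exact ⟨l, hl⟩

namespace TW
variable {Γ X : Type*} [Group Γ] [MulAction Γ X] [MulAction.IsPretransitive Γ X] (T : TW Γ X)

/-- mean zero functions -/
noncomputable def F0 (X : Type*) : Submodule ℝ (X →₀ ℝ) :=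
  LinearMap.ker (Finsupp.linearCombination ℝ (fun _ : X => (1:ℝ)))

noncomputable def dd (a x : X) : F0 X :=
  ⟨Finsupp.single x 1 - Finsupp.single a 1, by simp [F0, LinearMap.mem_ker]⟩

lemma F0_eq (a : X) (ξ : F0 X) : ξ = ∑ x ∈ ξ.1.support, ξ.1 x • dd a x := by
  have h := LinearMap.mem_ker.1 ξ.2
  rw [Finsupp.linearCombination_apply, Finsupp.sum] at h
  apply Subtype.ext
  simp only [AddSubmonoidClass.coe_finsetSum, SetLike.val_smul, dd, smul_sub, Finset.sum_sub_distrib]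
  rw [← Finset.sum_smul]
  simp only [smul_eq_mul, mul_one] at h
  rw [h, zero_smul, sub_zero]
  conv_lhs => rw [← Finsupp.sum_single ξ.1]
  simp [Finsupp.sum]

/-- translation action on mean zero functions -/
noncomputable def F0act : Γ →* (F0 X ≃ₗ[ℝ] F0 X) where
  toFun γ := LinearEquiv.ofLinearMap
    ((Finsupp.lmapDomain ℝ ℝ (γ • · : X → X)).restrict (by
      intro ξ hξ
      rw [F0, LinearMap.mem_ker] at hξ ⊢
      rw [Finsupp.lmapDomain_apply, Finsupp.linearCombination_mapDomain]; exact hξ))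
    ((Finsupp.lmapDomain ℝ ℝ (γ⁻¹ • · : X → X)).restrict (by
      intro ξ hξ
      rw [F0, LinearMap.mem_ker] at hξ ⊢
      rw [Finsupp.lmapDomain_apply, Finsupp.linearCombination_mapDomain]; exact hξ))
    (by
      ext1 ξ; apply Subtype.ext
      simp only [LinearMap.comp_apply, LinearMap.restrict_apply, Finsupp.lmapDomain_apply, LinearMap.id_apply]
      rw [← Finsupp.mapDomain_comp]
      convert Finsupp.mapDomain_id
      ext x; simp)
    (by
      ext1 ξ; apply Subtype.ext
      simp only [LinearMap.comp_apply, LinearMap.restrict_apply, Finsupp.lmapDomain_apply, LinearMap.id_apply]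
      rw [← Finsupp.mapDomain_comp]
      convert Finsupp.mapDomain_id
      ext x; simp)
  map_one' := by
    ext1 ξ; apply Subtype.ext
    simp only [LinearEquiv.coe_ofLinearMap, LinearMap.restrict_apply, Finsupp.lmapDomain_apply]
    have : (fun x : X => (1:Γ) • x) = id := by ext x; simp
    rw [this, Finsupp.mapDomain_id]; rfl
  map_mul' γ γ' := by
    ext1 ξ; apply Subtype.ext
    simp only [LinearEquiv.coe_ofLinearMap, LinearMap.restrict_apply, Finsupp.lmapDomain_apply, LinearEquiv.mul_apply]
    rw [← Finsupp.mapDomain_comp]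
    congr 1
    ext x; simp [mul_smul]

lemma F0act_coe (γ : Γ) (ξ : F0 X) : ((F0act γ ξ : F0 X) : X →₀ ℝ) = ξ.1.mapDomain (γ • ·) := rfl

lemma F0act_dd (γ : Γ) (a x : X) : F0act γ (dd a x) = dd (γ • a) (γ • x) := by
  apply Subtype.ext
  rw [F0act_coe]
  have := map_sub (Finsupp.lmapDomain ℝ ℝ (γ • · : X → X)) (Finsupp.single x 1) (Finsupp.single a 1)
  simp only [Finsupp.lmapDomain_apply, Finsupp.mapDomain_single] at this
  exact this

noncomputable def form (a : X) (n : ℕ) (ξ η : F0 X) : ℝ :=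
  dot ((T.P ^ n) ξ.1) ((T.P ^ n) η.1) / T.w a n

lemma form_add_left (a : X) (n : ℕ) (ξ ξ' η : F0 X) :
    T.form a n (ξ + ξ') η = T.form a n ξ η + T.form a n ξ' η := by
  simp only [form, Submodule.coe_add, map_add, dot_add_left, add_div]
lemma form_smul_left (a : X) (n : ℕ) (c : ℝ) (ξ η : F0 X) :
    T.form a n (c • ξ) η = c * T.form a n ξ η := by
  simp only [form, SetLike.val_smul, map_smul, dot_smul_left, mul_div_assoc]
lemma form_comm (a : X) (n : ℕ) (ξ η : F0 X) : T.form a n ξ η = T.form a n η ξ := by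
  simp only [form, dot_comm]
lemma form_self_nonneg (a : X) (n : ℕ) (ξ : F0 X) : 0 ≤ T.form a n ξ ξ :=
  div_nonneg (dot_self_nonneg _) (T.w_nonneg a n)

lemma form_dd (a x y : X) (n : ℕ) : T.form a n (dd x y) (dd x y) =
    2 * (T.u a n - T.p (2*n) y x) / T.w a n := by
  simp only [form, dd, map_sub]; rw [T.dist_eq a]

lemma form_bdd_self [Infinite X] (a : X) (hch : ∀ y, ∃ k, T.Chain2 a k y) (x : X) :
    ∃ C, ∀ n, T.form a n (dd a x) (dd a x) ≤ C := by
  obtain ⟨k, hk⟩ := hch x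
  refine ⟨2 * (k^2 * T.d^2), fun n => ?_⟩
  rw [form_dd, div_le_iff₀ (T.w_pos a hch n)]
  have := T.chain_diff a a x n k hk
  rw [p_symm]
  nlinarith

lemma form_cs (a : X) (n : ℕ) (ξ η : F0 X) :
    |T.form a n ξ η| ≤ (T.form a n ξ ξ + T.form a n η η) / 2 := by
  have h1 := two_dot_le ((T.P ^ n) ξ.1) ((T.P ^ n) η.1)
  have h2 := two_dot_le ((T.P ^ n) ξ.1) (-(T.P ^ n) η.1)
  have e1 : dot ((T.P ^ n) ξ.1) (-(T.P ^ n) η.1) = - dot ((T.P ^ n) ξ.1) ((T.P ^ n) η.1) := by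
    have := dot_smul_right (-1) ((T.P ^ n) ξ.1) ((T.P ^ n) η.1); simpa using this
  have e2 : dot (-(T.P ^ n) η.1) (-(T.P ^ n) η.1) = dot ((T.P ^ n) η.1) ((T.P ^ n) η.1) := by
    have e : -(T.P ^ n) η.1 = (-1:ℝ) • (T.P ^ n) η.1 := by simp
    rw [e, dot_smul_left, dot_smul_right]; ring
  rw [e1, e2] at h2
  have hw := T.w_nonneg a n
  simp only [form]
  rw [← add_div, div_div, mul_comm, ← div_div, abs_div, abs_of_nonneg hw]
  apply div_le_div_of_nonneg_right _ hw
  rw [abs_le]; constructor <;> linarith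

lemma form_bdd [Infinite X] (a : X) (hch : ∀ y, ∃ k, T.Chain2 a k y) (ξ η : F0 X) :
    ∃ C, ∀ n, |T.form a n ξ η| ≤ C := by
  -- first self bound by subadditivity
  have hself : ∀ ξ : F0 X, ∃ C, ∀ n, T.form a n ξ ξ ≤ C := by
    intro ξ
    rw [F0_eq a ξ]
    generalize ξ.1.support = s
    generalize hcc : (⇑ξ.1 : X → ℝ) = c
    classical
    induction s using Finset.induction_on with
    | empty => exact ⟨0, fun n => by simp [form, dot]⟩
    | insert x s hx ih =>
      obtain ⟨C1, h1⟩ := ih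
      obtain ⟨C2, h2⟩ := T.form_bdd_self a hch x
      refine ⟨2 * C1 + 2 * (c x ^ 2 * C2), fun n => ?_⟩
      rw [Finset.sum_insert hx]
      have h3 := h1 n
      have h4 := h2 n
      set A := ∑ x ∈ s, c x • dd a x
      set Bv := c x • dd a x with hB
      have h5 : T.form a n Bv Bv ≤ c x ^ 2 * C2 := by
        rw [hB, form_smul_left, form_comm, form_smul_left]
        have := mul_le_mul_of_nonneg_left h4 (sq_nonneg (c x))
        nlinarith
      have h6 := T.form_cs a n Bv A
      have h7 := le_of_abs_le h6
      rw [form_add_left, form_comm, form_add_left, T.form_comm a n A (Bv + A), form_add_left, T.form_comm a n A Bv]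
      linarith
  obtain ⟨C1, h1⟩ := hself ξ
  obtain ⟨C2, h2⟩ := hself η
  exact ⟨(C1+C2)/2, fun n => (T.form_cs a n ξ η).trans (by linarith [h1 n, h2 n])⟩

lemma form_act (a : X) (n : ℕ) (γ : Γ) (ξ η : F0 X) :
    T.form a n (F0act γ ξ) (F0act γ η) = T.form a n ξ η := by
  simp only [form, F0act_coe, Pn_map, dot_mapDomain]

lemma E_single (n : ℕ) (x : X) : T.E n (fun y => Finsupp.single y (1:ℝ)) x =
    (T.P ^ n) (Finsupp.single x 1) := by
  rw [E_eq_sum]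
  conv_rhs => rw [← Finsupp.sum_single ((T.P ^ n) (Finsupp.single x 1))]
  simp [Finsupp.sum, p]

theorem cocycle {Γ : Type*} {X : Type u} [Group Γ] [MulAction Γ X] [MulAction.IsPretransitive Γ X]
    (T : TW Γ X) [Infinite X] (a : X) (hch : ∀ y, ∃ k, T.Chain2 a k y) (D : ℕ)
    (hg : ∀ N0, ∃ N ≥ N0, ((T.sup a N).card : ℝ) ≤ (N:ℝ) ^ D) :
    ∃ (H : Type u) (_ : NormedAddCommGroup H) (_ : InnerProductSpace ℝ H) (_ : CompleteSpace H)
      (π : Γ →* (H ≃ₗᵢ[ℝ] H)) (b : X → H), b a = 0 ∧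
      (∀ γ x, b (γ • x) = π γ (b x) + b (γ • a)) ∧ (∀ x, T.E 2 b x = b x) ∧
      (∀ x, T.E 2 (fun y => ‖b y - b x‖^2) x = 2) ∧
      Dense (Submodule.span ℝ (Set.range b) : Set H) := by
  choose B hB using fun ξ η => let ⟨C, hC⟩ := T.form_bdd a hch ξ η; ulim_exists _ C hC
  have huniq : ∀ ξ η l, Tendsto (fun n => T.form a n ξ η) (hyperfilter ℕ : Filter ℕ) (nhds l) → B ξ η = l :=
    fun ξ η l h => tendsto_nhds_unique (hB ξ η) h
  have hatTop : (hyperfilter ℕ : Filter ℕ) ≤ atTop := by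
    rw [← Nat.cofinite_eq_atTop]; exact hyperfilter_le_cofinite
  have hcomm : ∀ ξ η, B ξ η = B η ξ := fun ξ η => huniq _ _ _ (by simpa only [T.form_comm a _ ξ η] using hB η ξ)
  have hadd : ∀ ξ ξ' η, B (ξ + ξ') η = B ξ η + B ξ' η := fun ξ ξ' η =>
    huniq _ _ _ (by simpa only [T.form_add_left] using (hB ξ η).add (hB ξ' η))
  have hsmul : ∀ (c : ℝ) ξ η, B (c • ξ) η = c • B ξ η := fun c ξ η =>
    huniq _ _ _ (by simpa only [T.form_smul_left, smul_eq_mul] using (hB ξ η).const_mul c)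
  let BL : F0 X →ₗ[ℝ] F0 X →ₗ[ℝ] ℝ := LinearMap.mk₂ ℝ B hadd hsmul
    (fun ξ η η' => by rw [hcomm, hadd, hcomm η, hcomm η']) (fun c ξ η => by rw [hcomm, hsmul, hcomm η])
  have hpos : ∀ ξ, 0 ≤ B ξ ξ := fun ξ => ge_of_tendsto' (hB ξ ξ) fun n => T.form_self_nonneg a n ξ
  obtain ⟨H, i1, i2, i3, ι, π, hd, hin, hπ⟩ := hilbert_of_form BL hcomm hpos (F0act (Γ := Γ) (X := X))
    (fun γ ξ η => huniq (F0act γ ξ) (F0act γ η) (B ξ η) (by simpa only [T.form_act] using hB ξ η))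
  have hin' : ∀ ξ η, inner ℝ (ι ξ) (ι η) = B ξ η := hin
  refine ⟨H, i1, i2, i3, π, fun x => ι (dd a x), ?_, ?_, ?_, ?_, ?_⟩
  · have : dd a a = 0 := by apply Subtype.ext; simp [dd]
    simp [this]
  · intro γ x
    simp only
    rw [hπ, F0act_dd, ← map_add]
    congr 1
    apply Subtype.ext; simp [dd]
  · intro x
    rw [T.E_lin 2 ι (dd a) x]
    simp only
    rw [← sub_eq_zero, ← map_sub]
    set η := T.E 2 (dd a) x - dd a x with hη
    have hc : (η : X →₀ ℝ) = (T.P ^ 2) (Finsupp.single x 1) - Finsupp.single x 1 := by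
      have h1 : ((T.E 2 (dd a) x : F0 X) : X →₀ ℝ) = T.E 2 (fun y => ((dd a y : F0 X) : X →₀ ℝ)) x :=
        (T.E_lin 2 (F0 X).subtype (dd a) x).symm
      rw [hη, Submodule.coe_sub, h1]
      simp only [dd]
      rw [E_sub, E_const, E_single]; abel
    have hw : ∀ n, T.w x n = T.w a n := fun n => by rw [w, w, u, u, T.u_eq a, T.u_eq a]
    have h0 : B η η = 0 := by
      apply huniq
      have : ∀ n, T.form a n η η = 1 - T.w a (n+1) / T.w a n := by
        intro n
        have hwp := T.w_pos a hch n
        have h2 := T.w_diff x n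
        rw [hw, hw] at h2
        rw [form, hc, eq_sub_iff_add_eq, ← add_div, div_eq_one_iff_eq hwp.ne']
        have h3 : (T.P ^ n) ((T.P ^ 2) (Finsupp.single x 1) - Finsupp.single x 1) =
          (-1:ℝ) • ((T.P ^ n) (Finsupp.single x 1) - (T.P ^ (n+2)) (Finsupp.single x 1)) := by
          rw [map_sub, pow_add]; simp [Module.End.mul_apply]
        rw [h3, dot_smul_left, dot_smul_right, ← h2]; ring
      simp only [this]
      have := (T.ratio_tendsto a hch D hg).const_sub 1
      rw [sub_self] at this
      exact this.mono_left hatTop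
    have : inner ℝ (ι η) (ι η) = (0:ℝ) := by rw [hin', h0]
    exact inner_self_eq_zero.1 this
  · intro x
    have h1 : ∀ y, ‖ι (dd a y) - ι (dd a x)‖^2 = B (dd x y) (dd x y) := by
      intro y
      rw [← hin', ← map_sub, ← real_inner_self_eq_norm_sq]
      have : dd a y - dd a x = dd x y := by apply Subtype.ext; simp [dd]
      rw [this]
    simp only [h1]
    have h2 : Tendsto (fun n => T.E 2 (fun y => T.form a n (dd x y) (dd x y)) x)
        (hyperfilter ℕ : Filter ℕ) (nhds (T.E 2 (fun y => B (dd x y) (dd x y)) x)) := by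
      simp only [E_eq_sum]
      exact tendsto_finsetSum _ fun y _ => (hB _ _).const_smul _
    refine tendsto_nhds_unique h2 ?_
    have h3 : ∀ n, T.E 2 (fun y => T.form a n (dd x y) (dd x y)) x = 2 := by
      intro n
      have hwp := T.w_pos a hch n
      have : (fun y => T.form a n (dd x y) (dd x y)) =
          fun y => (2 / T.w a n) * (T.u a n - T.p (2*n) y x) := by
        ext y; rw [form_dd]; ring
      rw [this, E_mul, E_sub, E_const, T.two_step a, ← w]
      field_simp
    simp only [h3]; exact tendsto_const_nhds
  · have : (Submodule.span ℝ (Set.range fun x => ι (dd a x)) : Set H) = Set.range ι := by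
      have : Submodule.span ℝ (Set.range fun x => ι (dd a x)) = LinearMap.range ι := by
        apply le_antisymm
        · rw [Submodule.span_le]; rintro _ ⟨x, rfl⟩; exact ⟨_, rfl⟩
        · rintro _ ⟨ξ, rfl⟩
          rw [F0_eq a ξ, map_sum]
          refine Submodule.sum_mem _ fun x _ => ?_
          rw [map_smul]
          exact Submodule.smul_mem _ _ (Submodule.subset_span ⟨x, rfl⟩)
      rw [this]; rfl
    rw [this]; exact hd
end TW
end RotorWalk

namespace RotorWalk
open scoped TensorProduct
set_option linter.unusedSectionVars false

lemma tensor_hilbert {Γ : Type*} {H : Type u} [Group Γ] [NormedAddCommGroup H] [InnerProductSpace ℝ H]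
    (π : Γ →* (H ≃ₗᵢ[ℝ] H)) :
    ∃ (W : Type u) (_ : NormedAddCommGroup W) (_ : InnerProductSpace ℝ W) (_ : CompleteSpace W)
      (τ : H →ₗ[ℝ] H →ₗ[ℝ] W) (πW : Γ →* (W ≃ₗᵢ[ℝ] W)),
      (∀ x y x' y', inner ℝ (τ x y) (τ x' y') = inner ℝ x x' * inner ℝ y y') ∧
      ∀ γ x y, πW γ (τ x y) = τ (π γ x) (π γ y) := by
  let ρ : Γ →* ((H ⊗[ℝ] H) ≃ₗ[ℝ] (H ⊗[ℝ] H)) :=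
    { toFun := fun γ => TensorProduct.congr (π γ).toLinearEquiv (π γ).toLinearEquiv
      map_one' := by
        apply LinearEquiv.toLinearMap_injective
        ext x y; simp
      map_mul' := fun γ γ' => by
        apply LinearEquiv.toLinearMap_injective
        ext x y; simp }
  obtain ⟨W, i1, i2, i3, ι, πW, _, hin, hπ⟩ := hilbert_of_form (Γ := Γ) (F := H ⊗[ℝ] H)
    (innerₗ (H ⊗[ℝ] H)) (fun x y => by rw [innerₗ_apply_apply, innerₗ_apply_apply]; exact real_inner_comm _ _) (fun x => by rw [innerₗ_apply_apply]; exact real_inner_self_nonneg) ρ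
    (fun γ x y => by
      have := (TensorProduct.congrIsometry (π γ) (π γ)).inner_map_map x y
      exact this)
  refine ⟨W, i1, i2, i3, (TensorProduct.mk ℝ H H).compr₂ ι, πW, ?_, ?_⟩
  · intro x y x' y'
    simp only [LinearMap.compr₂_apply, hin, TensorProduct.mk_apply]
    simp
  · intro γ x y
    simp only [LinearMap.compr₂_apply, hπ, TensorProduct.mk_apply]
    rfl

/-- Harmonic cocycle data -/
structure Coc {Γ X : Type*} [Group Γ] [MulAction Γ X] (T : TW Γ X) (a : X) (H : Type*)
    [NormedAddCommGroup H] [InnerProductSpace ℝ H] where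
  π : Γ →* (H ≃ₗᵢ[ℝ] H)
  b : X → H
  ba : b a = 0
  bact : ∀ γ x, b (γ • x) = π γ (b x) + b (γ • a)
  harm : ∀ x, T.E 2 b x = b x
  en : ∀ x, T.E 2 (fun y => ‖b y - b x‖^2) x = 2

namespace Coc
variable {Γ X : Type*} [Group Γ] [MulAction Γ X] [MulAction.IsPretransitive Γ X] {T : TW Γ X} {a : X}
  {H : Type*} [NormedAddCommGroup H] [InnerProductSpace ℝ H] (c : Coc T a H)

lemma bdiff (γ : Γ) (x y : X) : c.b (γ • x) - c.b (γ • y) = c.π γ (c.b x - c.b y) := by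
  rw [c.bact γ x, c.bact γ y, map_sub]; abel

lemma harm_n (n : ℕ) (x : X) : T.E (2*n) c.b x = c.b x := by
  induction n generalizing x with
  | zero => simp [TW.E]
  | succ n ih =>
    rw [show 2*(n+1) = 2*n+2 by ring, TW.E_add_time]
    have : T.E 2 c.b = c.b := by ext y; exact c.harm y
    rw [this, ih]

lemma harm_lin {W : Type*} [AddCommGroup W] [Module ℝ W] (L : H →ₗ[ℝ] W) (n : ℕ) (x : X) :
    T.E (2*n) (fun y => L (c.b y - c.b x)) x = 0 := by
  rw [TW.E_lin T (2*n) L (fun y => c.b y - c.b x), TW.E_sub, TW.E_const, harm_n, sub_self, map_zero]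

/-- second-moment tensors -/
noncomputable def V {W : Type*} [AddCommGroup W] [Module ℝ W] (τ : H →ₗ[ℝ] H →ₗ[ℝ] W) (n : ℕ) (x : X) : W :=
  T.E (2*n) (fun y => τ (c.b y - c.b x) (c.b y - c.b x)) x

/-- conditional second moment -/
lemma cond2 {W : Type*} [AddCommGroup W] [Module ℝ W] (τ : H →ₗ[ℝ] H →ₗ[ℝ] W) (n : ℕ) (x z : X) :
    T.E (2*n) (fun y => τ (c.b y - c.b x) (c.b y - c.b x)) z =
      c.V τ n z + τ (c.b z - c.b x) (c.b z - c.b x) := by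
  have : (fun y => τ (c.b y - c.b x) (c.b y - c.b x)) = fun y =>
      (τ (c.b y - c.b z) (c.b y - c.b z) +
      (τ.flip (c.b z - c.b x) (c.b y - c.b z) + τ (c.b z - c.b x) (c.b y - c.b z))) +
      τ (c.b z - c.b x) (c.b z - c.b x) := by
    ext y
    have e : c.b y - c.b x = (c.b y - c.b z) + (c.b z - c.b x) := by abel
    rw [e]; simp only [map_add, LinearMap.add_apply, LinearMap.flip_apply]; abel
  rw [this, TW.E_add, TW.E_add, TW.E_add, TW.E_const, c.harm_lin (τ.flip _), c.harm_lin (τ _), V]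
  simp

lemma V_add {W : Type*} [AddCommGroup W] [Module ℝ W] (τ : H →ₗ[ℝ] H →ₗ[ℝ] W) (m n : ℕ) (x : X) :
    c.V τ (m + n) x = T.E (2*m) (c.V τ n) x + c.V τ m x := by
  rw [V, mul_add, TW.E_add_time]
  have : T.E (2*n) (fun y => τ (c.b y - c.b x) (c.b y - c.b x)) = fun z =>
      c.V τ n z + τ (c.b z - c.b x) (c.b z - c.b x) := by ext z; exact c.cond2 τ n x z
  rw [this, TW.E_add]; rfl

lemma V_inner_const (n : ℕ) (x : X) : c.V (innerₗ H) n x = 2 * n := by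
  induction n generalizing x with
  | zero => simp [V, TW.E]
  | succ n ih =>
    rw [add_comm, V_add]
    have : c.V (innerₗ H) n = fun _ => 2 * (n:ℝ) := by ext y; exact ih y
    rw [this, TW.E_const]
    have h2 : c.V (innerₗ H) 1 x = 2 := by
      have := c.en x
      simpa only [V, innerₗ_apply_apply, real_inner_self_eq_norm_sq, mul_one] using this
    rw [h2]; push_cast; ring

lemma en_n (n : ℕ) (x : X) : T.E (2*n) (fun y => ‖c.b y - c.b x‖^2) x = 2 * n := by
  rw [← c.V_inner_const n x, V]; congr 1; ext y; simp only [innerₗ_apply_apply, real_inner_self_eq_norm_sq]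

lemma V_act {W : Type*} [AddCommGroup W] [Module ℝ W] (τ : H →ₗ[ℝ] H →ₗ[ℝ] W)
    (A : W →ₗ[ℝ] W) (γ : Γ) (hA : ∀ x y, A (τ x y) = τ (c.π γ x) (c.π γ y)) (n : ℕ) (x : X) :
    c.V τ n (γ • x) = A (c.V τ n x) := by
  rw [V, V, TW.E_inv, ← TW.E_lin]
  congr 1; ext y; rw [hA, c.bdiff]

end Coc
end RotorWalk

namespace RotorWalk
set_option linter.unusedSectionVars false
namespace TW
variable {Γ X : Type*} [Group Γ] [MulAction Γ X] (T : TW Γ X)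

lemma sum_le_E (n : ℕ) (g : X → ℝ) (hg : ∀ y, 0 ≤ g y) (x : X) (s : Finset X) :
    ∑ y ∈ s, T.p n x y * g y ≤ T.E n g x := by
  classical
  rw [E_eq_sum]
  simp only [smul_eq_mul]
  rw [← Finset.sum_filter_add_sum_filter_not s (fun y => y ∈ ((T.P ^ n) (Finsupp.single x 1)).support)]
  have : ∑ y ∈ s with y ∉ ((T.P ^ n) (Finsupp.single x 1)).support, T.p n x y * g y = 0 := by
    apply Finset.sum_eq_zero
    intro y hy
    have h := (Finset.mem_filter.1 hy).2
    rw [Finsupp.notMem_support_iff] at h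
    have : T.p n x y = 0 := h
    rw [this, zero_mul]
  rw [this, add_zero]
  apply Finset.sum_le_sum_of_subset_of_nonneg
  · intro y hy; exact (Finset.mem_filter.1 hy).2
  · intro y _ _; exact mul_nonneg (T.p_nonneg _ _ _) (hg y)

lemma term_le_E (n : ℕ) (g : X → ℝ) (hg : ∀ y, 0 ≤ g y) (x y : X) :
    T.p n x y * g y ≤ T.E n g x := by
  simpa using T.sum_le_E n g hg x {y}

lemma mem_supp {n : ℕ} {x y : X} : y ∈ ((T.P ^ n) (Finsupp.single x 1)).support ↔ 0 < T.p n x y := by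
  rw [Finsupp.mem_support_iff]
  exact ⟨fun h => lt_of_le_of_ne (T.p_nonneg _ _ _) (Ne.symm h), fun h => h.ne'⟩

lemma E_mono' (n : ℕ) {f g : X → ℝ} (x : X) (h : ∀ y, 0 < T.p n x y → f y ≤ g y) :
    T.E n f x ≤ T.E n g x := by
  rw [E_eq_sum, E_eq_sum]
  apply Finset.sum_le_sum
  intro y hy
  have := T.mem_supp.1 hy
  exact mul_le_mul_of_nonneg_left (h y this) this.le

lemma E_congr' (n : ℕ) {W : Type*} [AddCommGroup W] [Module ℝ W] {f g : X → W} (x : X)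
    (h : ∀ y, 0 < T.p n x y → f y = g y) :
    T.E n f x = T.E n g x := by
  rw [E_eq_sum, E_eq_sum]
  apply Finset.sum_congr rfl
  intro y hy
  rw [h y (T.mem_supp.1 hy)]

lemma p_add (m n : ℕ) (x z : X) : T.p (m+n) x z = T.E m (fun y => T.p n y z) x := by
  classical
  rw [p_eq_E, E_add_time]
  congr 1; ext y; rw [p_eq_E]

lemma p_mul_le (m n : ℕ) (x y z : X) : T.p m x y * T.p n y z ≤ T.p (m+n) x z := by
  rw [p_add]; exact T.term_le_E m (fun y => T.p n y z) (fun y => T.p_nonneg _ _ _) x y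

lemma p_one_pos {x y : X} (h : y ∈ T.nb x) : 0 < T.p 1 x y := by
  classical
  rw [p_eq_E, show (1:ℕ) = 0 + 1 from rfl, E_eq', Function.iterate_one, A, smul_eq_mul]
  have := T.dR_pos
  simp [h, this]

lemma two_pos {x y : X} (h : T.two x y) : 0 < T.p 2 x y := by
  obtain ⟨z, h1, h2⟩ := h
  exact lt_of_lt_of_le (mul_pos (T.p_one_pos h1) (T.p_one_pos h2)) (T.p_mul_le 1 1 x z y)

lemma p_zero_self (x : X) : T.p 0 x x = 1 := by simp [p]

lemma chain_pos {x y : X} {k : ℕ} (h : T.Chain2 x k y) : 0 < T.p (2*k) x y := by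
  induction h with
  | nil => simp [p_zero_self]
  | cons h1 h2 ih =>
    exact lt_of_lt_of_le (mul_pos ih (T.two_pos h2)) (T.p_mul_le _ 2 x _ _)

lemma sup_mono (hl : ∀ x, x ∈ T.nb x) (a : X) : Monotone (T.sup a) := by
  apply monotone_nat_of_le_succ
  intro n y hy
  rw [sup, mem_supp] at hy ⊢
  exact lt_of_lt_of_le (mul_pos hy (T.p_one_pos (hl y))) (T.p_mul_le n 1 a y y)

/-- entropy -/
noncomputable def ent (n : ℕ) (x : X) : ℝ := T.E n (fun y => -Real.log (T.p n x y)) x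

lemma ent_le (n : ℕ) (x : X) : T.ent n x ≤ Real.log (T.sup x n).card := by
  have h1 := T.sum_p n x
  have hN : 0 < ((T.sup x n).card : ℝ) := by
    rcases Finset.eq_empty_or_nonempty (T.sup x n) with h | h
    · rw [sup] at h; rw [h] at h1; simp at h1
    · exact_mod_cast h.card_pos
  set N := ((T.sup x n).card : ℝ)
  have : T.ent n x - Real.log N ≤ 0 := by
    rw [ent, ← T.E_const n (Real.log N) x, ← E_sub, E_eq_sum]
    calc _ ≤ ∑ y ∈ ((T.P ^ n) (Finsupp.single x 1)).support, (1/N - T.p n x y) := by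
          apply Finset.sum_le_sum
          intro y hy
          have hp := T.mem_supp.1 hy
          have := Real.log_le_sub_one_of_pos (show 0 < 1/(T.p n x y * N) by positivity)
          rw [one_div, Real.log_inv, Real.log_mul hp.ne' hN.ne'] at this
          rw [smul_eq_mul]
          have h2 := mul_le_mul_of_nonneg_left this hp.le
          have h3 : T.p n x y * ((T.p n x y * N)⁻¹ - 1) = 1/N - T.p n x y := by
            field_simp
          rw [h3] at h2
          linarith
      _ = 0 := by
          rw [Finset.sum_sub_distrib, h1, Finset.sum_const, nsmul_eq_mul]
          have : ((((T.P ^ n) (Finsupp.single x 1)).support).card:ℝ) = N := rfl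
          rw [this]; field_simp; simp
  linarith

lemma ent_const [MulAction.IsPretransitive Γ X] (n : ℕ) (x y : X) : T.ent n x = T.ent n y := by
  obtain ⟨γ, rfl⟩ := MulAction.exists_smul_eq Γ y x
  rw [ent, E_inv, ent]
  simp only [p_inv]

lemma ent_incr [MulAction.IsPretransitive Γ X] (m : ℕ) (a : X) (s : ℝ) (B : X → X → ℝ)
    (hB : ∀ z y, B z y = 0 ∨ B z y = 1) :
    s * T.E m (fun z => T.E m (B z) z) a - (Real.exp s - 1) * T.E m (fun z => T.E (m+m) (B z) a) a
      ≤ T.ent (m+m) a - T.ent m a := by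
  have e1 : T.ent m a = T.E m (fun z => T.E m (fun y => - Real.log (T.p m z y)) z) a := by
    have : (fun z => T.E m (fun y => - Real.log (T.p m z y)) z) = fun _ => T.ent m a := by
      ext z; exact T.ent_const m z a
    rw [this, E_const]
  have e2 : T.ent (m+m) a = T.E m (fun z => T.E m (fun y => - Real.log (T.p (m+m) a y)) z) a := by
    rw [ent, E_add_time]
  rw [e1, e2, ← E_sub, ← E_mul, ← E_mul, ← E_sub]
  apply T.E_mono' m
  intro z hz
  rw [← E_sub]
  have h1 : ∑ y ∈ ((T.P ^ m) (Finsupp.single z 1)).support, T.p (m+m) a y * Real.exp (s * B z y)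
      ≤ 1 + (Real.exp s - 1) * T.E (m+m) (B z) a := by
    refine (T.sum_le_E (m+m) (fun y => Real.exp (s * B z y)) (fun y => (Real.exp_pos _).le) a _).trans ?_
    rw [← E_mul]
    have e : (1:ℝ) + T.E (m+m) (fun y => (Real.exp s - 1) * B z y) a =
        T.E (m+m) (fun y => 1 + (Real.exp s - 1) * B z y) a := by
      rw [E_add, E_const]
    rw [e]
    apply T.E_mono
    intro y
    rcases hB z y with h | h <;> simp [h]
  have h2 : s * T.E m (B z) z - ∑ y ∈ ((T.P ^ m) (Finsupp.single z 1)).support,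
      T.p (m+m) a y * Real.exp (s * B z y) + 1 ≤
      T.E m (fun y => -Real.log (T.p (m + m) a y) - -Real.log (T.p m z y)) z := by
    rw [← E_mul, E_eq_sum, E_eq_sum]
    have e : ∀ r : ℝ, r + 1 = r + ∑ y ∈ ((T.P ^ m) (Finsupp.single z 1)).support, T.p m z y := by
      intro r; rw [T.sum_p m z]
    rw [e, ← Finset.sum_sub_distrib, ← Finset.sum_add_distrib]
    apply Finset.sum_le_sum
    intro y hy
    have hp := T.mem_supp.1 hy
    have hq : 0 < T.p (m+m) a y := lt_of_lt_of_le (mul_pos hz hp) (T.p_mul_le m m a z y)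
    set P := T.p m z y
    set Q := T.p (m+m) a y
    have := Real.log_le_sub_one_of_pos (show 0 < Q * Real.exp (s * B z y) / P by positivity)
    rw [Real.log_div (by positivity) hp.ne', Real.log_mul hq.ne' (Real.exp_pos _).ne', Real.log_exp] at this
    have h3 := mul_le_mul_of_nonneg_left this hp.le
    have h4 : P * (Q * Real.exp (s * B z y) / P - 1) = Q * Real.exp (s * B z y) - P := by field_simp
    rw [h4] at h3
    simp only [smul_eq_mul]
    nlinarith
  linarith

end TW
end RotorWalk

namespace RotorWalk
set_option linter.unusedSectionVars false
namespace Coc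
variable {Γ X : Type*} [Group Γ] [MulAction Γ X] [MulAction.IsPretransitive Γ X] {T : TW Γ X} {a : X}
  {H : Type*} [NormedAddCommGroup H] [InnerProductSpace ℝ H] (c : Coc T a H)

lemma step_bdd : ∃ R : ℝ, 0 < R ∧ ∀ x y, 0 < T.p 2 x y → ‖c.b y - c.b x‖ ≤ R := by
  refine ⟨∑ y ∈ ((T.P ^ 2) (Finsupp.single a 1)).support, ‖c.b y - c.b a‖ + 1, by positivity, ?_⟩
  intro x y h
  obtain ⟨γ, rfl⟩ := MulAction.exists_smul_eq Γ a x
  have h2 : 0 < T.p 2 a (γ⁻¹ • y) := by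
    rw [← T.p_inv 2 γ]; simpa using h
  have h3 := Finset.single_le_sum (f := fun y => ‖c.b y - c.b a‖) (fun _ _ => norm_nonneg _)
    (T.mem_supp.2 h2)
  have h4 := c.bdiff γ (γ⁻¹ • y) a
  rw [smul_inv_smul] at h4
  rw [h4, LinearIsometryEquiv.norm_map]
  linarith

lemma fourth : ∃ C : ℝ, 0 < C ∧ ∀ n : ℕ, T.E (2*n) (fun y => ‖c.b y‖^4) a ≤ C * n^2 := by
  obtain ⟨R, hR, hs⟩ := c.step_bdd
  refine ⟨16*R^2+3*R^4, by positivity, ?_⟩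
  have hz : ∀ z, T.E 2 (fun y => ‖c.b y‖^4) z ≤ ‖c.b z‖^4 + (8*R^2*‖c.b z‖^2 + 3*R^4) := by
    intro z
    have hl := c.harm_lin ((4*‖c.b z‖^2) • innerₗ H (c.b z)) 1 z
    have : T.E 2 (fun y => ‖c.b y‖^4) z ≤ T.E 2 (fun y => (‖c.b z‖^4 + (8*R^2*‖c.b z‖^2 + 3*R^4)) +
        ((4*‖c.b z‖^2) • innerₗ H (c.b z)) (c.b y - c.b z)) z := by
      apply T.E_mono'
      intro y hy
      have h := hs z y hy
      set v := c.b z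
      set D := c.b y - v with hD
      have e : c.b y = v + D := by rw [hD]; abel
      have e1 : ‖c.b y‖^2 = ‖v‖^2 + 2 * inner ℝ v D + ‖D‖^2 := by rw [e, norm_add_sq_real]
      have e2 : ((4*‖v‖^2) • innerₗ H v) D = 4*‖v‖^2 * inner ℝ v D := by
        simp
      rw [e2, show ‖c.b y‖^4 = (‖c.b y‖^2)^2 by ring, e1]
      have i1 : (inner ℝ v D)^2 ≤ ‖v‖^2 * ‖D‖^2 := by
        have := abs_real_inner_le_norm v D
        rw [← mul_pow]; exact sq_le_sq' (by linarith [neg_abs_le (inner ℝ v D : ℝ)]) (le_trans (le_abs_self _) this)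
      have i2 : ‖D‖^2 ≤ R^2 := by gcongr
      have i3 : ‖v‖^2 * ‖D‖^2 ≤ ‖v‖^2 * R^2 := by gcongr
      have i4 : (‖D‖^2)^2 ≤ (R^2)^2 := by gcongr
      nlinarith [sq_nonneg (inner ℝ v D - ‖D‖^2)]
    refine this.trans ?_
    rw [TW.E_add, TW.E_const]
    rw [mul_one] at hl
    rw [hl, add_zero]
  intro n
  induction n with
  | zero => simp [TW.E, c.ba]
  | succ n ih =>
    rw [show 2*(n+1) = 2*n+2 by ring, TW.E_add_time]
    refine (T.E_mono (2*n) hz a).trans ?_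
    have e := c.en_n n a
    simp only [c.ba, sub_zero] at e
    rw [TW.E_add, TW.E_add, TW.E_const, TW.E_mul, e]
    push_cast
    nlinarith [mul_pos hR hR, pow_pos hR 4, mul_nonneg (Nat.cast_nonneg (α := ℝ) n) (pow_pos hR 4).le]

open Classical in
lemma anticonc : ∃ δ : ℝ, 0 < δ ∧ ∀ n : ℕ, 1 ≤ n →
    δ ≤ T.E (2*n) (fun z => if (n:ℝ) ≤ ‖c.b z‖^2 then (1:ℝ) else 0) a := by
  obtain ⟨C, hC, h4⟩ := c.fourth
  refine ⟨1/(4*C), by positivity, ?_⟩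
  intro n hn
  have hn' : (0:ℝ) < n := by exact_mod_cast hn
  have e := c.en_n n a
  simp only [c.ba, sub_zero] at e
  have h := T.E_mono (2*n) (f := fun y => ‖c.b y‖^2) (g := fun y => (n:ℝ) +
    ((2*C*n) * (if (n:ℝ) ≤ ‖c.b y‖^2 then (1:ℝ) else 0) + (1/(2*C*n)) * ‖c.b y‖^4)) (by
      intro y
      have h2 : 0 ≤ (1/(2*C*n)) * ‖c.b y‖^4 := by positivity
      split_ifs with h
      · have : ‖c.b y‖^2 ≤ 2*C*n + (1/(2*C*n)) * ‖c.b y‖^4 := by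
          rw [show ‖c.b y‖^4 = (‖c.b y‖^2)^2 by ring]
          set t := ‖c.b y‖^2
          have ht : 0 ≤ t := by positivity
          rw [← sub_nonneg]
          have : 2*C*n + (1/(2*C*n)) * t^2 - t = ((2*C*n - t)^2 + (2*C*n)*t)/(2*C*n) := by
            field_simp; ring
          rw [this]; positivity
        linarith
      · push Not at h; linarith) a
  rw [e, TW.E_add, TW.E_add, TW.E_const, TW.E_mul, TW.E_mul] at h
  have h5 : (1/(2*C*n)) * T.E (2*n) (fun y => ‖c.b y‖^4) a ≤ n/2 := by
    calc _ ≤ (1/(2*C*n)) * (C * n^2) := by gcongr; exact h4 n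
      _ = n/2 := by field_simp
  set Pp := T.E (2*n) (fun z => if (n:ℝ) ≤ ‖c.b z‖^2 then (1:ℝ) else 0) a
  have h6 : (n:ℝ)/2 ≤ 2*C*n*Pp := by linarith
  rw [div_le_iff₀ (by positivity)]
  have : (1:ℝ)/2 * n ≤ (2*C*Pp) * n := by linarith
  have := le_of_mul_le_mul_right this hn'
  linarith

variable {W : Type*} [NormedAddCommGroup W] [InnerProductSpace ℝ W]
  (τ : H →ₗ[ℝ] H →ₗ[ℝ] W) (πW : Γ →* (W ≃ₗᵢ[ℝ] W))
  (hτ : ∀ x y x' y', inner ℝ (τ x y) (τ x' y') = (inner ℝ x x' * inner ℝ y y' : ℝ))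
  (hπ : ∀ γ x y, πW γ (τ x y) = τ (c.π γ x) (c.π γ y))

include hπ in
lemma V_smul (n : ℕ) (γ : Γ) (x : X) : c.V τ n (γ • x) = πW γ (c.V τ n x) :=
  c.V_act τ (πW γ).toLinearEquiv.toLinearMap γ (hπ γ) n x

include hπ in
lemma V_norm (n : ℕ) (x : X) : ‖c.V τ n x‖ = ‖c.V τ n a‖ := by
  obtain ⟨γ, rfl⟩ := MulAction.exists_smul_eq Γ a x
  rw [c.V_smul τ πW hπ, LinearIsometryEquiv.norm_map]

include hτ in
lemma V_inner (n : ℕ) (x : X) (v : H) :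
    T.E (2*n) (fun y => (inner ℝ v (c.b y - c.b x))^2) x = inner ℝ (τ v v) (c.V τ n x) := by
  rw [V, ← innerₗ_apply_apply, ← TW.E_lin]
  congr 1; ext y; rw [innerₗ_apply_apply, hτ, sq]

include hτ in
lemma τ_norm (v : H) : ‖τ v v‖ = ‖v‖^2 := by
  have := hτ v v v v
  rw [real_inner_self_eq_norm_sq, real_inner_self_eq_norm_sq] at this
  have h2 : ‖τ v v‖^2 = (‖v‖^2)^2 := by rw [this]; ring
  exact (pow_left_inj₀ (norm_nonneg _) (by positivity) two_ne_zero).1 h2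

open Classical in
include hτ hπ in
lemma pair_prob (n : ℕ) (hn : 1 ≤ n) :
    T.E (2*n) (fun z => if (n:ℝ) ≤ ‖c.b z‖^2 then (1:ℝ) else 0) a - 8 * (‖c.V τ n a‖/n) ≤
    T.E (2*n) (fun z => T.E (2*n) (fun y => if (n:ℝ)/2 ≤ inner ℝ (c.b z) (c.b y) then (1:ℝ) else 0) z) a := by
  have hn' : (0:ℝ) < n := by exact_mod_cast hn
  have e := c.en_n n a
  simp only [c.ba, sub_zero] at e
  have h1 : ∀ z, (if (n:ℝ) ≤ ‖c.b z‖^2 then (1:ℝ) else 0) - (4/n^2*‖c.V τ n a‖) * ‖c.b z‖^2 ≤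
      T.E (2*n) (fun y => if (n:ℝ)/2 ≤ inner ℝ (c.b z) (c.b y) then (1:ℝ) else 0) z := by
    intro z
    have h2 := T.E_mono (2*n) (f := fun y => (if (n:ℝ) ≤ ‖c.b z‖^2 then (1:ℝ) else 0) -
      (4/n^2) * (inner ℝ (c.b z) (c.b y - c.b z))^2)
      (g := fun y => if (n:ℝ)/2 ≤ inner ℝ (c.b z) (c.b y) then (1:ℝ) else 0) (by
      intro y
      have h0 : 0 ≤ (4/(n:ℝ)^2) * (inner ℝ (c.b z) (c.b y - c.b z))^2 := by positivity
      split_ifs with h h' h'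
      · linarith
      · rw [inner_sub_right, real_inner_self_eq_norm_sq]
        push Not at h'
        rw [sub_nonpos, div_mul_eq_mul_div, le_div_iff₀ (by positivity)]
        nlinarith
      · linarith
      · linarith) z
    rw [TW.E_sub, TW.E_const, TW.E_mul, c.V_inner τ hτ] at h2
    refine le_trans ?_ h2
    have h3 : inner ℝ (τ (c.b z) (c.b z)) (c.V τ n z) ≤ ‖c.b z‖^2 * ‖c.V τ n a‖ := by
      refine (real_inner_le_norm _ _).trans ?_
      rw [τ_norm τ hτ, c.V_norm τ πW hπ]
    have h4 : 4/(n:ℝ)^2 * inner ℝ (τ (c.b z) (c.b z)) (c.V τ n z) ≤ 4/(n:ℝ)^2*(‖c.b z‖^2 * ‖c.V τ n a‖) := by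
      gcongr
    linarith
  refine le_trans (le_of_eq ?_) (T.E_mono (2*n) h1 a)
  rw [TW.E_sub, TW.E_mul, e]
  congr 1
  field_simp
  ring

open Classical in
include hτ in
lemma indep_prob (n : ℕ) (hn : 1 ≤ n) :
    T.E (2*n) (fun z => T.E (2*(n+n)) (fun y => if (n:ℝ)/2 ≤ inner ℝ (c.b z) (c.b y) then (1:ℝ) else 0) a) a
    ≤ 4 * (‖c.V τ n a‖/n) * (‖c.V τ (n+n) a‖/n) := by
  have hn' : (0:ℝ) < n := by exact_mod_cast hn
  have h1 : ∀ z, T.E (2*(n+n)) (fun y => if (n:ℝ)/2 ≤ inner ℝ (c.b z) (c.b y) then (1:ℝ) else 0) a ≤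
      (4/(n:ℝ)^2) * inner ℝ (c.V τ (n+n) a) (τ (c.b z - c.b a) (c.b z - c.b a)) := by
    intro z
    rw [c.ba, sub_zero, real_inner_comm, ← c.V_inner τ hτ, ← TW.E_mul]
    apply T.E_mono
    intro y
    rw [c.ba, sub_zero]
    split_ifs with h
    · rw [div_mul_eq_mul_div, le_div_iff₀ (by positivity)]
      nlinarith
    · positivity
  refine (T.E_mono (2*n) h1 a).trans ?_
  rw [TW.E_mul]
  have : T.E (2*n) (fun z => inner ℝ (c.V τ (n+n) a) (τ (c.b z - c.b a) (c.b z - c.b a))) a =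
      inner ℝ (c.V τ (n+n) a) (c.V τ n a) := by
    nth_rewrite 3 [V]
    rw [← innerₗ_apply_apply (c.V τ (n+n) a), ← TW.E_lin]
    rfl
  rw [this]
  calc _ ≤ 4/(n:ℝ)^2 * (‖c.V τ (n+n) a‖ * ‖c.V τ n a‖) := by
        gcongr; exact real_inner_le_norm _ _
    _ = _ := by field_simp

open Classical in
include hτ hπ in
lemma ent_grow (h0 : Tendsto (fun n : ℕ => ‖c.V τ n a‖/n) atTop (nhds 0)) (M : ℝ) :
    ∀ᶠ n in atTop, M ≤ T.ent (2*n + 2*n) a - T.ent (2*n) a := by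
  obtain ⟨δ, hδ, hd⟩ := c.anticonc
  set s := 2*(|M|+1)/δ
  have hs : 0 < s := by positivity
  have h2 : Tendsto (fun n : ℕ => ‖c.V τ (n+n) a‖/n) atTop (nhds 0) := by
    have : Tendsto (fun n : ℕ => n + n) atTop atTop := tendsto_atTop_mono (fun n => by simp) tendsto_id
    have := (h0.comp this).const_mul 2
    rw [mul_zero] at this
    refine this.congr (fun n => ?_)
    simp only [Function.comp]
    push_cast
    rcases eq_or_ne (n:ℝ) 0 with h | h
    · simp [h]
    · field_simp; ring
  have h3 : Tendsto (fun n : ℕ => s * (δ - 8 * (‖c.V τ n a‖/n)) - (Real.exp s - 1) *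
      (4 * (‖c.V τ n a‖/n) * (‖c.V τ (n+n) a‖/n))) atTop (nhds (s * (δ - 8 * 0) - (Real.exp s - 1) * (4 * 0 * 0))) :=
    ((h0.const_mul 8).const_sub δ |>.const_mul s).sub ((((h0.const_mul 4).mul h2)).const_mul _)
  have h4 : M < s * (δ - 8 * 0) - (Real.exp s - 1) * (4 * 0 * 0) := by
    have : s * δ = 2*(|M|+1) := by simp only [s]; field_simp
    simp only [mul_zero, sub_zero, this]
    linarith [le_abs_self M, abs_nonneg M]
  filter_upwards [h3.eventually_const_lt h4, eventually_ge_atTop 1] with n hn hn1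
  refine hn.le.trans ?_
  refine le_trans ?_ (T.ent_incr (2*n) a s (fun z y => if (n:ℝ)/2 ≤ inner ℝ (c.b z) (c.b y) then (1:ℝ) else 0) (by
    intro z y; split_ifs <;> simp))
  have k1 := c.pair_prob τ πW hτ hπ n hn1
  have k2 := c.indep_prob τ hτ n hn1
  have k3 := hd n hn1
  rw [mul_add] at k2
  have k4 : 0 ≤ Real.exp s - 1 := by linarith [Real.add_one_le_exp s]
  have := mul_le_mul_of_nonneg_left (sub_le_sub_right k3 (8 * (‖c.V τ n a‖/n)) |>.trans k1) hs.le
  have := mul_le_mul_of_nonneg_left k2 k4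
  linarith

include hτ hπ in
/-- the normalised second moment does not vanish -/
lemma not_small (hl : ∀ x, x ∈ T.nb x) (D : ℕ)
    (hg : ∀ N0, ∃ N ≥ N0, ((T.sup a N).card : ℝ) ≤ (N:ℝ) ^ D)
    (h0 : Tendsto (fun n : ℕ => ‖c.V τ n a‖/n) atTop (nhds 0)) : False := by
  set M : ℝ := D * Real.log 2 + 1
  obtain ⟨n0, hn0⟩ := eventually_atTop.1 (c.ent_grow τ πW hτ hπ h0 M)
  have key : ∀ k : ℕ, T.ent (2*2^n0) a + M * k ≤ T.ent (2*2^(n0+k)) a := by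
    intro k
    induction k with
    | zero => simp
    | succ k ih =>
      have := hn0 (2^(n0+k)) (le_trans (by omega) Nat.lt_two_pow_self.le)
      have e : 2*2^(n0+k)+2*2^(n0+k) = 2*2^(n0+(k+1)) := by ring
      rw [e] at this
      push_cast
      linarith
  obtain ⟨k0, hk0⟩ := exists_nat_gt (D * Real.log 2 * (n0+2) - T.ent (2*2^n0) a)
  obtain ⟨N, hN, hN2⟩ := hg (2*2^(n0+k0))
  have hNpos : N ≠ 0 := by have : 0 < 2*2^(n0+k0) := by positivity
                           omega
  -- N between powers of two
  obtain ⟨j, hj⟩ : ∃ j, j = Nat.log 2 N := ⟨_, rfl⟩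
  have hj1 : 2^j ≤ N := hj ▸ Nat.pow_log_le_self 2 hNpos
  have hj2 : N < 2^(j+1) := hj ▸ Nat.lt_pow_succ_log_self (by norm_num) N
  have hj3 : n0+k0+1 ≤ j := by
    have : 2^(n0+k0+1) < 2^(j+1) := by rw [pow_succ]; omega
    have := (Nat.pow_lt_pow_iff_right (by norm_num)).1 this
    omega
  obtain ⟨k, rfl⟩ : ∃ k, j = n0+k+1 := ⟨j - n0 - 1, by omega⟩
  have hk := key k
  have h1 := T.ent_le (2*2^(n0+k)) a
  have h2 : (T.sup a (2*2^(n0+k))).card ≤ (T.sup a N).card := Finset.card_le_card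
    (T.sup_mono hl a (by rw [pow_succ] at hj1; omega))
  have hpos : 0 < (T.sup a (2*2^(n0+k))).card := by
    rcases Nat.eq_zero_or_pos (T.sup a (2*2^(n0+k))).card with h | h
    · have := T.sum_p (2*2^(n0+k)) a
      rw [Finset.card_eq_zero, TW.sup] at h
      rw [h] at this; simp at this
    · exact h
  have h3 : Real.log (T.sup a (2*2^(n0+k))).card ≤ D * (Real.log 2 * (n0+k+2)) := by
    calc _ ≤ Real.log (((2:ℝ)^(n0+k+2))^D) := by
          apply Real.log_le_log (by exact_mod_cast hpos)
          refine le_trans (by exact_mod_cast h2) (hN2.trans ?_)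
          gcongr
          exact_mod_cast hj2.le
      _ = _ := by rw [Real.log_pow, Real.log_pow]; push_cast; ring
  have : (k0:ℝ) ≤ k := by exact_mod_cast (by omega : k0 ≤ k)
  simp only [M] at hk
  nlinarith

end Coc
end RotorWalk

namespace RotorWalk
set_option linter.unusedSectionVars false
namespace Coc
variable {Γ X : Type*} [Group Γ] [MulAction Γ X] [MulAction.IsPretransitive Γ X] {T : TW Γ X} {a : X}
  {H : Type*} [NormedAddCommGroup H] [InnerProductSpace ℝ H] (c : Coc T a H)
variable {W : Type*} [NormedAddCommGroup W] [InnerProductSpace ℝ W] [CompleteSpace W]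
  (τ : H →ₗ[ℝ] H →ₗ[ℝ] W) (πW : Γ →* (W ≃ₗᵢ[ℝ] W))
  (hτ : ∀ x y x' y', inner ℝ (τ x y) (τ x' y') = (inner ℝ x x' * inner ℝ y y' : ℝ))
  (hπ : ∀ γ x y, πW γ (τ x y) = τ (c.π γ x) (c.π γ y))

include hπ in
lemma lim_exists : ∃ F : W, Tendsto (fun n : ℕ => (n:ℝ)⁻¹ • c.V τ n a) atTop (nhds F) := by
  choose g hg using fun z => MulAction.exists_smul_eq Γ a z
  let 𝓛 : W →L[ℝ] W := ∑ z ∈ ((T.P ^ 2) (Finsupp.single a 1)).support,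
    T.p 2 a z • ((πW (g z)).toContinuousLinearEquiv : W →L[ℝ] W)
  have h𝓛 : ∀ w, 𝓛 w = T.E 2 (fun z => πW (g z) w) a := by
    intro w
    rw [TW.E_eq_sum]
    simp [𝓛]
  have hn : ‖𝓛‖ ≤ 1 := by
    refine 𝓛.opNorm_le_bound zero_le_one (fun w => ?_)
    rw [h𝓛, TW.E_eq_sum]
    refine (norm_sum_le _ _).trans ?_
    simp only [norm_smul, LinearIsometryEquiv.norm_map]
    rw [← Finset.sum_mul]
    gcongr
    refine le_of_eq (Eq.trans ?_ (T.sum_p 2 a))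
    apply Finset.sum_congr rfl
    intro z _; rw [Real.norm_of_nonneg (T.p_nonneg _ _ _)]
  have hV : ∀ n, c.V τ n a = birkhoffSum 𝓛 _root_.id n (c.V τ 1 a) := by
    intro n
    induction n with
    | zero => simp [V, TW.E]
    | succ n ih =>
      rw [add_comm, V_add, mul_one, add_comm 1 n, birkhoffSum_succ', add_comm]
      congr 1
      have h1 : birkhoffSum 𝓛 _root_.id n (𝓛 (c.V τ 1 a)) = 𝓛 (c.V τ n a) := by
        rw [ih]; simp [birkhoffSum, ← Function.iterate_succ_apply, Function.iterate_succ_apply']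
      rw [h1, h𝓛]
      congr 1; ext z
      conv_lhs => rw [← hg z]
      exact c.V_smul τ πW hπ n (g z) a
  refine ⟨_, (𝓛.tendsto_birkhoffAverage_orthogonalProjection hn (c.V τ 1 a)).congr (fun n => ?_)⟩
  rw [birkhoffAverage, ← hV]

include hπ in
lemma lim_inv (hch : ∀ y, ∃ k, T.Chain2 a k y) {F : W}
    (hF : Tendsto (fun n : ℕ => (n:ℝ)⁻¹ • c.V τ n a) atTop (nhds F)) (γ : Γ) : πW γ F = F := by
  choose g hg using fun z => MulAction.exists_smul_eq Γ a z
  have hFx : ∀ γ : Γ, Tendsto (fun n : ℕ => (n:ℝ)⁻¹ • c.V τ n (γ • a)) atTop (nhds (πW γ F)) := by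
    intro γ
    refine (((πW γ).continuous.tendsto F).comp hF).congr (fun n => ?_)
    simp only [Function.comp]
    rw [map_smul, c.V_smul τ πW hπ]
  obtain ⟨k, hk⟩ := hch (γ • a)
  have hp := T.chain_pos hk
  let Φ : X → W := fun z => πW (g z) F
  have hΦ : ∀ z, Tendsto (fun n : ℕ => (n:ℝ)⁻¹ • c.V τ n z) atTop (nhds (Φ z)) := by
    intro z; have := hFx (g z); rwa [hg z] at this
  have h1 : T.E (2*k) Φ a = F := by
    have e1 : Tendsto (fun n : ℕ => T.E (2*k) (fun z => (n:ℝ)⁻¹ • c.V τ n z) a) atTop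
        (nhds (T.E (2*k) Φ a)) := by
      simp only [TW.E_eq_sum]
      exact tendsto_finsetSum _ (fun z _ => (hΦ z).const_smul _)
    have e2 : ∀ n : ℕ, 1 ≤ n → T.E (2*k) (fun z => (n:ℝ)⁻¹ • c.V τ n z) a =
        (((n + k : ℕ):ℝ) / n) • (((n+k:ℕ):ℝ)⁻¹ • c.V τ (n+k) a) - (n:ℝ)⁻¹ • c.V τ k a := by
      intro n hn
      have hn' : (n:ℝ) ≠ 0 := by positivity
      have hn'' : ((n+k:ℕ):ℝ) ≠ 0 := by positivity
      rw [smul_smul, div_mul_eq_mul_div, mul_inv_cancel₀ hn'', one_div, add_comm n k, V_add,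
        smul_add, add_sub_cancel_right]
      exact T.E_lin (2*k) (LinearMap.lsmul ℝ W ((n:ℝ)⁻¹)) (c.V τ n) a
    have e3 : Tendsto (fun n : ℕ => (((n + k : ℕ):ℝ) / n) • (((n+k:ℕ):ℝ)⁻¹ • c.V τ (n+k) a) -
        (n:ℝ)⁻¹ • c.V τ k a) atTop (nhds ((1:ℝ) • F - (0:ℝ) • c.V τ k a)) := by
      refine Tendsto.sub (Tendsto.smul ?_ (hF.comp (tendsto_add_atTop_nat k)))
        (Tendsto.smul tendsto_inv_atTop_nhds_zero_nat tendsto_const_nhds)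
      have : Tendsto (fun n : ℕ => 1 + (k:ℝ) * (n:ℝ)⁻¹) atTop (nhds (1 + k * 0)) :=
        (tendsto_inv_atTop_nhds_zero_nat.const_mul _).const_add _
      rw [mul_zero, add_zero] at this
      refine this.congr' ?_
      filter_upwards [eventually_ge_atTop 1] with n hn
      have hn' : (n:ℝ) ≠ 0 := by positivity
      push_cast; field_simp
    rw [one_smul, zero_smul, sub_zero] at e3
    refine tendsto_nhds_unique (e1.congr' ?_) e3
    filter_upwards [eventually_ge_atTop 1] with n hn
    exact e2 n hn
  have h2 : T.E (2*k) (fun z => ‖Φ z - F‖^2) a = 0 := by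
    have e : (fun z => ‖Φ z - F‖^2) = fun z => 2*‖F‖^2 - 2 * innerₗ W F (Φ z) := by
      ext z
      rw [norm_sub_sq_real, innerₗ_apply_apply, real_inner_comm, LinearIsometryEquiv.norm_map]; ring
    rw [e, TW.E_sub, TW.E_const, TW.E_mul, TW.E_lin, h1, innerₗ_apply_apply, real_inner_self_eq_norm_sq]
    ring
  have h3 := T.term_le_E (2*k) (fun z => ‖Φ z - F‖^2) (fun z => by positivity) a (γ • a)
  rw [h2] at h3
  have h4 : ‖Φ (γ • a) - F‖^2 ≤ 0 := by
    by_contra h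
    push Not at h
    have := mul_pos hp h
    linarith
  have h5 : Φ (γ • a) = F := by
    have : ‖Φ (γ • a) - F‖ = 0 := by
      have := le_antisymm h4 (by positivity)
      exact pow_eq_zero_iff two_ne_zero |>.1 this
    exact sub_eq_zero.1 (norm_eq_zero.1 this)
  rw [← tendsto_nhds_unique (hFx γ) (hΦ (γ • a))] at h5
  exact h5

end Coc
end RotorWalk

namespace RotorWalk
set_option linter.unusedSectionVars false
lemma rep_mul {Γ H : Type*} [Group Γ] [NormedAddCommGroup H] [InnerProductSpace ℝ H] (π : Γ →* (H ≃ₗᵢ[ℝ] H))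
    (γ γ' : Γ) (v : H) : π (γ*γ') v = π γ (π γ' v) := by rw [map_mul]; rfl
lemma rep_inv {Γ H : Type*} [Group Γ] [NormedAddCommGroup H] [InnerProductSpace ℝ H] (π : Γ →* (H ≃ₗᵢ[ℝ] H))
    (γ : Γ) (v : H) : π γ (π γ⁻¹ v) = v := by rw [← rep_mul, mul_inv_cancel, map_one]; rfl
lemma rep_inv' {Γ H : Type*} [Group Γ] [NormedAddCommGroup H] [InnerProductSpace ℝ H] (π : Γ →* (H ≃ₗᵢ[ℝ] H))
    (γ : Γ) (v : H) : π γ⁻¹ (π γ v) = v := by rw [← rep_mul, inv_mul_cancel, map_one]; rfl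
namespace Coc
variable {Γ X : Type*} [Group Γ] [MulAction Γ X] [MulAction.IsPretransitive Γ X] {T : TW Γ X} {a : X}
  {H : Type*} [NormedAddCommGroup H] [InnerProductSpace ℝ H] [CompleteSpace H] (c : Coc T a H)
variable {W : Type*} [NormedAddCommGroup W] [InnerProductSpace ℝ W] [CompleteSpace W]
  (τ : H →ₗ[ℝ] H →ₗ[ℝ] W) (πW : Γ →* (W ≃ₗᵢ[ℝ] W))
  (hτ : ∀ x y x' y', inner ℝ (τ x y) (τ x' y') = (inner ℝ x x' * inner ℝ y y' : ℝ))
  (hπ : ∀ γ x y, πW γ (τ x y) = τ (c.π γ x) (c.π γ y))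

/-- rank one operators -/
noncomputable def rk : H →ₗ[ℝ] H →ₗ[ℝ] (H →L[ℝ] H) :=
  LinearMap.mk₂ ℝ (fun u v => (innerSL ℝ v).smulRight u)
    (fun u u' v => by ext; simp) (fun r u v => by ext z; simp [smul_smul, mul_comm])
    (fun u v v' => by ext; simp [add_smul]) (fun r u v => by ext; simp [mul_smul])

lemma rk_compact (u v : H) : rk u v ∈ compactOperator (RingHom.id ℝ) H H := by
  have h : IsCompactOperator (_root_.id : ℝ → ℝ) := isCompactOperator_id
  have := (h.comp_clm (innerSL ℝ v)).clm_comp (ContinuousLinearMap.toSpanSingleton ℝ u)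
  refine cast ?_ this
  congr 1

include hτ in
lemma inner_V (n : ℕ) (u v : H) : inner ℝ (c.V rk n a u) v = inner ℝ (c.V τ n a) (τ u v) := by
  have e1 : inner ℝ (c.V rk n a u) v =
      ((innerₗ H v).comp ((ContinuousLinearMap.apply ℝ H u).toLinearMap)) (c.V rk n a) := by
    simp [real_inner_comm]
  rw [e1, V, ← TW.E_lin, real_inner_comm, V, ← innerₗ_apply_apply, ← TW.E_lin]
  congr 1; ext y
  rw [innerₗ_apply_apply, hτ, LinearMap.comp_apply]
  simp only [rk, LinearMap.mk₂_apply, innerₗ_apply_apply, ContinuousLinearMap.coe_coe, ContinuousLinearMap.apply_apply,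
    ContinuousLinearMap.smulRight_apply, innerSL_apply_apply, inner_smul_right]
  rw [real_inner_comm u]

include hτ in
lemma τ_norm' (u v : H) : ‖τ u v‖ = ‖u‖ * ‖v‖ := by
  have := hτ u v u v
  rw [real_inner_self_eq_norm_sq, real_inner_self_eq_norm_sq, real_inner_self_eq_norm_sq] at this
  have h2 : ‖τ u v‖^2 = (‖u‖*‖v‖)^2 := by rw [this]; ring
  exact (pow_left_inj₀ (norm_nonneg _) (by positivity) two_ne_zero).1 h2

include hτ in
/-- the operator attached to a tensor -/
lemma op_exists (F : W) : ∃ S : H →L[ℝ] H, ∀ u v, inner ℝ (S u) v = inner ℝ F (τ u v) := by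
  let B : H →L[ℝ] H →L[ℝ] ℝ := LinearMap.mkContinuous₂ (τ.compr₂ (innerₗ W F)) ‖F‖ (by
    intro u v
    simp only [LinearMap.compr₂_apply, innerₗ_apply_apply]
    refine (norm_inner_le_norm _ _).trans ?_
    rw [τ_norm' τ hτ]; linarith)
  refine ⟨InnerProductSpace.continuousLinearMapOfBilin B, fun u v => ?_⟩
  rw [InnerProductSpace.continuousLinearMapOfBilin_apply]
  rfl

include hτ in
lemma op_props {F : W} (hF : Tendsto (fun n : ℕ => (n:ℝ)⁻¹ • c.V τ n a) atTop (nhds F))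
    {S : H →L[ℝ] H} (hS : ∀ u v, inner ℝ (S u) v = inner ℝ F (τ u v)) :
    IsCompactOperator S ∧ S.IsSymmetric := by
  constructor
  · have h1 : Tendsto (fun n : ℕ => (n:ℝ)⁻¹ • c.V rk n a) atTop (nhds S) := by
      rw [tendsto_iff_norm_sub_tendsto_zero] at hF ⊢
      refine squeeze_zero (fun _ => norm_nonneg _) (fun n => ?_) hF
      refine ContinuousLinearMap.opNorm_le_bound _ (norm_nonneg _) (fun u => ?_)
      set w := ((n:ℝ)⁻¹ • c.V rk n a - S) u with hw
      have : inner ℝ w w = inner ℝ ((n:ℝ)⁻¹ • c.V τ n a - F) (τ u w) := by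
        nth_rewrite 1 [hw]
        rw [ContinuousLinearMap.sub_apply, inner_sub_left, inner_sub_left, hS,
          ContinuousLinearMap.smul_apply, inner_smul_left, inner_smul_left, c.inner_V τ hτ]
      have h2 := real_inner_le_norm ((n:ℝ)⁻¹ • c.V τ n a - F) (τ u w)
      rw [← this, real_inner_self_eq_norm_sq, τ_norm' τ hτ] at h2
      rcases (norm_nonneg w).eq_or_lt with h | h
      · rw [← h]; positivity
      · have : ‖w‖ * ‖w‖ ≤ (‖(n:ℝ)⁻¹ • c.V τ n a - F‖ * ‖u‖) * ‖w‖ := by nlinarith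
        exact le_of_mul_le_mul_right this h
    refine isCompactOperator_of_tendsto h1 (Eventually.of_forall (fun n => ?_))
    have : (n:ℝ)⁻¹ • c.V rk n a ∈ compactOperator (RingHom.id ℝ) H H := by
      apply Submodule.smul_mem
      rw [V, TW.E_eq_sum]
      exact Submodule.sum_mem _ (fun y _ => Submodule.smul_mem _ _ (rk_compact _ _))
    exact this
  · intro u v
    have key : ∀ n, inner ℝ (c.V τ n a) (τ u v) = inner ℝ (c.V τ n a) (τ v u) := by
      intro n
      rw [real_inner_comm, real_inner_comm (τ v u), V, ← innerₗ_apply_apply, ← innerₗ_apply_apply,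
        ← TW.E_lin, ← TW.E_lin]
      congr 1; ext y
      rw [innerₗ_apply_apply, innerₗ_apply_apply, hτ, hτ, mul_comm]
    have h3 : inner ℝ F (τ u v) = inner ℝ F (τ v u) := by
      refine tendsto_nhds_unique (hF.inner tendsto_const_nhds) ((hF.inner tendsto_const_nhds).congr (fun n => ?_))
      rw [inner_smul_left, inner_smul_left, key]
    show inner ℝ (S u) v = inner ℝ u (S v)
    rw [real_inner_comm (S v) u, hS, hS, h3]

end Coc

/-- Theorem H -/
theorem TW.fd_cocycle {Γ : Type*} {X : Type u} [Group Γ] [MulAction Γ X] [MulAction.IsPretransitive Γ X]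
    (T : TW Γ X) [Infinite X] (a : X) (hch : ∀ y, ∃ k, T.Chain2 a k y) (hl : ∀ x, x ∈ T.nb x) (D : ℕ)
    (hg : ∀ N0, ∃ N ≥ N0, ((T.sup a N).card : ℝ) ≤ (N:ℝ) ^ D) :
    ∃ (E : Type u) (_ : NormedAddCommGroup E) (_ : InnerProductSpace ℝ E) (_ : FiniteDimensional ℝ E)
      (π : Γ →* (E ≃ₗᵢ[ℝ] E)) (β : X → E), β a = 0 ∧ (∀ γ x, β (γ • x) = π γ (β x) + β (γ • a)) ∧
      (∀ x, T.E 2 β x = β x) ∧ Submodule.span ℝ (range β) = ⊤ ∧ ∃ x, β x ≠ 0 := by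
  obtain ⟨H, i1, i2, i3, π, b, hba, hact, hharm, hen, -⟩ := T.cocycle a hch D hg
  let c : Coc T a H := ⟨π, b, hba, hact, hharm, hen⟩
  obtain ⟨W, j1, j2, j3, τ, πW, hτ, hπ⟩ := tensor_hilbert π
  obtain ⟨F, hF⟩ := c.lim_exists τ πW hπ
  have hinv := c.lim_inv τ πW hπ hch hF
  obtain ⟨S, hS⟩ := Coc.op_exists τ hτ F
  obtain ⟨hcomp, hsymm⟩ := c.op_props τ hτ hF hS
  have hF0 : F ≠ 0 := by
    rintro rfl
    refine c.not_small τ πW hτ hπ hl D hg ?_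
    have := hF.norm
    rw [norm_zero] at this
    refine this.congr (fun n => ?_)
    rw [norm_smul, norm_inv, Real.norm_natCast, div_eq_inv_mul]
  have hFV : ∀ n, inner ℝ F (c.V τ n a) = T.E (2*n) (fun y => inner ℝ (S (b y)) (b y)) a := by
    intro n
    rw [Coc.V, ← innerₗ_apply_apply, ← TW.E_lin]
    congr 1; ext y
    rw [innerₗ_apply_apply, ← hS]
    simp [c, hba]
  have hS0 : S ≠ 0 := by
    rintro rfl
    apply hF0
    have h1 : Tendsto (fun n : ℕ => inner ℝ F ((n:ℝ)⁻¹ • c.V τ n a)) atTop (nhds (inner ℝ F F)) :=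
      tendsto_const_nhds.inner hF
    have h2 : Tendsto (fun n : ℕ => inner ℝ F ((n:ℝ)⁻¹ • c.V τ n a)) atTop (nhds (0:ℝ)) := by
      refine tendsto_const_nhds.congr (fun n => ?_)
      rw [inner_smul_right, hFV]
      simp [TW.E_const]
    exact inner_self_eq_zero.1 (tendsto_nhds_unique h1 h2)
  obtain ⟨μ, hμ, hμ0⟩ : ∃ μ, Module.End.HasEigenvalue (S : Module.End ℝ H) μ ∧ μ ≠ 0 := by
    by_contra h
    push Not at h
    exact hS0 ((ContinuousLinearMap.eq_zero_of_forall_hasEigenvalue_eq_zero hcomp hsymm).1 h)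
  have hfd := ContinuousLinearMap.finite_dimensional_eigenspace hcomp μ hμ0
  set E := Module.End.eigenspace (S : Module.End ℝ H) μ with hE
  have hmem : ∀ v, v ∈ E ↔ S v = μ • v := fun v => Module.End.mem_eigenspace_iff
  have hadj : ∀ γ (u v : H), inner ℝ (π γ u) v = (inner ℝ u (π γ⁻¹ v) : ℝ) := by
    intro γ u v
    rw [← (π γ).inner_map_map u (π γ⁻¹ v)]
    rw [rep_inv]
  have hcm : ∀ γ u, S (π γ u) = π γ (S u) := by
    intro γ u
    refine ext_inner_right ℝ (fun v => ?_)
    rw [hS, hadj, hS]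
    rw [← (πW γ).inner_map_map F (τ u _), hπ, hinv]
    show _ = inner ℝ F (τ (π γ u) (π γ (π γ⁻¹ v)))
    rw [rep_inv]
  have hEinv : ∀ γ, ∀ v ∈ E, π γ v ∈ E := by
    intro γ v hv
    rw [hmem] at hv ⊢
    rw [hcm, hv, map_smul]
  let πE : Γ →* (E ≃ₗᵢ[ℝ] E) :=
    { toFun := fun γ =>
        { toFun := fun v => ⟨π γ v, hEinv γ v v.2⟩
          invFun := fun v => ⟨π γ⁻¹ v, hEinv γ⁻¹ v v.2⟩
          map_add' := fun u v => by ext; simp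
          map_smul' := fun r v => by ext; simp
          left_inv := fun v => by
            ext; simp only
            exact rep_inv' π γ _
          right_inv := fun v => by
            ext; simp only
            exact rep_inv π γ _
          norm_map' := fun v => by
            show ‖π γ v‖ = ‖(v:H)‖
            simp }
      map_one' := by ext v; show (π 1 v : H) = v; simp
      map_mul' := fun γ γ' => by ext v; show (π (γ*γ') v : H) = π γ (π γ' v); rw [map_mul]; rfl }
  have hπE : ∀ γ (v : E), ((πE γ v : E) : H) = π γ v := fun γ v => rfl
  let Pr : H →L[ℝ] E := E.orthogonalProjectionOnto
  have hPr : ∀ u (v : E), inner ℝ (Pr u) v = (inner ℝ u (v:H) : ℝ) := by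
    intro u v
    exact Submodule.inner_orthogonalProjectionOnto_eq_of_mem_right v u
  have hPπ : ∀ γ u, Pr (π γ u) = πE γ (Pr u) := by
    intro γ u
    refine ext_inner_right ℝ (fun v => ?_)
    rw [hPr, hadj]
    have h1 : (inner ℝ (πE γ (Pr u)) v : ℝ) = inner ℝ (Pr u) (πE γ⁻¹ v) := by
      rw [← (πE γ).inner_map_map (Pr u) (πE γ⁻¹ v), rep_inv]
    rw [h1, hPr, hπE]
  have hspan : Submodule.span ℝ (range fun x => Pr (b x)) = ⊤ := by
    rw [← Submodule.orthogonal_eq_bot_iff, Submodule.eq_bot_iff]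
    intro v hv
    have hv' : ∀ x, inner ℝ (v:H) (b x) = (0:ℝ) := by
      intro x
      rw [real_inner_comm, ← hPr]
      exact (Submodule.mem_orthogonal _ _).1 hv _ (Submodule.subset_span ⟨x, rfl⟩)
    have h1 : Tendsto (fun n : ℕ => inner ℝ ((n:ℝ)⁻¹ • c.V τ n a) (τ v v)) atTop (nhds (inner ℝ F (τ v v))) :=
      hF.inner tendsto_const_nhds
    have h2 : Tendsto (fun n : ℕ => inner ℝ ((n:ℝ)⁻¹ • c.V τ n a) (τ v v)) atTop (nhds (0:ℝ)) := by
      refine tendsto_const_nhds.congr (fun n => ?_)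
      rw [inner_smul_left, real_inner_comm, ← c.V_inner τ hτ]
      have : (fun y => (inner ℝ (v:H) (c.b y - c.b a) : ℝ)^2) = fun _ => 0 := by
        ext y; rw [inner_sub_right]; simp [c, hv']
      rw [this, TW.E_const, mul_zero]
    have h3 := tendsto_nhds_unique h1 h2
    rw [← hS, (hmem v).1 v.2, inner_smul_left] at h3
    have h4 : inner ℝ (v:H) (v:H) = (0:ℝ) := by
      rcases mul_eq_zero.1 h3 with h | h
      · exact absurd h hμ0
      · exact h
    ext
    exact inner_self_eq_zero.1 h4
  refine ⟨E, inferInstance, inferInstance, hfd, πE, fun x => Pr (b x), ?_, ?_, ?_, hspan, ?_⟩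
  · simp [hba]
  · intro γ x
    show Pr (b (γ • x)) = πE γ (Pr (b x)) + Pr (b (γ • a))
    rw [hact, map_add, hPπ]
  · intro x
    have := T.E_lin 2 Pr.toLinearMap b x
    rw [hharm] at this
    exact this
  · by_contra h
    push Not at h
    have : (range fun x => Pr (b x)) ⊆ {0} := by rintro _ ⟨x, rfl⟩; exact h x
    have h2 := Submodule.span_mono (R := ℝ) this
    rw [hspan, Submodule.span_zero_singleton, top_le_iff] at h2
    obtain ⟨v, hv⟩ := hμ.exists_hasEigenvector
    have h3 : (⟨v, hv.1⟩ : E) ∈ (⊤ : Submodule ℝ E) := trivial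
    rw [← h2, Submodule.mem_bot] at h3
    exact hv.2 (congrArg Subtype.val h3)

end RotorWalk

namespace RotorWalk
set_option linter.unusedSectionVars false

/-- an action by isometries of a locally finite integer valued metric, with a base point -/
structure Geo (Γ V : Type*) [Group Γ] [MulAction Γ V] where
  δ : V → V → ℕ
  o : V
  self : ∀ x, δ x x = 0
  eq : ∀ x y, δ x y = 0 → x = y
  symm : ∀ x y, δ x y = δ y x
  tri : ∀ x y z, δ x z ≤ δ x y + δ y z
  inv : ∀ (γ : Γ) x y, δ (γ • x) (γ • y) = δ x y
  fin : ∀ x r, {y | δ x y ≤ r}.Finite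

namespace Geo
variable {Γ V : Type*} [Group Γ] [MulAction Γ V] (g : Geo Γ V)

def len (γ : Γ) : ℕ := g.δ g.o (γ • g.o)

lemma len_one : g.len 1 = 0 := by simp [len, g.self]

lemma δ_smul (γ κ : Γ) : g.δ (γ • g.o) (κ • g.o) = g.len (γ⁻¹ * κ) := by
  rw [len, ← g.inv γ⁻¹, smul_smul, smul_smul, inv_mul_cancel, one_smul]

lemma len_mul (γ κ : Γ) : g.len (γ * κ) ≤ g.len γ + g.len κ := by
  refine (g.tri _ (γ • g.o) _).trans ?_
  rw [δ_smul, inv_mul_cancel_left]; rfl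

lemma len_inv (γ : Γ) : g.len γ⁻¹ = g.len γ := by
  have := g.δ_smul γ 1
  rw [mul_one, one_smul] at this
  rw [← this, g.symm, len]

lemma len_pow (γ : Γ) (n : ℕ) : g.len (γ ^ n) ≤ n * g.len γ := by
  induction n with
  | zero => simp [len_one]
  | succ n ih => rw [pow_succ]; have := g.len_mul (γ^n) γ; nlinarith

lemma len_zpow (γ : Γ) (n : ℤ) : g.len (γ ^ n) ≤ n.natAbs * g.len γ := by
  obtain ⟨k, rfl | rfl⟩ := n.eq_nat_or_neg
  · simpa using g.len_pow γ k
  · rw [zpow_neg, len_inv]; simpa using g.len_pow γ k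

lemma len_eq_zero {γ : Γ} : g.len γ = 0 ↔ γ • g.o = g.o :=
  ⟨fun h => (g.eq _ _ h).symm, fun h => by rw [len, h, g.self]⟩

def orb (H : Subgroup Γ) : Set V := {x | ∃ γ ∈ H, γ • g.o = x}

noncomputable def gr (H : Subgroup Γ) (n : ℕ) : ℕ := (g.orb H ∩ {x | g.δ g.o x ≤ n}).ncard

lemma ball_fin (H : Subgroup Γ) (n : ℕ) : (g.orb H ∩ {x | g.δ g.o x ≤ n}).Finite :=
  (g.fin g.o n).subset inter_subset_right

lemma gr_mono {H H' : Subgroup Γ} (h : H ≤ H') {m n : ℕ} (hmn : m ≤ n) : g.gr H m ≤ g.gr H' n := by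
  refine ncard_le_ncard ?_ (g.ball_fin _ _)
  rintro x ⟨⟨γ, hγ, rfl⟩, hx⟩
  exact ⟨⟨γ, h hγ, rfl⟩, le_trans hx hmn⟩

def BG (H : Subgroup Γ) : Prop := ∃ R, ∀ γ ∈ H, γ ∈ Subgroup.closure {s | s ∈ H ∧ g.len s ≤ R}

def CD (H' H : Subgroup Γ) : Prop := ∃ c, ∀ γ ∈ H, ∃ κ ∈ H', g.δ (γ • g.o) (κ • g.o) ≤ c

lemma BG_of_CD {H' H : Subgroup Γ} (hle : H' ≤ H) (hc : g.CD H' H) (hb : g.BG H) : g.BG H' := by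
  obtain ⟨c, hc⟩ := hc
  obtain ⟨R, hR⟩ := hb
  have hsub : Subgroup.closure {s | s ∈ H ∧ g.len s ≤ R} ≤ H := by
    rw [Subgroup.closure_le]; exact fun s hs => hs.1
  refine ⟨R + 2 * c, ?_⟩
  set S' := {s | s ∈ H' ∧ g.len s ≤ R + 2 * c} with hS'
  have stp : ∀ x ∈ H, ∀ y, g.len y ≤ R → (∀ κ ∈ H', g.δ (x • g.o) (κ • g.o) ≤ c → κ ∈ Subgroup.closure S') →
      (∀ κ ∈ H', g.δ ((x * y) • g.o) (κ • g.o) ≤ c → κ ∈ Subgroup.closure S') := by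
    intro x hx y hy ih κ hκ h
    obtain ⟨κ', hκ', h'⟩ := hc x hx
    have h1 := ih κ' hκ' h'
    have h2 : κ'⁻¹ * κ ∈ S' := by
      refine ⟨mul_mem (inv_mem hκ') hκ, ?_⟩
      rw [← δ_smul]
      have e1 := g.tri (κ' • g.o) (x • g.o) (κ • g.o)
      have e2 := g.tri (x • g.o) ((x * y) • g.o) (κ • g.o)
      rw [g.symm] at h'
      have e3 : g.δ (x • g.o) ((x*y) • g.o) = g.len y := by rw [δ_smul, inv_mul_cancel_left]
      omega
    have := mul_mem h1 (Subgroup.subset_closure h2)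
    rwa [mul_inv_cancel_left] at this
  have key : ∀ γ ∈ Subgroup.closure {s | s ∈ H ∧ g.len s ≤ R}, ∀ κ ∈ H', g.δ (γ • g.o) (κ • g.o) ≤ c →
      κ ∈ Subgroup.closure S' := by
    intro γ hγ
    induction hγ using Subgroup.closure_induction_right with
    | one =>
      intro κ hκ h
      refine Subgroup.subset_closure ⟨hκ, ?_⟩
      rw [one_smul] at h
      show g.δ _ _ ≤ _
      omega
    | mul_right x hx y hy ih => exact stp x (hsub hx) y hy.2 ih
    | mul_inv_cancel x hx y hy ih => exact stp x (hsub hx) y⁻¹ (by rw [len_inv]; exact hy.2) ih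
  intro γ hγ
  exact key γ (hR γ (hle hγ)) γ hγ (by rw [g.self]; exact Nat.zero_le _)

lemma CD_of_relIndex {H' H : Subgroup Γ} (hle : H' ≤ H) (h : H'.relIndex H ≠ 0) : g.CD H' H := by
  have : (H'.subgroupOf H).FiniteIndex := ⟨h⟩
  have : Finite (H ⧸ H'.subgroupOf H) := inferInstance
  obtain ⟨c, hc⟩ := (Set.finite_range (fun q : H ⧸ H'.subgroupOf H => g.len (q.out : H))).bddAbove
  refine ⟨c, fun γ hγ => ?_⟩
  set γi : H := ⟨γ⁻¹, inv_mem hγ⟩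
  obtain ⟨u, hu⟩ := QuotientGroup.mk_out_eq_mul (H'.subgroupOf H) γi
  have hu2 : ((u : H) : Γ) ∈ H' := Subgroup.mem_subgroupOf.1 u.2
  refine ⟨(u : H), hu2, ?_⟩
  rw [δ_smul]
  have : γ⁻¹ * ((u:H):Γ) = ((QuotientGroup.mk γi : H ⧸ H'.subgroupOf H).out : H) := by
    rw [hu]; rfl
  rw [this]
  exact hc ⟨_, rfl⟩

end Geo
end RotorWalk

namespace RotorWalk
set_option linter.unusedSectionVars false

lemma exists_surj_int (M : Type*) [AddCommGroup M] [AddGroup.FG M] [Infinite M] :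
    ∃ f : M →+ ℤ, Function.Surjective f := by
  obtain ⟨n, ι, _, p, hp, e, ⟨φ⟩⟩ := AddCommGroup.equiv_free_prod_directSum_zmod M
  rcases Nat.eq_zero_or_pos n with rfl | hn
  · exfalso
    have : ∀ i, NeZero (p i ^ e i) := fun i => ⟨pow_ne_zero _ (hp i).ne_zero⟩
    have h1 : Finite (DirectSum ι fun i => ZMod (p i ^ e i)) := by
      classical
      exact Finite.of_equiv _ (DirectSum.addEquivProd (fun i => ZMod (p i ^ e i))).symm.toEquiv
    have : Finite M := Finite.of_equiv _ φ.symm.toEquiv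
    exact not_finite M
  · refine ⟨((Finsupp.applyAddHom (⟨0, hn⟩ : Fin n)).comp (AddMonoidHom.fst _ _)).comp φ.toAddMonoidHom, ?_⟩
    intro z
    refine ⟨φ.symm (Finsupp.single ⟨0, hn⟩ z, 0), ?_⟩
    simp

namespace Geo
variable {Γ V : Type*} [Group Γ] [MulAction Γ V] (g : Geo Γ V)

/-- `h` is additive on `H`, kills the stabiliser, and takes the value one -/
structure ZHom (H : Subgroup Γ) (h : Γ → ℤ) (t : Γ) : Prop where
  mul : ∀ x ∈ H, ∀ y ∈ H, h (x * y) = h x + h y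
  mem : t ∈ H
  one : h t = 1
  kill : ∀ u ∈ H, u • g.o = g.o → h u = 0

lemma ball_image {P : Type*} [Group P] {H : Subgroup Γ} (ψ : H →* P)
    (hst : (ψ '' {u | (u : Γ) • g.o = g.o}).Finite) (R : ℕ) :
    (ψ '' {s | g.len (s : Γ) ≤ R}).Finite ∧
    (ψ '' {s | g.len (s : Γ) ≤ R}).ncard ≤ g.gr H R * (ψ '' {u | (u : Γ) • g.o = g.o}).ncard := by
  have hF : ((fun s : H => (s : Γ) • g.o) '' {s | g.len (s : Γ) ≤ R}) = g.orb H ∩ {x | g.δ g.o x ≤ R} := by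
    ext x; constructor
    · rintro ⟨s, hs, rfl⟩; exact ⟨⟨s, s.2, rfl⟩, hs⟩
    · rintro ⟨⟨γ, hγ, rfl⟩, hx⟩; exact ⟨⟨γ, hγ⟩, hx, rfl⟩
  obtain ⟨u, hu1, hu2⟩ := Set.exists_subset_bijOn {s : H | g.len (s : Γ) ≤ R} (fun s : H => (s : Γ) • g.o)
  have hufin : u.Finite := by
    refine Set.Finite.of_finite_image (f := fun s : H => (s : Γ) • g.o) ?_ hu2.injOn
    rw [hu2.image_eq, hF]; exact g.ball_fin H R
  have hsub : (ψ '' {s | g.len (s : Γ) ≤ R}) ⊆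
      (fun q : P × P => q.1 * q.2) '' ((ψ '' u) ×ˢ (ψ '' {u | (u : Γ) • g.o = g.o})) := by
    rintro _ ⟨s, hs, rfl⟩
    obtain ⟨s', hs', h⟩ := hu2.surjOn ⟨s, hs, rfl⟩
    refine ⟨(ψ s', ψ (s'⁻¹ * s)), ⟨⟨s', hs', rfl⟩, ⟨_, ?_, rfl⟩⟩, ?_⟩
    · show ((s'⁻¹ * s : H) : Γ) • g.o = g.o
      have h : (s' : Γ) • g.o = (s : Γ) • g.o := h
      rw [Subgroup.coe_mul, Subgroup.coe_inv, mul_smul, ← h, inv_smul_smul]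
    · show ψ s' * ψ (s'⁻¹ * s) = ψ s
      rw [← map_mul, mul_inv_cancel_left]
  have hpf := (hufin.image ψ).prod hst
  refine ⟨(hpf.image _).subset hsub, (ncard_le_ncard hsub (hpf.image _)).trans ?_⟩
  refine (ncard_image_le hpf).trans ?_
  rw [ncard_prod]
  refine Nat.mul_le_mul_right _ ((ncard_image_le hufin).trans ?_)
  rw [gr, ← hF, ← hu2.image_eq, ncard_image_of_injOn hu2.injOn]

lemma fg_range {P : Type*} [Group P] {H : Subgroup Γ} (hb : g.BG H) (ψ : H →* P)
    (hst : (ψ '' {u | (u : Γ) • g.o = g.o}).Finite) : Group.FG ψ.range := by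
  obtain ⟨R, hR⟩ := hb
  have hs' : Function.Surjective ψ.rangeRestrict := ψ.rangeRestrict_surjective
  refine Group.fg_iff.2 ⟨ψ.rangeRestrict '' {s | g.len (s : Γ) ≤ R}, ?_, ?_⟩
  · rw [← MonoidHom.map_closure]
    have : Subgroup.closure {s : H | g.len (s : Γ) ≤ R} = ⊤ := by
      rw [eq_top_iff]
      rintro ⟨γ, hγ⟩ -
      have h1 := hR γ hγ
      have e : {s | s ∈ H ∧ g.len s ≤ R} = H.subtype '' {s : H | g.len (s : Γ) ≤ R} := by
        ext s; constructor
        · rintro ⟨h, h'⟩; exact ⟨⟨s, h⟩, h', rfl⟩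
        · rintro ⟨s, h, rfl⟩; exact ⟨s.2, h⟩
      rw [e, ← MonoidHom.map_closure] at h1
      obtain ⟨s, hs, h2⟩ := h1
      have : s = ⟨γ, hγ⟩ := Subtype.ext h2
      rwa [← this]
    rw [this]
    exact Subgroup.map_top_of_surjective _ hs'
  · refine Set.Finite.of_finite_image (f := Subtype.val) ?_ Subtype.val_injective.injOn
    rw [image_image]; exact (g.ball_image ψ hst R).1

lemma exists_hom {P : Type*} [Group P] {H : Subgroup Γ} (hb : g.BG H) (ψ : H →* P)
    (hcomm : ∀ x y, ψ x * ψ y = ψ y * ψ x) (hinf : (range ψ).Infinite)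
    (hst : (ψ '' {u | (u : Γ) • g.o = g.o}).Finite) : ∃ h t, g.ZHom H h t := by
  let Q : Subgroup P := ψ.range
  let iM : CommGroup Q := { (inferInstance : Group Q) with
    mul_comm := by
      rintro ⟨_, x, rfl⟩ ⟨_, y, rfl⟩
      exact Subtype.ext (hcomm x y) }
  let ψ' : H →* Q := ψ.rangeRestrict
  have hψ' : ∀ x, ((ψ' x : Q) : P) = ψ x := fun x => rfl
  have hs' : Function.Surjective ψ' := ψ.rangeRestrict_surjective
  have : Infinite Q := hinf.to_subtype
  obtain ⟨R, hR⟩ := hb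
  have hfg : Group.FG Q := g.fg_range ⟨R, hR⟩ ψ hst
  obtain ⟨f, hf⟩ := exists_surj_int (Additive Q)
  obtain ⟨q, hq⟩ := hf 1
  obtain ⟨t, ht⟩ := hs' q.toMul
  classical
  refine ⟨fun γ => if hγ : γ ∈ H then f (Additive.ofMul (ψ' ⟨γ, hγ⟩)) else 0, t, ?_, t.2, ?_, ?_⟩
  · intro x hx y hy
    simp only [dif_pos hx, dif_pos hy, dif_pos (mul_mem hx hy)]
    rw [← map_add, ← ofMul_mul, ← map_mul]; rfl
  · simp only [dif_pos t.2]
    rw [Subtype.coe_eta, ht]; exact hq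
  · intro u hu huo
    simp only [dif_pos hu]
    have hmt : MapsTo (fun n : ℕ => ψ (⟨u, hu⟩ ^ n)) univ (ψ '' {u | (u : Γ) • g.o = g.o}) := by
      intro n _
      refine ⟨_, ?_, rfl⟩
      show ((⟨u, hu⟩ ^ n : H) : Γ) • g.o = g.o
      rw [Subgroup.coe_pow]
      have h1 : u ∈ MulAction.stabilizer Γ g.o := huo
      exact pow_mem h1 n
    obtain ⟨n, -, m, -, hnm, he⟩ := Set.infinite_univ.exists_ne_map_eq_of_mapsTo hmt hst
    have he : ψ' (⟨u, hu⟩ ^ n) = ψ' (⟨u, hu⟩ ^ m) := Subtype.ext he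
    rw [map_pow, map_pow] at he
    have h2 := congrArg (fun q => f (Additive.ofMul q)) he
    simp only [ofMul_pow, map_nsmul, nsmul_eq_mul] at h2
    by_contra h3
    exact hnm (by exact_mod_cast mul_right_cancel₀ h3 h2)

end Geo
end RotorWalk

namespace RotorWalk
set_option linter.unusedSectionVars false
namespace Jor
variable {P A : Type*} [Group P] [NormedRing A] [NormedAlgebra ℝ A] (ρ : P →* A)

noncomputable def nm (g : P) : ℝ := ‖ρ g - 1‖

lemma nm_nonneg (g : P) : 0 ≤ nm ρ g := norm_nonneg _

variable (h1 : ∀ g, ‖ρ g‖ ≤ 1)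
include h1

lemma nm_mul (g h : P) : nm ρ (g * h) ≤ nm ρ g + nm ρ h := by
  have e : ρ (g * h) - 1 = (ρ g - 1) * ρ h + (ρ h - 1) := by rw [map_mul]; noncomm_ring
  rw [nm, e]
  refine (norm_add_le _ _).trans ?_
  have := (norm_mul_le (ρ g - 1) (ρ h)).trans (mul_le_of_le_one_right (norm_nonneg _) (h1 h))
  simp only [nm]; linarith

lemma nm_inv_le (g : P) : nm ρ g⁻¹ ≤ nm ρ g := by
  have e : ρ g⁻¹ - 1 = ρ g⁻¹ * (1 - ρ g) := by rw [mul_sub, ← map_mul]; simp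
  rw [nm, e]
  refine (norm_mul_le _ _).trans ?_
  rw [norm_sub_rev]
  exact mul_le_of_le_one_left (norm_nonneg _) (h1 _)

lemma nm_le_two (g : P) : nm ρ g ≤ 2 := by
  have := norm_sub_le (ρ g) (ρ 1)
  have a := h1 g
  have b := h1 1
  rw [map_one] at *
  simp only [nm]; linarith

lemma nm_comm (g h : P) : nm ρ (g * h * g⁻¹ * h⁻¹) ≤ 2 * nm ρ g * nm ρ h := by
  have e : ρ (g * h * g⁻¹ * h⁻¹) - 1 =
      ((ρ g - 1) * (ρ h - 1) - (ρ h - 1) * (ρ g - 1)) * ρ (g⁻¹ * h⁻¹) := by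
    have : (ρ g - 1) * (ρ h - 1) - (ρ h - 1) * (ρ g - 1) = ρ (g * h) - ρ (h * g) := by
      rw [map_mul, map_mul]; noncomm_ring
    rw [this, sub_mul, ← map_mul, ← map_mul]
    have e2 : h * g * (g⁻¹ * h⁻¹) = 1 := by group
    rw [e2, map_one, mul_assoc (g * h)]
  rw [nm, e]
  refine (norm_mul_le _ _).trans ((mul_le_of_le_one_right (norm_nonneg _) (h1 _)).trans ?_)
  refine (norm_sub_le _ _).trans ?_
  have a := norm_mul_le (ρ g - 1) (ρ h - 1)
  have b := norm_mul_le (ρ h - 1) (ρ g - 1)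
  simp only [nm]; nlinarith

lemma nm_pow_le (g : P) (n : ℕ) : nm ρ (g ^ n) ≤ n * nm ρ g := by
  induction n with
  | zero => simp [nm]
  | succ n ih => rw [pow_succ]; have := nm_mul ρ h1 (g^n) g; push_cast; linarith

lemma nm_pow_lin (g : P) (n : ℕ) : ‖ρ (g ^ n) - 1 - (n:ℝ) • (ρ g - 1)‖ ≤ (n:ℝ)^2 * nm ρ g ^ 2 := by
  induction n with
  | zero => simp
  | succ n ih =>
    have e : ρ (g ^ (n+1)) - 1 - ((n+1 : ℕ):ℝ) • (ρ g - 1) =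
        (ρ (g^n) - 1 - (n:ℝ) • (ρ g - 1)) + (ρ (g^n) - 1) * (ρ g - 1) := by
      rw [pow_succ, map_mul]; push_cast; rw [add_smul, one_smul]; noncomm_ring
    rw [e]
    refine (norm_add_le _ _).trans ?_
    have h2 := norm_mul_le (ρ (g^n) - 1) (ρ g - 1)
    have h3 := nm_pow_le ρ h1 g n
    simp only [nm] at *
    have h4 : ‖ρ (g^n) - 1‖ * ‖ρ g - 1‖ ≤ (n * ‖ρ g - 1‖) * ‖ρ g - 1‖ := by gcongr
    push_cast
    have : (0:ℝ) ≤ n := n.cast_nonneg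
    nlinarith [norm_nonneg (ρ g - 1), sq_nonneg ‖ρ g - 1‖, mul_nonneg this (sq_nonneg ‖ρ g - 1‖)]

lemma nm_pow_ge (g : P) (n : ℕ) : n * nm ρ g - (n:ℝ)^2 * nm ρ g ^ 2 ≤ nm ρ (g ^ n) := by
  have h := nm_pow_lin ρ h1 g n
  have h2 := norm_sub_norm_le ((n:ℝ) • (ρ g - 1)) (ρ (g^n) - 1)
  rw [norm_sub_rev ((n:ℝ) • (ρ g - 1)), norm_smul, Real.norm_natCast] at h2
  simp only [nm] at *; linarith

lemma no_small (hinj : Function.Injective ρ) (z : P) (hz : ∀ j : ℕ, nm ρ (z ^ j) ≤ 1/8) : z = 1 := by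
  have key : ∀ k : ℕ, (3/2:ℝ)^k * nm ρ z ≤ nm ρ (z ^ (2^k)) := by
    intro k
    induction k with
    | zero => simp
    | succ k ih =>
      have a := nm_pow_ge ρ h1 (z^(2^k)) 2
      rw [← pow_mul, ← pow_succ] at a
      have b := hz (2^k)
      have c := nm_nonneg ρ (z^(2^k))
      push_cast at a
      rw [pow_succ]
      nlinarith
  have h0 : nm ρ z = 0 := by
    by_contra h
    have hp : 0 < nm ρ z := lt_of_le_of_ne (nm_nonneg _ _) (Ne.symm h)
    obtain ⟨k, hk⟩ := pow_unbounded_of_one_lt (1 / nm ρ z) (by norm_num : (1:ℝ) < 3/2)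
    rw [div_lt_iff₀ hp] at hk
    have := key k
    have := hz (2^k)
    linarith
  apply hinj
  rw [map_one]
  exact sub_eq_zero.1 (norm_eq_zero.1 h0)

/-- words -/
def wd (g : ℕ → P) (a : ℕ → ℕ) : ℕ → ℕ → P
  | _, 0 => 1
  | i, k+1 => g i ^ a i * wd g a (i+1) k

omit h1 in
lemma wd_succ (g : ℕ → P) (a : ℕ → ℕ) (i k : ℕ) : wd g a i (k+1) = g i ^ a i * wd g a (i+1) k := rfl

lemma wd_nm (g : ℕ → P) (a : ℕ → ℕ) (N : ℕ) (ha : ∀ i, a i < N) (ε : ℝ) (hε : ε ≤ 1/4)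
    (hg : ∀ i, nm ρ (g (i+1)) ≤ 2 * ε * nm ρ (g i)) (k i : ℕ) : nm ρ (wd g a i k) ≤ 2 * N * nm ρ (g i) := by
  induction k generalizing i with
  | zero =>
    have := nm_nonneg ρ (g i)
    have : nm ρ (wd g a i 0) = 0 := by simp [wd, nm]
    rw [this]; positivity
  | succ k ih =>
    rw [wd_succ]
    have b := nm_mul ρ h1 (g i ^ a i) (wd g a (i+1) k)
    have c := nm_pow_le ρ h1 (g i) (a i)
    have d := ih (i+1)
    have e := hg i
    have f := nm_nonneg ρ (g i)
    have h : (a i : ℝ) ≤ N := by exact_mod_cast (ha i).le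
    have hN : (0:ℝ) ≤ N := N.cast_nonneg
    have e2 : nm ρ (g (i+1)) ≤ (1/2) * nm ρ (g i) := by nlinarith
    have : (a i : ℝ) * nm ρ (g i) ≤ N * nm ρ (g i) := by gcongr
    have : 2 * (N:ℝ) * nm ρ (g (i+1)) ≤ 2 * N * ((1/2) * nm ρ (g i)) := by gcongr
    linarith

lemma wd_lt (g : ℕ → P) (N : ℕ) (ε : ℝ) (hε : ε * (100 * N) ≤ 1) (hε0 : 0 < ε) (hN : 1 ≤ N)
    (hg : ∀ i, nm ρ (g (i+1)) ≤ 2 * ε * nm ρ (g i)) (hge : ∀ i, nm ρ (g i) ≤ ε) (hpos : ∀ i, 0 < nm ρ (g i))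
    (a a' : ℕ → ℕ) (ha : ∀ i, a i < N) (ha' : ∀ i, a' i < N) (k i : ℕ)
    (hlt : a' i < a i) : wd g a i (k+1) ≠ wd g a' i (k+1) := by
  intro he
  have hNr : (1:ℝ) ≤ N := by exact_mod_cast hN
  have hε4 : ε ≤ 1/100 := by nlinarith
  obtain ⟨b, hb⟩ := Nat.exists_eq_add_of_lt hlt
  rw [wd_succ, wd_succ, hb, add_assoc, pow_add, mul_assoc] at he
  have he := mul_left_cancel he
  have he2 : g i ^ (b+1) = wd g a' (i+1) k * (wd g a (i+1) k)⁻¹ := eq_mul_inv_of_mul_eq he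
  have u1 := nm_pow_ge ρ h1 (g i) (b+1)
  have u2 := nm_mul ρ h1 (wd g a' (i+1) k) (wd g a (i+1) k)⁻¹
  have u3 := nm_inv_le ρ h1 (wd g a (i+1) k)
  have u4 := wd_nm ρ h1 g a N ha ε (by linarith) hg k (i+1)
  have u5 := wd_nm ρ h1 g a' N ha' ε (by linarith) hg k (i+1)
  rw [← he2] at u2
  set x := nm ρ (g i) with hx
  have hx0 : 0 < x := hpos i
  have hxe : x ≤ ε := hge i
  have hbN : ((b+1 : ℕ):ℝ) ≤ N := by have := ha i; exact_mod_cast (by omega)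
  have hb1 : (1:ℝ) ≤ ((b+1 : ℕ):ℝ) := by exact_mod_cast (by omega)
  set β := ((b+1 : ℕ):ℝ)
  have v1 : β * x ≤ 1/100 := by
    calc β * x ≤ N * ε := by gcongr
      _ ≤ 1/100 := by linarith
  have v2 : 99/100 * x ≤ nm ρ (g i ^ (b+1)) := by
    have w1 : x ≤ β * x := by nlinarith
    have w2 : (β * x) * (β * x) ≤ 1/100 * (β * x) := by gcongr
    nlinarith
  have v3 : 4 * (N:ℝ) * nm ρ (g (i+1)) ≤ 4 * N * (2 * ε * x) := by gcongr; exact hg i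
  have v4 : 4 * (N:ℝ) * (2 * ε * x) ≤ 8/100 * x := by nlinarith
  linarith

lemma wd_inj (g : ℕ → P) (N : ℕ) (ε : ℝ) (hε : ε * (100 * N) ≤ 1) (hε0 : 0 < ε) (hN : 1 ≤ N)
    (hg : ∀ i, nm ρ (g (i+1)) ≤ 2 * ε * nm ρ (g i)) (hge : ∀ i, nm ρ (g i) ≤ ε) (hpos : ∀ i, 0 < nm ρ (g i))
    (a a' : ℕ → ℕ) (ha : ∀ i, a i < N) (ha' : ∀ i, a' i < N) (k i : ℕ)
    (he : wd g a i k = wd g a' i k) : ∀ j < k, a (i+j) = a' (i+j) := by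
  induction k generalizing i with
  | zero => intro j hj; omega
  | succ k ih =>
    have h0 : a i = a' i := by
      rcases lt_trichotomy (a i) (a' i) with h | h | h
      · exact absurd he.symm (wd_lt ρ h1 g N ε hε hε0 hN hg hge hpos a' a ha' ha k i h)
      · exact h
      · exact absurd he (wd_lt ρ h1 g N ε hε hε0 hN hg hge hpos a a' ha ha' k i h)
    rw [wd_succ, wd_succ, h0] at he
    have := ih (i+1) (mul_left_cancel he)
    intro j hj
    rcases j with _ | j
    · exact h0
    · have := this j (by omega)
      rwa [add_assoc, add_comm 1] at this

end Jor
end RotorWalk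

namespace RotorWalk
set_option linter.unusedSectionVars false
namespace Jor

lemma exists_finite_closure {P : Type*} [Group P] {U : Set P} {x : P} (hx : x ∈ Subgroup.closure U) :
    ∃ t : Set P, t.Finite ∧ t ⊆ U ∧ x ∈ Subgroup.closure t := by
  induction hx using Subgroup.closure_induction with
  | mem x hx => exact ⟨{x}, finite_singleton x, by simpa using hx, Subgroup.subset_closure rfl⟩
  | one => exact ⟨∅, finite_empty, empty_subset _, one_mem _⟩
  | mul x y _ _ ihx ihy =>
    obtain ⟨t, h1, h2, h3⟩ := ihx
    obtain ⟨t', h1', h2', h3'⟩ := ihy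
    exact ⟨t ∪ t', h1.union h1', union_subset h2 h2', mul_mem
      (Subgroup.closure_mono subset_union_left h3) (Subgroup.closure_mono subset_union_right h3')⟩
  | inv x _ ih =>
    obtain ⟨t, h1, h2, h3⟩ := ih
    exact ⟨t, h1, h2, inv_mem h3⟩

variable {P A : Type*} [Group P] [NormedRing A] [NormedAlgebra ℝ A] (ρ : P →* A)

lemma growth_contra (B : ℕ → Set P) (hBf : ∀ n, (B n).Finite) (hB1 : 1 ∈ B 0)
    (hBm : ∀ m n x y, x ∈ B m → y ∈ B n → x * y ∈ B (m + n))
    (hBmono : Monotone B) (D : ℕ) (hD : ∀ N0, ∃ N ≥ N0, (B N).ncard ≤ N ^ D)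
    (g : ℕ → P) (c : ℕ) (hc : 1 ≤ c) (hg : ∀ i, g i ∈ B (c * 2 ^ i))
    (hinj : ∀ a a' : ℕ → ℕ, (∀ i, a i < 2^(D+1)) → (∀ i, a' i < 2^(D+1)) → ∀ k,
      wd g a 0 k = wd g a' 0 k → ∀ j < k, a j = a' j) : False := by
  set N := 2^(D+1) with hN
  have hpow : ∀ i n, g i ^ n ∈ B (n * (c * 2^i)) := by
    intro i n
    induction n with
    | zero => simpa using hB1
    | succ n ih => rw [pow_succ, add_mul, one_mul]; exact hBm _ _ _ _ ih (hg i)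
  have hw : ∀ a : ℕ → ℕ, (∀ i, a i < N) → ∀ k i, ∀ q, 2^k = q + 1 → wd g a i k ∈ B (N * c * 2^i * q) := by
    intro a ha k
    induction k with
    | zero => intro i q _; exact hBmono (Nat.zero_le _) hB1
    | succ k ih =>
      intro i q hq
      obtain ⟨q', hq'⟩ : ∃ q', 2^k = q' + 1 := ⟨2^k - 1, by have := Nat.one_le_two_pow (n := k); omega⟩
      rw [wd_succ]
      refine hBmono ?_ (hBm _ _ _ _ (hpow i (a i)) (ih (i+1) q' hq'))
      have : q = 2 * q' + 1 := by rw [pow_succ] at hq; omega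
      subst this
      have := (ha i).le
      calc a i * (c * 2^i) + N * c * 2^(i+1) * q' ≤ N * (c * 2^i) + N * c * 2^(i+1) * q' := by gcongr
        _ = _ := by ring
  have hcount : ∀ m, N ^ m ≤ (B (N * c * 2^m)).ncard := by
    intro m
    have hmem : ∀ a : Fin m → Fin N, wd g (fun i => if h : i < m then (a ⟨i, h⟩ : ℕ) else 0) 0 m ∈ B (N * c * 2^m) := by
      intro a
      obtain ⟨q', hq'⟩ : ∃ q', 2^m = q' + 1 := ⟨2^m - 1, by have := Nat.one_le_two_pow (n := m); omega⟩
      refine hBmono ?_ (hw _ ?_ m 0 q' hq')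
      · rw [pow_zero, mul_one, hq']; gcongr; omega
      · intro i
        split_ifs
        · exact Fin.is_lt _
        · positivity
    have : Finite (B (N * c * 2^m)) := hBf _
    have h := Nat.card_le_card_of_injective (fun a : Fin m → Fin N => (⟨_, hmem a⟩ : B (N * c * 2^m))) (by
      intro a a' h
      have h := congrArg Subtype.val h
      dsimp only at h
      have := hinj _ _ ?_ ?_ m h
      · ext i
        have := this i i.2
        simpa using this
      · intro i
        split_ifs
        · exact Fin.is_lt _
        · positivity
      · intro i
        split_ifs
        · exact Fin.is_lt _
        · positivity)
    rw [Nat.card_coe_set_eq] at h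
    simpa using h
  set K := N * c with hK
  have hKpos : 0 < K := by positivity
  obtain ⟨n, hn, hnD⟩ := hD (K * 2 ^ ((2*K)^D))
  set m := Nat.log 2 (n / K) with hm
  have hnK : 2^((2*K)^D) ≤ n / K := by rw [Nat.le_div_iff_mul_le hKpos, mul_comm]; exact hn
  have hm1 : (2*K)^D ≤ m := by rw [hm]; exact Nat.le_log_of_pow_le (by norm_num) hnK
  have hne : n / K ≠ 0 := by have := Nat.one_le_two_pow (n := (2*K)^D); omega
  have hm2 : 2^m ≤ n / K := Nat.pow_log_le_self 2 hne
  have hm3 : n / K < 2^(m+1) := Nat.lt_pow_succ_log_self (by norm_num) _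
  have h5 : K * 2^m ≤ n := by rw [Nat.le_div_iff_mul_le hKpos, mul_comm] at hm2; exact hm2
  have h6 : n ≤ 2 * K * 2^m := by
    rw [Nat.div_lt_iff_lt_mul hKpos] at hm3; rw [pow_succ] at hm3; nlinarith
  have h7 := hcount m
  have h8 : (B (K * 2^m)).ncard ≤ (B n).ncard := ncard_le_ncard (hBmono h5) (hBf _)
  have h9 : N ^ m ≤ (2 * K * 2^m)^D := (h7.trans (h8.trans hnD)).trans (Nat.pow_le_pow_left h6 D)
  rw [mul_pow, hN, ← pow_mul, ← pow_mul] at h9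
  have h10 : 2^((D+1)*m) = 2^m * 2^(m*D) := by rw [← pow_add]; congr 1; ring
  rw [h10] at h9
  have h11 : 2^m ≤ (2*K)^D := Nat.le_of_mul_le_mul_right h9 (by positivity)
  have := Nat.lt_two_pow_self (n := m)
  omega

theorem jordan (h1 : ∀ g, ‖ρ g‖ ≤ 1) (hinj : Function.Injective ρ)
    (ht : ∀ ε > 0, ∃ F : Set P, F.Finite ∧ ∀ p, ∃ f ∈ F, ‖ρ p - ρ f‖ < ε) (hfg : Group.FG P)
    (B : ℕ → Set P) (hBf : ∀ n, (B n).Finite) (hB1 : 1 ∈ B 0)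
    (hBm : ∀ m n x y, x ∈ B m → y ∈ B n → x * y ∈ B (m + n)) (hBi : ∀ n x, x ∈ B n → x⁻¹ ∈ B n)
    (hBmono : Monotone B) (hBe : ∀ x, ∃ n, x ∈ B n)
    (D : ℕ) (hD : ∀ N0, ∃ N ≥ N0, (B N).ncard ≤ N ^ D) :
    ∃ Q : Subgroup P, Q.index ≠ 0 ∧ ∀ x ∈ Q, ∀ y ∈ Q, x * y = y * x := by
  set N := 2^(D+1) with hN
  have hN1 : 1 ≤ N := Nat.one_le_two_pow
  have hNr : (1:ℝ) ≤ N := by exact_mod_cast hN1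
  obtain ⟨ε, hεd⟩ : ∃ ε : ℝ, ε = 1 / (100 * N) := ⟨_, rfl⟩
  have hε : ε * (100 * N) ≤ 1 := by rw [hεd]; field_simp; exact le_rfl
  have hε0 : 0 < ε := by rw [hεd]; positivity
  have hε4 : ε ≤ 1/100 := by nlinarith
  set U : Set P := {p | nm ρ p < ε} with hU
  set Q := Subgroup.closure U with hQ
  have hidx : Q.index ≠ 0 := by
    obtain ⟨F, hF, hF2⟩ := ht ε hε0
    have : Finite (P ⧸ Q) := by
      have := hF.to_subtype
      refine Finite.of_surjective (fun f : F => (QuotientGroup.mk (f : P) : P ⧸ Q)) ?_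
      intro q
      induction q using QuotientGroup.induction_on with
      | H p =>
        obtain ⟨f, hf, hlt⟩ := hF2 p
        refine ⟨⟨f, hf⟩, ?_⟩
        rw [QuotientGroup.eq]
        apply Subgroup.subset_closure
        show ‖ρ (f⁻¹ * p) - 1‖ < ε
        have e : ρ (f⁻¹ * p) - 1 = ρ f⁻¹ * (ρ p - ρ f) := by
          rw [mul_sub, ← map_mul, ← map_mul, inv_mul_cancel, map_one]
        rw [e]
        exact (norm_mul_le _ _).trans_lt ((mul_le_of_le_one_left (norm_nonneg _) (h1 _)).trans_lt hlt)
    exact Subgroup.index_ne_zero_of_finite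
  refine ⟨Q, hidx, ?_⟩
  have hQfg : Q.FG := by
    have : Q.FiniteIndex := ⟨hidx⟩
    exact (Group.fg_iff_subgroup_fg Q).1 (Subgroup.fg_of_index_ne_zero Q)
  obtain ⟨S, hS⟩ := hQfg
  have hSU : ∀ s : S, ∃ t : Set P, t.Finite ∧ t ⊆ U ∧ (s : P) ∈ Subgroup.closure t := by
    intro s
    apply exists_finite_closure
    rw [← hQ, ← hS]; exact Subgroup.subset_closure s.2
  choose t ht1 ht2 ht3 using hSU
  set S' := ⋃ s, t s with hS'
  have hS'f : S'.Finite := finite_iUnion ht1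
  have hS'U : S' ⊆ U := iUnion_subset ht2
  have hS'Q : Subgroup.closure S' = Q := by
    apply le_antisymm (Subgroup.closure_mono hS'U)
    rw [← hQ, ← hS, Subgroup.closure_le]
    intro s hs
    exact Subgroup.closure_mono (subset_iUnion t ⟨s, hs⟩) (ht3 ⟨s, hs⟩)
  have hcent : ∀ z, (∀ s ∈ S', z * s = s * z) → ∀ x ∈ Q, z * x = x * z := by
    intro z hz x hx
    have : Q ≤ Subgroup.centralizer {z} := by
      rw [← hS'Q, Subgroup.closure_le]
      intro s hs
      rw [SetLike.mem_coe, Subgroup.mem_centralizer_singleton_iff]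
      exact (hz s hs).symm
    exact (Subgroup.mem_centralizer_singleton_iff.1 (this hx)).symm
  by_contra hna
  have hex : ∃ g0 ∈ S', ∃ s ∈ S', g0 * s ≠ s * g0 := by
    by_contra hcon
    push Not at hcon
    apply hna
    intro x hx y hy
    refine hcent x (fun s hs => ?_) y hy
    exact (hcent s (fun s' hs' => hcon s hs s' hs') x hx).symm
  obtain ⟨g0, hg0, s0, hs0, hne0⟩ := hex
  let good : P → Prop := fun p => p ∈ Q ∧ nm ρ p ≤ ε ∧ ∃ s ∈ S', p * s ≠ s * p
  have hstep : ∀ p, good p → ∃ p', good p' ∧ nm ρ p' ≤ 2 * ε * nm ρ p ∧ ∃ s ∈ S', p' = p * s * p⁻¹ * s⁻¹ := by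
    rintro p ⟨hp, hpε, s, hs, hne⟩
    have hsε : nm ρ s < ε := hS'U hs
    have hsQ : s ∈ Q := Subgroup.subset_closure (hS'U hs)
    have hcm := nm_comm ρ h1 p s
    have hnp := nm_nonneg ρ p
    have hle : nm ρ (p * s * p⁻¹ * s⁻¹) ≤ 2 * ε * nm ρ p := by nlinarith
    refine ⟨p * s * p⁻¹ * s⁻¹, ⟨mul_mem (mul_mem (mul_mem hp hsQ) (inv_mem hp)) (inv_mem hsQ), ?_, ?_⟩, hle, s, hs, rfl⟩
    · nlinarith
    · by_contra hcon
      push Not at hcon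
      set z := p * s * p⁻¹ * s⁻¹ with hz
      have hzc := hcent z hcon
      have e1 : p * s * p⁻¹ = z * s := by rw [hz]; group
      have e2 : ∀ j : ℕ, z ^ j = p * s^j * p⁻¹ * (s^j)⁻¹ := by
        intro j
        have : p * s^j * p⁻¹ = z^j * s^j := by
          rw [← conj_pow, e1]
          exact (show Commute z s from hzc s hsQ).mul_pow j
        rw [this, mul_inv_cancel_right]
      have hz1 : z = 1 := by
        refine no_small ρ h1 hinj z (fun j => ?_)
        rw [e2]
        have a := nm_comm ρ h1 p (s^j)
        have b := nm_le_two ρ h1 (s^j)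
        nlinarith [nm_nonneg ρ (s^j)]
      apply hne
      rw [hz1, one_mul] at e1
      exact mul_inv_eq_iff_eq_mul.1 e1
  choose! f hf1 hf2 hf3 using hstep
  let g : ℕ → P := fun i => f^[i] g0
  have hgs : ∀ i, g (i+1) = f (g i) := fun i => Function.iterate_succ_apply' f i g0
  have hgood : ∀ i, good (g i) := by
    intro i
    induction i with
    | zero => exact ⟨Subgroup.subset_closure (hS'U hg0), (show nm ρ g0 < ε from hS'U hg0).le, s0, hs0, hne0⟩
    | succ i ih => rw [hgs]; exact hf1 _ ih
  have hgd : ∀ i, nm ρ (g (i+1)) ≤ 2 * ε * nm ρ (g i) := fun i => by rw [hgs]; exact hf2 _ (hgood i)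
  have hpos : ∀ i, 0 < nm ρ (g i) := by
    intro i
    refine lt_of_le_of_ne (nm_nonneg _ _) (fun h => ?_)
    obtain ⟨-, -, s, -, hne⟩ := hgood i
    have : ρ (g i) = 1 := sub_eq_zero.1 (norm_eq_zero.1 h.symm)
    rw [← map_one ρ] at this
    rw [hinj this] at hne
    simp at hne
  obtain ⟨c, hc⟩ : ∃ c, S' ⊆ B c := by
    choose n hn using hBe
    obtain ⟨c, hc⟩ := (hS'f.image n).bddAbove
    exact ⟨c, fun s hs => hBmono (hc ⟨s, hs, rfl⟩) (hn s)⟩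
  have hlen : ∀ i, ∃ L, g i ∈ B L ∧ L + 2 * c = 3 * c * 2^i := by
    intro i
    induction i with
    | zero => exact ⟨c, hc hg0, by ring⟩
    | succ i ih =>
      obtain ⟨L, hL, hL2⟩ := ih
      obtain ⟨s, hs, e⟩ := hf3 _ (hgood i)
      refine ⟨L + c + L + c, ?_, ?_⟩
      · rw [hgs, e]
        exact hBm _ _ _ _ (hBm _ _ _ _ (hBm _ _ _ _ hL (hc hs)) (hBi _ _ hL)) (hBi _ _ (hc hs))
      · rw [pow_succ]; nlinarith
  refine growth_contra B hBf hB1 hBm hBmono D hD g (3 * c + 1) (by omega) ?_ ?_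
  · intro i
    obtain ⟨L, hL, hL2⟩ := hlen i
    refine hBmono ?_ hL
    nlinarith [Nat.zero_le (2^i)]
  · intro a a' ha ha' k he
    have := wd_inj ρ h1 g N ε hε hε0 hN1 hgd (fun i => (hgood i).2.1) hpos a a' ha ha' k 0 he
    simpa using this

end Jor
end RotorWalk

namespace RotorWalk
set_option linter.unusedSectionVars false
namespace TW
variable {Γ X : Type*} [Group Γ] [MulAction Γ X] [MulAction.IsPretransitive Γ X] (T : TW Γ X)

lemma harm_iter {W : Type*} [AddCommGroup W] [Module ℝ W] (f : X → W) (hf : ∀ x, T.E 2 f x = f x) (k : ℕ) :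
    T.E (2*k) f = f := by
  induction k with
  | zero => rw [E_eq']; rfl
  | succ k ih => rw [mul_add, mul_one, E_add_time, show T.E 2 f = f from funext hf, ih]

lemma harm_const (a : X) (hch : ∀ y, ∃ k, T.Chain2 a k y) (f : X → ℝ) (hf : ∀ x, T.E 2 f x = f x)
    (hfin : (range f).Finite) (y : X) : f y = f a := by
  have : Nonempty X := ⟨a⟩
  obtain ⟨M, ⟨x, hx⟩, hM⟩ := hfin.exists_maximal (range_nonempty f)
  have hM : ∀ z, f z ≤ M := fun z => by
    rcases le_total (f z) M with h | h
    · exact h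
    · exact hM ⟨z, rfl⟩ h
  obtain ⟨γ, rfl⟩ := MulAction.exists_smul_eq Γ a x
  have key : ∀ y, f y = M := by
    intro y
    obtain ⟨k, hk⟩ := hch (γ⁻¹ • y)
    have h1 := T.chain_pos hk
    have h2 := T.p_inv (2*k) γ a (γ⁻¹ • y)
    rw [smul_inv_smul] at h2
    rw [← h2] at h1
    have h3 := T.term_le_E (2*k) (fun y => M - f y) (fun y => sub_nonneg.2 (hM y)) (γ • a) y
    rw [E_sub T (2*k) (fun _ => M) f, E_const, T.harm_iter f hf k, hx, sub_self] at h3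
    have := hM y
    nlinarith
  rw [key, key]

lemma supp_ball (δ : X → X → ℕ) (R : ℕ) (h0 : ∀ x, δ x x = 0) (htri : ∀ x y z, y ∈ T.nb z → δ x y ≤ δ x z + R)
    (x : X) (n : ℕ) (y : X) (hy : y ∈ T.sup x n) : δ x y ≤ R * n := by
  induction n generalizing y with
  | zero =>
    have : y = x := by
      simpa [sup] using hy
    rw [this, h0]; exact Nat.zero_le _
  | succ n ih =>
    rw [sup, Finsupp.mem_support_iff, pow_succ', Module.End.mul_apply, P_apply, A] at hy
    have : ∃ z ∈ T.nb y, ((T.P ^ n) (Finsupp.single x 1)) z ≠ 0 := by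
      by_contra hcon
      push Not at hcon
      exact hy (by rw [Finset.sum_eq_zero hcon, smul_zero])
    obtain ⟨z, hz, hz2⟩ := this
    have h1 := ih z (Finsupp.mem_support_iff.2 hz2)
    have h2 := htri x y z (T.symm _ _ hz)
    rw [mul_add, mul_one]; omega

end TW

namespace Geo
variable {Γ V : Type*} [Group Γ] [MulAction Γ V] (g : Geo Γ V)

lemma poly_scale {H : Subgroup Γ} {D : ℕ} (hg : ∀ N0, ∃ N ≥ N0, g.gr H N ≤ N ^ D) (c : ℕ) (hc : 1 ≤ c) :
    ∀ N0, ∃ N ≥ N0, g.gr H (c * N) ≤ N ^ (2 * D) := by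
  intro N0
  obtain ⟨n, hn, h⟩ := hg (c * (N0 + 2 * c))
  have h1 : N0 + 2 * c ≤ n / c := by rw [Nat.le_div_iff_mul_le hc, mul_comm]; exact hn
  refine ⟨n / c, by omega, ?_⟩
  refine (g.gr_mono le_rfl (Nat.mul_div_le n c)).trans (h.trans ?_)
  have h2 : n ≤ c * (n / c + 1) := by
    have := Nat.lt_mul_div_succ n hc; omega
  rw [pow_mul]
  refine Nat.pow_le_pow_left ?_ D
  set N := n / c
  nlinarith

/-- the walk on an orbit -/
noncomputable def tw (H : Subgroup Γ) (R : ℕ) : TW H (MulAction.orbit H g.o) where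
  nb x := ((g.fin x.1 R).preimage (f := Subtype.val) (Subtype.val_injective.injOn) :
    {y : MulAction.orbit H g.o | g.δ x.1 y.1 ≤ R}.Finite).toFinset
  d := (((g.fin g.o R).preimage (f := Subtype.val) (Subtype.val_injective.injOn) :
    {y : MulAction.orbit H g.o | g.δ g.o y.1 ≤ R}.Finite).toFinset).card
  d_pos := by
    rw [Finset.card_pos]
    refine ⟨⟨g.o, MulAction.mem_orbit_self _⟩, ?_⟩
    rw [Set.Finite.mem_toFinset]
    show g.δ g.o g.o ≤ R
    rw [g.self]; exact Nat.zero_le _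
  card_nb := by
    rintro ⟨_, γ, rfl⟩
    refine Finset.card_bij (fun y _ => γ⁻¹ • y) ?_ ?_ ?_
    · intro y hy
      rw [Set.Finite.mem_toFinset] at hy ⊢
      show g.δ g.o ((γ⁻¹ : H) • (y : V)) ≤ R
      have hy : g.δ (γ • g.o) y.1 ≤ R := hy
      have := g.inv (γ : Γ) g.o ((γ⁻¹ : H) • (y : V))
      rw [← this]
      have e : (γ : Γ) • ((γ⁻¹ : H) • (y : V)) = y := smul_inv_smul γ (y : V)
      rw [e]; exact hy
    · intro y _ y' _ h
      exact MulAction.injective γ⁻¹ h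
    · intro y hy
      rw [Set.Finite.mem_toFinset] at hy
      refine ⟨γ • y, ?_, inv_smul_smul γ y⟩
      rw [Set.Finite.mem_toFinset]
      show g.δ ((γ : Γ) • g.o) ((γ : Γ) • (y : V)) ≤ R
      rw [g.inv]; exact hy
  symm x y h := by
    rw [Set.Finite.mem_toFinset] at h ⊢
    show g.δ y.1 x.1 ≤ R
    rw [g.symm]; exact h
  inv γ x y h := by
    rw [Set.Finite.mem_toFinset] at h ⊢
    show g.δ ((γ : Γ) • (x : V)) ((γ : Γ) • (y : V)) ≤ R
    rw [g.inv]; exact h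

lemma mem_nb {H : Subgroup Γ} {R : ℕ} {x y : MulAction.orbit H g.o} :
    y ∈ (g.tw H R).nb x ↔ g.δ x.1 y.1 ≤ R := by
  simp only [tw]; rw [Set.Finite.mem_toFinset]; rfl

def base (H : Subgroup Γ) : MulAction.orbit H g.o := ⟨g.o, MulAction.mem_orbit_self _⟩

lemma tw_chain {H : Subgroup Γ} {R : ℕ} (hR : ∀ γ ∈ H, γ ∈ Subgroup.closure {s | s ∈ H ∧ g.len s ≤ R})
    (y : MulAction.orbit H g.o) : ∃ k, (g.tw H R).Chain2 (g.base H) k y := by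
  have hsub : Subgroup.closure {s | s ∈ H ∧ g.len s ≤ R} ≤ H := by
    rw [Subgroup.closure_le]; exact fun s hs => hs.1
  have stp : ∀ (x y : Γ), g.len y ≤ R → (∀ hx : x ∈ H, ∃ k, (g.tw H R).Chain2 (g.base H) k ((⟨x, hx⟩ : H) • g.base H)) →
      y ∈ H → (∀ hx : x * y ∈ H, ∃ k, (g.tw H R).Chain2 (g.base H) k ((⟨x * y, hx⟩ : H) • g.base H)) := by
    intro x y hy ih hyH hxy
    have hx : x ∈ H := by simpa using mul_mem hxy (inv_mem hyH)
    obtain ⟨k, hk⟩ := ih hx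
    refine ⟨k+1, hk.cons ⟨(⟨x, hx⟩ : H) • g.base H, g.mem_nb.2 ?_, g.mem_nb.2 ?_⟩⟩
    · rw [g.self]; exact Nat.zero_le _
    · show g.δ (x • g.o) ((x * y) • g.o) ≤ R
      rw [δ_smul, inv_mul_cancel_left]; exact hy
  have key : ∀ γ ∈ Subgroup.closure {s | s ∈ H ∧ g.len s ≤ R}, ∀ hγ : γ ∈ H,
      ∃ k, (g.tw H R).Chain2 (g.base H) k ((⟨γ, hγ⟩ : H) • g.base H) := by
    intro γ hγ
    induction hγ using Subgroup.closure_induction_right with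
    | one =>
      intro h
      refine ⟨0, ?_⟩
      have : (⟨1, h⟩ : H) • g.base H = g.base H := one_smul H _
      rw [this]; exact .nil
    | mul_right x hx y hy ih => exact stp x y hy.2 ih hy.1
    | mul_inv_cancel x hx y hy ih => exact stp x y⁻¹ (by rw [len_inv]; exact hy.2) ih (inv_mem hy.1)
  obtain ⟨_, γ, rfl⟩ := y
  exact key γ (hR γ γ.2) γ.2

lemma tw_sup (H : Subgroup Γ) (R N : ℕ) : ((g.tw H R).sup (g.base H) N).card ≤ g.gr H (R * N) := by
  rw [gr, ← ncard_coe_finset, ← ncard_image_of_injective _ (Subtype.val_injective)]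
  refine ncard_le_ncard ?_ (g.ball_fin _ _)
  rintro _ ⟨y, hy, rfl⟩
  refine ⟨?_, ?_⟩
  · obtain ⟨_, γ, rfl⟩ := y
    exact ⟨γ, γ.2, rfl⟩
  · refine TW.supp_ball (g.tw H R) (fun x y => g.δ x.1 y.1) R (fun x => g.self _) ?_ (g.base H) N y hy
    intro x y z h
    rw [mem_nb] at h
    have := g.tri x.1 z.1 y.1
    show g.δ x.1 y.1 ≤ g.δ x.1 z.1 + R
    omega

end Geo
end RotorWalk

namespace RotorWalk
set_option linter.unusedSectionVars false

lemma finite_of_factor {A B C : Type*} (S : Set A) (f : A → B) (k : A → C) (hf : (f '' S).Finite)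
    (h : ∀ x ∈ S, ∀ y ∈ S, f x = f y → k x = k y) : (k '' S).Finite := by
  obtain ⟨u, hu1, hu2⟩ := Set.exists_subset_bijOn S f
  have hufin : u.Finite := by
    refine Set.Finite.of_finite_image (f := f) ?_ hu2.injOn
    rw [hu2.image_eq]; exact hf
  refine (hufin.image k).subset ?_
  rintro _ ⟨x, hx, rfl⟩
  obtain ⟨y, hy, e⟩ := hu2.surjOn ⟨x, hx, rfl⟩
  exact ⟨y, hy, h _ (hu1 hy) _ hx e⟩

namespace Geo
section
variable {Γ V : Type*} [Group Γ] [MulAction Γ V] (g : Geo Γ V)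

lemma zfin {P : Type*} [Group P] {H : Subgroup Γ} (hb : g.BG H) (H2 : Subgroup H) (hi : H2.index ≠ 0)
    (ψ : H2 →* P) (hcomm : ∀ x y, ψ x * ψ y = ψ y * ψ x) (hinf : (range ψ).Infinite)
    (hst : (ψ '' {u | ((u : H) : Γ) • g.o = g.o}).Finite) :
    ∃ H' ≤ H, H'.relIndex H ≠ 0 ∧ ∃ h t, g.ZHom H' h t := by
  have hle : H2.map H.subtype ≤ H := by
    rintro _ ⟨x, -, rfl⟩; exact x.2
  have hri : (H2.map H.subtype).relIndex H ≠ 0 := by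
    have : (H2.map H.subtype).subgroupOf H = H2 :=
      Subgroup.comap_map_eq_self_of_injective H.subtype_injective H2
    rw [Subgroup.relIndex, this]; exact hi
  refine ⟨H2.map H.subtype, hle, hri, ?_⟩
  have hb' := g.BG_of_CD hle (g.CD_of_relIndex hle hri) hb
  let e : H2 ≃* H2.map H.subtype := H2.equivMapOfInjective H.subtype H.subtype_injective
  have he : ∀ x : H2.map H.subtype, (((e.symm x : H2) : H) : Γ) = x := by
    intro x
    have := Subgroup.coe_equivMapOfInjective_apply H2 H.subtype H.subtype_injective (e.symm x)
    rw [show (H2.equivMapOfInjective H.subtype H.subtype_injective) (e.symm x) = x from e.apply_symm_apply x] at this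
    exact this.symm
  refine g.exists_hom hb' (ψ.comp e.symm.toMonoidHom) (fun x y => hcomm _ _) ?_ ?_
  · refine hinf.mono ?_
    rintro _ ⟨x, rfl⟩
    exact ⟨e x, by simp⟩
  · refine hst.subset ?_
    rintro _ ⟨x, hx, rfl⟩
    refine ⟨e.symm x, ?_, rfl⟩
    show (((e.symm x : H2) : H) : Γ) • g.o = g.o
    rw [he]; exact hx

lemma stab_fin {E : Type*} [NormedAddCommGroup E] [InnerProductSpace ℝ E] [FiniteDimensional ℝ E]
    {H : Subgroup Γ} (π : H →* (E ≃ₗᵢ[ℝ] E)) (β : MulAction.orbit H g.o → E) (h0 : β (g.base H) = 0)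
    (hact : ∀ γ x, β (γ • x) = π γ (β x) + β (γ • g.base H)) (hspan : Submodule.span ℝ (range β) = ⊤) :
    (π '' {u | (u : Γ) • g.o = g.o}).Finite := by
  obtain ⟨b, hb1, hb2, hb3⟩ := exists_linearIndependent ℝ (range β)
  have hbf : b.Finite := hb3.setFinite
  have := hbf.to_subtype
  have hch : ∀ e : b, ∃ x, β x = e := fun e => hb1 e.2
  choose xx hxx using hch
  refine finite_of_factor _ (fun (u : H) (e : b) => u • xx e) _ ?_ ?_
  · have : (Set.pi univ (fun e : b => {y : MulAction.orbit H g.o | g.δ g.o y.1 ≤ g.δ g.o (xx e).1})).Finite := by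
      refine Set.Finite.pi (fun e => ?_)
      exact (g.fin g.o _).preimage (Subtype.val_injective.injOn)
    refine this.subset ?_
    rintro _ ⟨u, hu, rfl⟩ e -
    show g.δ g.o ((u : Γ) • (xx e).1) ≤ _
    have hu : (u : Γ) • g.o = g.o := hu
    have h2 := g.inv (u : Γ) g.o (xx e).1
    rw [hu] at h2
    exact h2.le
  · intro u hu v hv huv
    have hz : ∀ u : H, (u : Γ) • g.o = g.o → β (u • g.base H) = 0 := by
      intro u hu
      have : u • g.base H = g.base H := Subtype.ext hu
      rw [this, h0]
    have key : (π u).toLinearEquiv.toLinearMap = (π v).toLinearEquiv.toLinearMap := by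
      refine LinearMap.ext_on (hb2.trans hspan) ?_
      intro e he
      have h1 := hact u (xx ⟨e, he⟩)
      have h2 := hact v (xx ⟨e, he⟩)
      rw [hz u hu, add_zero, hxx] at h1
      rw [hz v hv, add_zero, hxx] at h2
      have h3 : u • xx ⟨e, he⟩ = v • xx ⟨e, he⟩ := congrFun huv ⟨e, he⟩
      rw [h3] at h1
      exact h1.symm.trans h2
    ext x
    exact LinearMap.congr_fun key x

lemma z_inf {E : Type*} [NormedAddCommGroup E] [InnerProductSpace ℝ E] [FiniteDimensional ℝ E]
    {H : Subgroup Γ} (hb : g.BG H) {D : ℕ} (hg : ∀ N0, ∃ N ≥ N0, g.gr H N ≤ N ^ D)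
    (π : H →* (E ≃ₗᵢ[ℝ] E)) (hst : (π '' {u | (u : Γ) • g.o = g.o}).Finite)
    (hinf : Infinite π.range) :
    ∃ H' ≤ H, H'.relIndex H ≠ 0 ∧ ∃ h t, g.ZHom H' h t := by
  set θ := π.rangeRestrict with hθ
  have hθs : Function.Surjective θ := π.rangeRestrict_surjective
  have hst' : (θ '' {u | (u : Γ) • g.o = g.o}).Finite := by
    refine Set.Finite.of_finite_image (f := Subtype.val) ?_ Subtype.val_injective.injOn
    rw [image_image]; exact hst
  let ρ : π.range →* (E →L[ℝ] E) :=
    { toFun := fun p => ((p : E ≃ₗᵢ[ℝ] E).toContinuousLinearEquiv : E →L[ℝ] E)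
      map_one' := rfl
      map_mul' := fun x y => rfl }
  have hn : ∀ p, ‖ρ p‖ ≤ 1 := fun p => (p : E ≃ₗᵢ[ℝ] E).toLinearIsometry.norm_toContinuousLinearMap_le
  have hinj : Function.Injective ρ := by
    intro x y hxy
    apply Subtype.ext
    ext v
    exact congrArg (fun f : E →L[ℝ] E => f v) hxy
  have ht : ∀ ε > 0, ∃ F : Set π.range, F.Finite ∧ ∀ p, ∃ f ∈ F, ‖ρ p - ρ f‖ < ε := by
    intro ε hε
    have hpr : ProperSpace (E →L[ℝ] E) := FiniteDimensional.proper ℝ _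
    have htb : TotallyBounded (range ρ) := by
      refine (isCompact_closedBall (0 : E →L[ℝ] E) 1).totallyBounded.subset ?_
      rintro _ ⟨p, rfl⟩
      rw [mem_closedBall_zero_iff]; exact hn p
    obtain ⟨t, ht1, ht2, ht3⟩ := Metric.finite_approx_of_totallyBounded htb ε hε
    refine ⟨ρ ⁻¹' t, ht2.preimage hinj.injOn, fun p => ?_⟩
    have := ht3 ⟨p, rfl⟩
    simp only [mem_iUnion] at this
    obtain ⟨y, hy, hd⟩ := this
    obtain ⟨q, rfl⟩ := ht1 hy
    exact ⟨q, hy, by rw [← dist_eq_norm]; exact hd⟩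
  obtain ⟨Q, hQ, hQc⟩ := Jor.jordan ρ hn hinj ht (g.fg_range hb π hst) (fun n => θ '' {s | g.len (s : Γ) ≤ n})
    (fun n => (g.ball_image θ hst' n).1) ⟨1, by show g.len 1 ≤ 0; rw [len_one], map_one _⟩
    (by
      rintro m n _ _ ⟨x, hx, rfl⟩ ⟨y, hy, rfl⟩
      refine ⟨x * y, ?_, map_mul _ _ _⟩
      have hx : g.len (x : Γ) ≤ m := hx
      have hy : g.len (y : Γ) ≤ n := hy
      have := g.len_mul (x : Γ) y
      show g.len ((x : Γ) * y) ≤ m + n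
      omega)
    (by
      rintro n _ ⟨x, hx, rfl⟩
      refine ⟨x⁻¹, ?_, map_inv _ _⟩
      show g.len ((x : Γ)⁻¹) ≤ n
      rw [len_inv]; exact hx)
    (by
      intro m n hmn
      refine image_mono ?_
      intro x hx
      exact le_trans hx hmn)
    (by
      intro x
      obtain ⟨y, rfl⟩ := hθs x
      exact ⟨g.len (y : Γ), y, le_refl (g.len (y : Γ)), rfl⟩) (D + 1)
    (by
      intro N0
      obtain ⟨N, hN, h⟩ := hg (N0 + (θ '' {u | (u : Γ) • g.o = g.o}).ncard)
      refine ⟨N, by omega, (g.ball_image θ hst' N).2.trans ?_⟩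
      rw [pow_succ]
      exact Nat.mul_le_mul h (by omega))
  refine g.zfin hb (Q.comap θ) (by rw [Subgroup.index_comap_of_surjective _ hθs]; exact hQ)
    (θ.comp (Q.comap θ).subtype) (fun x y => hQc _ x.2 _ y.2) ?_ ?_
  · intro hfin
    have hQf : (Q : Set π.range).Finite := by
      refine hfin.subset ?_
      intro q hq
      obtain ⟨x, rfl⟩ := hθs q
      exact ⟨⟨x, hq⟩, rfl⟩
    have : Finite Q := hQf.to_subtype
    have h1 := Q.card_mul_index
    have h2 : Nat.card Q ≠ 0 := Nat.card_pos.ne'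
    have h3 : Nat.card π.range ≠ 0 := by rw [← h1]; exact mul_ne_zero h2 hQ
    exact (Nat.finite_of_card_ne_zero h3).not_infinite hinf
  · refine hst'.subset ?_
    rintro _ ⟨x, hx, rfl⟩
    exact ⟨x, hx, rfl⟩

lemma z_fin {E : Type*} [NormedAddCommGroup E] [InnerProductSpace ℝ E] [FiniteDimensional ℝ E]
    {H : Subgroup Γ} (hb : g.BG H) (T : TW H (MulAction.orbit H g.o)) (hch : ∀ y, ∃ k, T.Chain2 (g.base H) k y)
    (π : H →* (E ≃ₗᵢ[ℝ] E)) (β : MulAction.orbit H g.o → E) (h0 : β (g.base H) = 0)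
    (hact : ∀ γ x, β (γ • x) = π γ (β x) + β (γ • g.base H)) (hh : ∀ x, T.E 2 β x = β x)
    (hne : ∃ x, β x ≠ 0) (hfin : Finite π.range) :
    ∃ H' ≤ H, H'.relIndex H ≠ 0 ∧ ∃ h t, g.ZHom H' h t := by
  have hidx : π.ker.index ≠ 0 := by
    rw [Subgroup.index_ker]; exact Nat.card_pos.ne'
  let ψ : π.ker →* Multiplicative E :=
    { toFun := fun γ => Multiplicative.ofAdd (β ((γ : H) • g.base H))
      map_one' := by
        show Multiplicative.ofAdd (β ((1 : H) • g.base H)) = 1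
        rw [one_smul, h0]; rfl
      map_mul' := by
        intro x y
        show Multiplicative.ofAdd (β (((x : H) * (y : H)) • g.base H)) = _
        rw [mul_smul, hact, (show π x = 1 from x.2), add_comm]; rfl }
  refine g.zfin hb π.ker hidx ψ (fun x y => mul_comm _ _) ?_ ?_
  · intro hr
    have hβ : (range β).Finite := by
      have : Finite (H ⧸ π.ker) := by
        have : π.ker.FiniteIndex := ⟨hidx⟩
        infer_instance
      have hF : (((range ψ) ×ˢ (univ : Set (H ⧸ π.ker))).image
        (fun q => π q.2.out (Multiplicative.toAdd q.1) + β (q.2.out • g.base H))).Finite :=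
        (hr.prod finite_univ).image _
      refine hF.subset ?_
      rintro _ ⟨⟨_, γ, rfl⟩, rfl⟩
      obtain ⟨u, hu⟩ := QuotientGroup.mk_out_eq_mul π.ker γ
      refine ⟨(ψ u⁻¹, QuotientGroup.mk γ), ⟨⟨_, rfl⟩, mem_univ _⟩, ?_⟩
      show π (QuotientGroup.mk γ : H ⧸ π.ker).out (β (((u⁻¹ : π.ker) : H) • g.base H)) + β ((QuotientGroup.mk γ : H ⧸ π.ker).out • g.base H) = _
      rw [← hact, hu, smul_smul, Subgroup.coe_inv, mul_inv_cancel_right]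
      rfl
    obtain ⟨x, hx⟩ := hne
    have h1 := T.harm_const (g.base H) hch (fun y => inner ℝ (β x) (β y)) (by
      intro y
      have := T.E_lin 2 (innerₗ E (β x)) β y
      rw [hh] at this
      exact this) ((hβ.image (fun e => inner ℝ (β x) e)).subset (by
        rintro _ ⟨y, rfl⟩; exact ⟨_, ⟨y, rfl⟩, rfl⟩)) x
    simp only [h0, inner_zero_right, inner_self_eq_zero] at h1
    exact hx h1
  · refine (Set.finite_singleton (1 : Multiplicative E)).subset ?_
    rintro _ ⟨u, hu, rfl⟩
    show Multiplicative.ofAdd (β ((u : H) • g.base H)) = 1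
    have : (u : H) • g.base H = g.base H := Subtype.ext hu
    rw [this, h0]; rfl
end

theorem thmZ {Γ V : Type*} [Group Γ] [MulAction Γ V] (g : Geo Γ V) {H : Subgroup Γ} (hb : g.BG H)
    (hinf : (g.orb H).Infinite) (D : ℕ) (hg : ∀ N0, ∃ N ≥ N0, g.gr H N ≤ N ^ D) :
    ∃ H' ≤ H, H'.relIndex H ≠ 0 ∧ ∃ h t, g.ZHom H' h t := by
  obtain ⟨R, hR⟩ := id hb
  have hR' : ∀ γ ∈ H, γ ∈ Subgroup.closure {s | s ∈ H ∧ g.len s ≤ R + 1} := by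
    intro γ hγ
    have hm : {s | s ∈ H ∧ g.len s ≤ R} ⊆ {s | s ∈ H ∧ g.len s ≤ R + 1} :=
      fun s hs => ⟨hs.1, hs.2.trans (by omega)⟩
    exact Subgroup.closure_mono hm (hR γ hγ)
  have hX : Infinite (MulAction.orbit H g.o) := by
    rw [Set.infinite_coe_iff]
    refine hinf.mono ?_
    rintro _ ⟨γ, hγ, rfl⟩
    exact ⟨⟨γ, hγ⟩, rfl⟩
  have hch := g.tw_chain hR'
  obtain ⟨E, i1, i2, i3, π, β, h0, hact, hh, hsp, hne⟩ := (g.tw H (R+1)).fd_cocycle (g.base H) hch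
    (fun x => g.mem_nb.2 (by rw [g.self]; omega)) (2 * D) (by
      intro N0
      obtain ⟨N, hN, h⟩ := g.poly_scale hg (R+1) (by omega) N0
      exact ⟨N, hN, by exact_mod_cast (g.tw_sup H (R+1) N).trans h⟩)
  have hst := g.stab_fin π β h0 hact hsp
  rcases finite_or_infinite π.range with h | h
  · exact g.z_fin hb _ hch π β h0 hact hh hne h
  · exact g.z_inf hb hg π hst h

end Geo
end RotorWalk

namespace RotorWalk
set_option linter.unusedSectionVars false

lemma pow_lt_two_pow (k : ℕ) : ∃ N0, ∀ N ≥ N0, N ^ k < 2 ^ N := by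
  have h := tendsto_pow_const_div_const_pow_of_one_lt k (show (1:ℝ) < 2 by norm_num)
  have h2 := h.eventually (gt_mem_nhds (show (0:ℝ) < 1 by norm_num))
  obtain ⟨N0, hN⟩ := eventually_atTop.1 h2
  refine ⟨N0, fun N h => ?_⟩
  have := hN N h
  rw [div_lt_one (by positivity)] at this
  exact_mod_cast this

namespace Geo
variable {Γ V : Type*} [Group Γ] [MulAction Γ V] (g : Geo Γ V)

namespace ZHom
variable {g} {H : Subgroup Γ} {h : Γ → ℤ} {t : Γ} (z : g.ZHom H h t)
include z

lemma map_one : h 1 = 0 := by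
  have := z.mul 1 H.one_mem 1 H.one_mem
  rw [mul_one] at this; omega

lemma map_inv {x : Γ} (hx : x ∈ H) : h x⁻¹ = - h x := by
  have := z.mul x hx _ (inv_mem hx)
  rw [mul_inv_cancel, z.map_one] at this; omega

lemma map_pow {x : Γ} (hx : x ∈ H) (n : ℕ) : h (x ^ n) = n * h x := by
  induction n with
  | zero => simp [z.map_one]
  | succ n ih => rw [pow_succ, z.mul _ (pow_mem hx n) _ hx, ih]; push_cast; ring

lemma map_zpow {x : Γ} (hx : x ∈ H) (n : ℤ) : h (x ^ n) = n * h x := by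
  obtain ⟨k, rfl | rfl⟩ := n.eq_nat_or_neg
  · rw [zpow_natCast, z.map_pow hx]
  · rw [zpow_neg, zpow_natCast, z.map_inv (pow_mem hx k), z.map_pow hx]; ring

lemma symm : g.ZHom H (fun x => - h x) t⁻¹ where
  mul x hx y hy := by rw [z.mul x hx y hy]; ring
  mem := inv_mem z.mem
  one := by rw [z.map_inv z.mem, z.one]; rfl
  kill u hu h := by rw [z.kill u hu h]; rfl

def ker : Subgroup Γ where
  carrier := {x | x ∈ H ∧ h x = 0}
  one_mem' := ⟨H.one_mem, z.map_one⟩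
  mul_mem' := fun {x y} hx hy => ⟨mul_mem hx.1 hy.1, by rw [z.mul x hx.1 y hy.1, hx.2, hy.2]; rfl⟩
  inv_mem' := fun {x} hx => ⟨inv_mem hx.1, by rw [z.map_inv hx.1, hx.2]; rfl⟩

lemma mem_ker {x : Γ} : x ∈ z.ker ↔ x ∈ H ∧ h x = 0 := Iff.rfl

lemma conj_ker {x y : Γ} (hy : y ∈ H) (hx : x ∈ z.ker) : y * x * y⁻¹ ∈ z.ker := by
  refine ⟨mul_mem (mul_mem hy hx.1) (inv_mem hy), ?_⟩
  rw [z.mul _ (mul_mem hy hx.1) _ (inv_mem hy), z.mul _ hy _ hx.1, z.map_inv hy, hx.2]; ring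

lemma split {x : Γ} (hx : x ∈ H) : x * t ^ (- h x) ∈ z.ker := by
  refine ⟨mul_mem hx (zpow_mem z.mem _), ?_⟩
  rw [z.mul _ hx _ (zpow_mem z.mem _), z.map_zpow z.mem, z.one]; ring

/-- h is bounded on balls -/
lemma bdd (R : ℕ) : ∃ M : ℕ, ∀ s ∈ H, g.len s ≤ R → (h s).natAbs ≤ M := by
  have hf : ((fun s => (h s).natAbs) '' {s | s ∈ H ∧ g.len s ≤ R}).Finite := by
    refine finite_of_factor _ (fun s => s • g.o) _ ?_ ?_
    · refine (g.fin g.o R).subset ?_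
      rintro _ ⟨s, hs, rfl⟩
      exact hs.2
    · intro x hx y hy hxy
      have h1 := z.kill (y⁻¹ * x) (mul_mem (inv_mem hy.1) hx.1) (by
        have hxy : x • g.o = y • g.o := hxy
        rw [mul_smul, hxy, inv_smul_smul])
      rw [z.mul _ (inv_mem hy.1) _ hx.1, z.map_inv hy.1] at h1
      show (h x).natAbs = (h y).natAbs
      congr 1; omega
  obtain ⟨M, hM⟩ := hf.bddAbove
  exact ⟨M, fun s hs h => hM ⟨s, ⟨hs, h⟩, rfl⟩⟩

end ZHom

def UU (t σ : Γ) : ℕ → Set Γ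
  | 0 => {1}
  | m+1 => UU t σ m ∪ (fun y => (t^(m+1) * σ * (t^(m+1))⁻¹) * y) '' UU t σ m

lemma UU_fin (t σ : Γ) (m : ℕ) : (UU t σ m).Finite := by
  induction m with
  | zero => exact finite_singleton _
  | succ m ih => exact ih.union (ih.image _)

lemma UU_cl (t σ : Γ) (m : ℕ) : UU t σ m ⊆ Subgroup.closure {x | ∃ j : ℕ, 1 ≤ j ∧ j ≤ m ∧ x = t^j * σ * (t^j)⁻¹} := by
  induction m with
  | zero => rintro _ rfl; exact one_mem _
  | succ m ih =>
    have ih' : UU t σ m ⊆ Subgroup.closure {x | ∃ j : ℕ, 1 ≤ j ∧ j ≤ m + 1 ∧ x = t^j * σ * (t^j)⁻¹} := by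
      refine ih.trans (Subgroup.closure_mono ?_)
      rintro x ⟨j, h1, h2, h3⟩
      exact ⟨j, h1, by omega, h3⟩
    rintro _ (hx | ⟨y, hy, rfl⟩)
    · exact ih' hx
    · exact mul_mem (Subgroup.subset_closure ⟨m+1, by omega, le_rfl, rfl⟩) (ih' hy)

lemma UU_len {H : Subgroup Γ} {t σ : Γ} (ht : t ∈ H) (hσ : σ ∈ H) (m : ℕ) :
    ∀ x ∈ UU t σ m, x ∈ H ∧ g.len ((t^m)⁻¹ * x) ≤ m * (g.len t + g.len σ) := by
  induction m with
  | zero => rintro _ rfl; exact ⟨H.one_mem, by simp [len_one]⟩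
  | succ m ih =>
    have base : ∀ x ∈ UU t σ m, g.len ((t^(m+1))⁻¹ * x) ≤ g.len t + m * (g.len t + g.len σ) := by
      intro x hx
      have h1 := (ih x hx).2
      have h2 := g.len_mul t⁻¹ ((t^m)⁻¹ * x)
      rw [len_inv, ← mul_assoc, ← mul_inv_rev, ← pow_succ] at h2
      omega
    rintro _ (hx | ⟨y, hy, rfl⟩)
    · refine ⟨(ih _ hx).1, (base _ hx).trans ?_⟩
      nlinarith
    · refine ⟨mul_mem (mul_mem (mul_mem (pow_mem ht _) hσ) (inv_mem (pow_mem ht _))) (ih y hy).1, ?_⟩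
      have h1 := g.len_mul σ ((t^(m+1))⁻¹ * y)
      have h2 := base y hy
      have e : (t^(m+1))⁻¹ * (t^(m+1) * σ * (t^(m+1))⁻¹ * y) = σ * ((t^(m+1))⁻¹ * y) := by group
      show g.len ((t^(m+1))⁻¹ * (t^(m+1) * σ * (t^(m+1))⁻¹ * y)) ≤ _
      rw [e]
      nlinarith

lemma milnor_step {H : Subgroup Γ} {t σ : Γ} (ht : t ∈ H) (hσ : σ ∈ H) {D : ℕ}
    (hg : ∀ N0, ∃ N ≥ N0, g.gr H N ≤ N ^ D) :
    ∃ m : ℕ, t^(m+1) * σ * (t^(m+1))⁻¹ ∈ Subgroup.closure ({u | u ∈ H ∧ u • g.o = g.o} ∪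
      {x | ∃ j : ℕ, 1 ≤ j ∧ j ≤ m ∧ x = t^j * σ * (t^j)⁻¹}) := by
  by_contra hcon
  push Not at hcon
  have hcard : ∀ m, ((fun x => x • g.o) '' UU t σ m).ncard = 2^m := by
    intro m
    induction m with
    | zero => simp [UU]
    | succ m ih =>
      rw [UU, image_union, ncard_union_eq ?_ ((UU_fin t σ m).image _) (((UU_fin t σ m).image _).image _)]
      · have : (fun x => x • g.o) '' ((fun y => (t^(m+1) * σ * (t^(m+1))⁻¹) * y) '' UU t σ m) =
          (fun v => (t^(m+1) * σ * (t^(m+1))⁻¹) • v) '' ((fun x => x • g.o) '' UU t σ m) := by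
          rw [image_image, image_image]
          simp only [mul_smul]
        rw [this, ncard_image_of_injective _ (MulAction.injective _), ih, pow_succ]; ring
      · rw [Set.disjoint_left]
        rintro _ ⟨p, hp, rfl⟩ ⟨_, ⟨q, hq, rfl⟩, hpq⟩
        have hpq : ((t^(m+1) * σ * (t^(m+1))⁻¹) * q) • g.o = p • g.o := hpq
        have hm1 : Subgroup.closure {x | ∃ j : ℕ, 1 ≤ j ∧ j ≤ m ∧ x = t^j * σ * (t^j)⁻¹} ≤
          Subgroup.closure ({u | u ∈ H ∧ u • g.o = g.o} ∪
            {x | ∃ j : ℕ, 1 ≤ j ∧ j ≤ m ∧ x = t^j * σ * (t^j)⁻¹}) := Subgroup.closure_mono subset_union_right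
        have hp' := hm1 (UU_cl t σ m hp)
        have hq' := hm1 (UU_cl t σ m hq)
        have hS : p⁻¹ * ((t^(m+1) * σ * (t^(m+1))⁻¹) * q) ∈ {u | u ∈ H ∧ u • g.o = g.o} := by
          refine ⟨mul_mem (inv_mem (g.UU_len ht hσ m p hp).1) (mul_mem (mul_mem (mul_mem (pow_mem ht _) hσ) (inv_mem (pow_mem ht _))) (g.UU_len ht hσ m q hq).1), ?_⟩
          rw [mul_smul, hpq, inv_smul_smul]
        have h3 := mul_mem (mul_mem hp' (Subgroup.subset_closure (Or.inl hS))) (inv_mem hq')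
        refine hcon m ?_
        rw [mul_inv_cancel_left, mul_inv_cancel_right] at h3
        exact h3
  obtain ⟨N1, hN1⟩ := pow_lt_two_pow (2 * D)
  obtain ⟨N, hN, hle⟩ := g.poly_scale hg (2 * g.len t + g.len σ + 1) (by omega) N1
  have h1 : 2 ^ N ≤ g.gr H ((2 * g.len t + g.len σ + 1) * N) := by
    rw [← hcard N, gr]
    refine ncard_le_ncard ?_ (g.ball_fin _ _)
    rintro _ ⟨x, hx, rfl⟩
    obtain ⟨hxH, hl⟩ := g.UU_len ht hσ N x hx
    refine ⟨⟨x, hxH, rfl⟩, ?_⟩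
    have h2 := g.len_mul (t^N) ((t^N)⁻¹ * x)
    rw [mul_inv_cancel_left] at h2
    have h3 := g.len_pow t N
    show g.len x ≤ _
    nlinarith
  have := hN1 N hN
  omega

section LL
variable (H : Subgroup Γ) (S0 : Set Γ)

/-- generators -/
def GN (t : Γ) (N : ℕ) : Set Γ :=
  {u | u ∈ H ∧ u • g.o = g.o} ∪ {x | ∃ σ ∈ S0, ∃ j : ℤ, j.natAbs ≤ N ∧ x = t^j * σ * (t^j)⁻¹}

lemma GN_inv (t : Γ) (N : ℕ) : g.GN H S0 t⁻¹ N = g.GN H S0 t N := by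
  have : ∀ t : Γ, g.GN H S0 t⁻¹ N ⊆ g.GN H S0 t N := by
    rintro t x (hx | ⟨σ, hσ, j, hj, rfl⟩)
    · exact Or.inl hx
    · exact Or.inr ⟨σ, hσ, -j, by rwa [Int.natAbs_neg], by rw [inv_zpow, zpow_neg]⟩
  refine subset_antisymm (this t) ?_
  have := this t⁻¹
  rwa [inv_inv] at this

lemma conj_closure {A : Set Γ} {L : Subgroup Γ} {y : Γ} (h : ∀ a ∈ A, y * a * y⁻¹ ∈ L) {x : Γ}
    (hx : x ∈ Subgroup.closure A) : y * x * y⁻¹ ∈ L := by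
  have : Subgroup.closure A ≤ L.comap (MulAut.conj y).toMonoidHom := by
    rw [Subgroup.closure_le]; exact h
  exact this hx

lemma conj_GN {t : Γ} {N : ℕ} (hN : 1 ≤ N)
    (htS : ∀ u ∈ H, u • g.o = g.o → t * u * t⁻¹ ∈ Subgroup.closure ({u | u ∈ H ∧ u • g.o = g.o} ∪ S0))
    (hJ : ∀ σ ∈ S0, ∃ m : ℕ, m + 1 ≤ N ∧ t^(m+1) * σ * (t^(m+1))⁻¹ ∈ Subgroup.closure ({u | u ∈ H ∧ u • g.o = g.o} ∪
      {x | ∃ j : ℕ, 1 ≤ j ∧ j ≤ m ∧ x = t^j * σ * (t^j)⁻¹})) {x : Γ} (hx : x ∈ Subgroup.closure (g.GN H S0 t N)) :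
    t * x * t⁻¹ ∈ Subgroup.closure (g.GN H S0 t N) := by
  have hS : ∀ m ≤ N + 1, ∀ u ∈ H, u • g.o = g.o → t^m * u * (t^m)⁻¹ ∈ Subgroup.closure (g.GN H S0 t N) := by
    intro m
    induction m with
    | zero => intro _ u hu hu2; rw [pow_zero, one_mul, inv_one, mul_one]; exact Subgroup.subset_closure (Or.inl ⟨hu, hu2⟩)
    | succ m ih =>
      intro hm u hu hu2
      have := conj_closure (L := Subgroup.closure (g.GN H S0 t N)) (y := t^m) ?_ (htS u hu hu2)
      · have e : t ^ (m+1) * u * (t^(m+1))⁻¹ = t^m * (t * u * t⁻¹) * (t^m)⁻¹ := by rw [pow_succ]; group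
        rw [e]; exact this
      · rintro a (ha | ha)
        · exact ih (by omega) a ha.1 ha.2
        · exact Subgroup.subset_closure (Or.inr ⟨a, ha, m, by rw [Int.natAbs_natCast]; omega, by rw [zpow_natCast]⟩)
  refine conj_closure ?_ hx
  rintro a (ha | ⟨σ, hσ, j, hj, rfl⟩)
  · have := hS 1 (by omega) a ha.1 ha.2
    rwa [pow_one] at this
  · have e : t * (t^j * σ * (t^j)⁻¹) * t⁻¹ = t^(j+1) * σ * (t^(j+1))⁻¹ := by rw [zpow_add_one]; group
    rw [e]
    by_cases hj2 : (j + 1).natAbs ≤ N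
    · exact Subgroup.subset_closure (Or.inr ⟨σ, hσ, j+1, hj2, rfl⟩)
    · have hj3 : j + 1 = ((N + 1 : ℕ) : ℤ) := by omega
      rw [hj3, zpow_natCast]
      obtain ⟨m, hm, hmem⟩ := hJ σ hσ
      have := conj_closure (L := Subgroup.closure (g.GN H S0 t N)) (y := t^(N-m)) ?_ hmem
      · have e : t^(N+1) = t^(N-m) * t^(m+1) := by rw [← pow_add]; congr 1; omega
        rw [e, mul_inv_rev]
        have e2 : t ^ (N - m) * t ^ (m + 1) * σ * ((t ^ (m + 1))⁻¹ * (t ^ (N - m))⁻¹) =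
          t ^ (N - m) * (t ^ (m + 1) * σ * (t ^ (m + 1))⁻¹) * (t ^ (N - m))⁻¹ := by group
        rw [e2]; exact this
      · rintro a (ha | ⟨i, hi1, hi2, rfl⟩)
        · exact hS _ (by omega) a ha.1 ha.2
        · refine Subgroup.subset_closure (Or.inr ⟨σ, hσ, ((N - m + i : ℕ) : ℤ), by rw [Int.natAbs_natCast]; omega, ?_⟩)
          rw [zpow_natCast, pow_add]; group

end LL

theorem milnor {H : Subgroup Γ} {h : Γ → ℤ} {t : Γ} (z : g.ZHom H h t) (hb : g.BG H) {D : ℕ}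
    (hg : ∀ N0, ∃ N ≥ N0, g.gr H N ≤ N ^ D) : g.BG z.ker := by
  obtain ⟨R, hR⟩ := hb
  obtain ⟨M, hM⟩ := z.bdd R
  obtain ⟨r0, hr0⟩ : ∃ r0, r0 = R + M * g.len t + 2 * g.len t := ⟨_, rfl⟩
  -- finite set of representatives
  obtain ⟨S0, hS1, hS2⟩ := Set.exists_subset_bijOn {k : Γ | k ∈ z.ker ∧ g.len k ≤ r0} (fun k => k • g.o)
  have hS0fin : S0.Finite := by
    refine Set.Finite.of_finite_image (f := fun k => k • g.o) ?_ hS2.injOn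
    rw [hS2.image_eq]
    refine (g.fin g.o r0).subset ?_
    rintro _ ⟨s, hs, rfl⟩
    exact hs.2
  have hA : ∀ k ∈ z.ker, g.len k ≤ r0 → k ∈ Subgroup.closure ({u | u ∈ H ∧ u • g.o = g.o} ∪ S0) := by
    intro k hk hl
    obtain ⟨σ, hσ, hσk⟩ := hS2.surjOn ⟨k, ⟨hk, hl⟩, rfl⟩
    have hσk : σ • g.o = k • g.o := hσk
    have h1 : σ⁻¹ * k ∈ {u | u ∈ H ∧ u • g.o = g.o} :=
      ⟨mul_mem (inv_mem (hS1 hσ).1.1) hk.1, by rw [mul_smul, ← hσk, inv_smul_smul]⟩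
    have := mul_mem (Subgroup.subset_closure (Or.inr hσ) : σ ∈ Subgroup.closure ({u | u ∈ H ∧ u • g.o = g.o} ∪ S0))
      (Subgroup.subset_closure (Or.inl h1))
    rwa [mul_inv_cancel_left] at this
  have htS : ∀ t' ∈ H, g.len t' = g.len t → ∀ u ∈ H, u • g.o = g.o →
      t' * u * t'⁻¹ ∈ Subgroup.closure ({u | u ∈ H ∧ u • g.o = g.o} ∪ S0) := by
    intro t' ht' hl u hu hu2
    refine hA _ (z.conj_ker ht' ⟨hu, z.kill u hu hu2⟩) ?_
    have h1 := g.len_mul (t' * u) t'⁻¹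
    have h2 := g.len_mul t' u
    have h3 := g.len_eq_zero.2 hu2
    rw [len_inv] at h1
    omega
  have hJ : ∀ t' ∈ H, ∃ N, ∀ σ ∈ S0, ∃ m : ℕ, m + 1 ≤ N ∧ t'^(m+1) * σ * (t'^(m+1))⁻¹ ∈
      Subgroup.closure ({u | u ∈ H ∧ u • g.o = g.o} ∪ {x | ∃ j : ℕ, 1 ≤ j ∧ j ≤ m ∧ x = t'^j * σ * (t'^j)⁻¹}) := by
    intro t' ht'
    have hst : ∀ σ : Γ, ∃ m : ℕ, σ ∈ S0 → t'^(m+1) * σ * (t'^(m+1))⁻¹ ∈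
      Subgroup.closure ({u | u ∈ H ∧ u • g.o = g.o} ∪ {x | ∃ j : ℕ, 1 ≤ j ∧ j ≤ m ∧ x = t'^j * σ * (t'^j)⁻¹}) := by
      intro σ
      by_cases hσ : σ ∈ S0
      · obtain ⟨m, hm⟩ := g.milnor_step ht' (hS1 hσ).1.1 hg
        exact ⟨m, fun _ => hm⟩
      · exact ⟨0, fun h => absurd h hσ⟩
    choose m hm using hst
    obtain ⟨N, hN⟩ := (hS0fin.image (fun σ => m σ + 1)).bddAbove
    exact ⟨N, fun σ hσ => ⟨m σ, hN ⟨σ, hσ, rfl⟩, hm σ hσ⟩⟩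
  obtain ⟨N1, hN1⟩ := hJ t z.mem
  obtain ⟨N2, hN2⟩ := hJ t⁻¹ (inv_mem z.mem)
  obtain ⟨N, hN⟩ : ∃ N, N = N1 + N2 + 1 := ⟨_, rfl⟩
  set L := Subgroup.closure (g.GN H S0 t N) with hL
  have hc1 : ∀ x ∈ L, t * x * t⁻¹ ∈ L := fun x hx => g.conj_GN H S0 (by omega) (htS t z.mem rfl)
    (fun σ hσ => by obtain ⟨m, h1, h2⟩ := hN1 σ hσ; exact ⟨m, by omega, h2⟩) hx
  have hc2 : ∀ x ∈ L, t⁻¹ * x * t ∈ L := by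
    intro x hx
    rw [hL, ← g.GN_inv] at hx ⊢
    have := g.conj_GN H S0 (by omega) (htS t⁻¹ (inv_mem z.mem) (g.len_inv t))
      (fun σ hσ => by obtain ⟨m, h1, h2⟩ := hN2 σ hσ; exact ⟨m, by omega, h2⟩) hx
    rwa [inv_inv] at this
  have hcp : ∀ n : ℕ, ∀ x ∈ L, t^n * x * (t^n)⁻¹ ∈ L := by
    intro n
    induction n with
    | zero => intro x hx; simpa using hx
    | succ n ih =>
      intro x hx
      have := hc1 _ (ih x hx)
      rw [pow_succ']
      simpa [mul_assoc] using this
  have hcm : ∀ n : ℕ, ∀ x ∈ L, (t^n)⁻¹ * x * (t^n) ∈ L := by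
    intro n
    induction n with
    | zero => intro x hx; simpa using hx
    | succ n ih =>
      intro x hx
      have := hc2 _ (ih x hx)
      rw [pow_succ]
      simpa [mul_assoc] using this
  have hcz : ∀ n : ℤ, ∀ x ∈ L, t^n * x * (t^n)⁻¹ ∈ L := by
    intro n x hx
    obtain ⟨k, rfl | rfl⟩ := n.eq_nat_or_neg
    · rw [zpow_natCast]; exact hcp k x hx
    · rw [zpow_neg, zpow_natCast, inv_inv]; exact hcm k x hx
  have hAL : Subgroup.closure ({u | u ∈ H ∧ u • g.o = g.o} ∪ S0) ≤ L := by
    refine Subgroup.closure_mono ?_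
    rintro x (hx | hx)
    · exact Or.inl hx
    · exact Or.inr ⟨x, hx, 0, by simp, by simp⟩
  have hsub : Subgroup.closure {s | s ∈ H ∧ g.len s ≤ R} ≤ H := by
    rw [Subgroup.closure_le]; exact fun s hs => hs.1
  have stp : ∀ x ∈ H, x * t ^ (- h x) ∈ L → ∀ s ∈ H, g.len s ≤ R → (x * s) * t ^ (- h (x * s)) ∈ L := by
    intro x hx hxL s hs hl
    have h1 : s * t ^ (- h s) ∈ L := by
      refine hAL (hA _ (z.split hs) ?_)
      have e1 := g.len_mul s (t ^ (- h s))
      have e2 := g.len_zpow t (- h s)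
      rw [Int.natAbs_neg] at e2
      have e3 := Nat.mul_le_mul_right (g.len t) (hM s hs hl)
      omega
    have h2 := mul_mem hxL (hcz (h x) _ h1)
    have e : x * s * t ^ (-h (x * s)) = x * t ^ (-h x) * (t ^ h x * (s * t ^ (-h s)) * (t ^ h x)⁻¹) := by
      rw [z.mul x hx s hs, neg_add, zpow_add, (Commute.zpow_zpow_self t (-h x) (-h s)).eq]
      simp [mul_assoc]
    rw [e]; exact h2
  have key : ∀ γ ∈ Subgroup.closure {s | s ∈ H ∧ g.len s ≤ R}, γ * t ^ (- h γ) ∈ L := by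
    intro γ hγ
    induction hγ using Subgroup.closure_induction_right with
    | one => rw [z.map_one]; simpa using one_mem L
    | mul_right x hx y hy ih => exact stp x (hsub hx) ih y hy.1 hy.2
    | mul_inv_cancel x hx y hy ih => exact stp x (hsub hx) ih y⁻¹ (inv_mem hy.1) (by rw [len_inv]; exact hy.2)
  refine ⟨r0 + 2 * (N * g.len t), fun γ hγ => ?_⟩
  have h1 := key γ (hR γ hγ.1)
  rw [hγ.2, neg_zero, zpow_zero, mul_one] at h1
  refine Subgroup.closure_mono ?_ h1
  rintro x (hx | ⟨σ, hσ, j, hj, rfl⟩)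
  · exact ⟨⟨hx.1, z.kill _ hx.1 hx.2⟩, by rw [g.len_eq_zero.2 hx.2]; exact Nat.zero_le _⟩
  · refine ⟨z.conj_ker (zpow_mem z.mem _) (hS1 hσ).1, ?_⟩
    have e1 := g.len_mul (t^j * σ) (t^j)⁻¹
    have e2 := g.len_mul (t^j) σ
    have e3 := g.len_zpow t j
    have e4 := Nat.mul_le_mul_right (g.len t) hj
    have e5 := (hS1 hσ).2
    rw [len_inv] at e1
    omega

end Geo
end RotorWalk

namespace RotorWalk
set_option linter.unusedSectionVars false
namespace Geo
variable {Γ V : Type*} [Group Γ] [MulAction Γ V] (g : Geo Γ V)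

def PG (e : ℕ) (H : Subgroup Γ) : Prop := ∃ C, ∀ N0, ∃ N ≥ N0, (g.gr H N)^2 ≤ C * N^e

lemma PG_poly {e : ℕ} {H : Subgroup Γ} (hp : g.PG e H) : ∀ N0, ∃ N ≥ N0, g.gr H N ≤ N ^ (e+1) := by
  obtain ⟨C, hC⟩ := hp
  intro N0
  obtain ⟨N, hN, h⟩ := hC (N0 + C)
  refine ⟨N, by omega, ?_⟩
  have h1 : g.gr H N ≤ (g.gr H N)^2 := Nat.le_self_pow (by norm_num) _
  refine h1.trans (h.trans ?_)
  rw [pow_succ, mul_comm]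
  exact Nat.mul_le_mul_left _ (by omega)

lemma PG_mono {e : ℕ} {K H : Subgroup Γ} (hle : K ≤ H) (hp : g.PG e H) : g.PG e K := by
  obtain ⟨C, hC⟩ := hp
  refine ⟨C, fun N0 => ?_⟩
  obtain ⟨N, hN, h⟩ := hC N0
  exact ⟨N, hN, (Nat.pow_le_pow_left (g.gr_mono hle le_rfl) 2).trans h⟩

lemma count {H : Subgroup Γ} {h : Γ → ℤ} {t : Γ} (z : g.ZHom H h t) (N : ℕ) :
    N * g.gr z.ker N ≤ g.gr H ((1 + g.len t) * N) := by
  classical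
  have hinj : InjOn (fun q : ℕ × V => t ^ q.1 • q.2)
      ((Finset.range N : Set ℕ) ×ˢ (g.orb z.ker ∩ {x | g.δ g.o x ≤ N})) := by
    rintro ⟨i, _⟩ ⟨-, ⟨κ, hκ, rfl⟩, -⟩ ⟨j, _⟩ ⟨-, ⟨κ', hκ', rfl⟩, -⟩ he
    have he : t ^ i • κ • g.o = t ^ j • κ' • g.o := he
    have h1 := z.kill ((t^j * κ')⁻¹ * (t^i * κ))
      (mul_mem (inv_mem (mul_mem (pow_mem z.mem _) hκ'.1)) (mul_mem (pow_mem z.mem _) hκ.1)) (by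
        rw [mul_smul, mul_smul (t^i), he, ← mul_smul (t^j), inv_smul_smul])
    rw [z.mul _ (inv_mem (mul_mem (pow_mem z.mem _) hκ'.1)) _ (mul_mem (pow_mem z.mem _) hκ.1),
      z.map_inv (mul_mem (pow_mem z.mem _) hκ'.1), z.mul _ (pow_mem z.mem _) _ hκ'.1,
      z.mul _ (pow_mem z.mem _) _ hκ.1, hκ.2, hκ'.2, z.map_pow z.mem, z.map_pow z.mem, z.one] at h1
    have hij : i = j := by omega
    subst hij
    rw [Prod.mk.injEq]
    exact ⟨rfl, MulAction.injective (t^i) he⟩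
  have h1 := ncard_image_of_injOn hinj
  rw [ncard_prod, ncard_coe_finset, Finset.card_range] at h1
  rw [gr, ← h1, gr]
  refine ncard_le_ncard ?_ (g.ball_fin _ _)
  rintro _ ⟨⟨i, _⟩, ⟨hi, ⟨κ, hκ, rfl⟩, hl⟩, rfl⟩
  refine ⟨⟨t^i * κ, mul_mem (pow_mem z.mem _) hκ.1, mul_smul _ _ _⟩, ?_⟩
  have hl : g.len κ ≤ N := hl
  have hi : i < N := by simpa using hi
  show g.δ g.o (t ^ i • κ • g.o) ≤ _
  rw [← mul_smul]
  have h2 := g.len_mul (t^i) κ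
  have h3 := g.len_pow t i
  have h4 := Nat.mul_le_mul_right (g.len t) hi.le
  show g.len (t^i * κ) ≤ _
  nlinarith

lemma PG_ker {e : ℕ} {H : Subgroup Γ} {h : Γ → ℤ} {t : Γ} (z : g.ZHom H h t) (hp : g.PG (e+2) H) :
    g.PG e z.ker := by
  obtain ⟨C, hC⟩ := hp
  obtain ⟨c, hc⟩ : ∃ c, c = 1 + g.len t := ⟨_, rfl⟩
  refine ⟨C * (2 * c)^(e+2), fun N0 => ?_⟩
  obtain ⟨n, hn, h1⟩ := hC (c * (N0 + 1))
  have h2 : N0 + 1 ≤ n / c := by rw [Nat.le_div_iff_mul_le (by omega), mul_comm]; exact hn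
  obtain ⟨N, hN⟩ : ∃ N, N = n / c := ⟨_, rfl⟩
  rw [← hN] at h2
  refine ⟨N, by omega, ?_⟩
  have h3 := g.count z N
  rw [← hc] at h3
  have h4 : g.gr H (c * N) ≤ g.gr H n := g.gr_mono le_rfl (by rw [hN]; exact Nat.mul_div_le n c)
  have h5 : n ≤ 2 * c * N := by
    have := Nat.lt_mul_div_succ n (show 0 < c by omega)
    rw [← hN] at this
    nlinarith
  have h6 : (N * g.gr z.ker N)^2 ≤ C * (2 * c * N)^(e+2) :=
    (Nat.pow_le_pow_left (h3.trans h4) 2).trans (h1.trans (Nat.mul_le_mul_left _ (Nat.pow_le_pow_left h5 _)))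
  have h7 : N^2 * (g.gr z.ker N)^2 ≤ N^2 * (C * (2 * c)^(e+2) * N^e) := by
    calc _ = (N * g.gr z.ker N)^2 := by ring
      _ ≤ _ := h6
      _ = _ := by ring
  exact Nat.le_of_mul_le_mul_left h7 (pow_pos (by omega) 2)

lemma gr_lin {K : Subgroup Γ} (hb : g.BG K) (hinf : (g.orb K).Infinite) :
    ∃ R, 1 ≤ R ∧ ∀ n, n ≤ g.gr K (R * n) := by
  obtain ⟨R, hR⟩ := hb
  have hsub : Subgroup.closure {s | s ∈ K ∧ g.len s ≤ R} ≤ K := by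
    rw [Subgroup.closure_le]; exact fun s hs => hs.1
  refine ⟨R + 1, by omega, fun n => ?_⟩
  induction n with
  | zero => exact Nat.zero_le _
  | succ n ih =>
    refine Nat.succ_le_of_lt (lt_of_le_of_lt ih ?_)
    have hex : ∃ γ ∈ K, (R+1) * n < g.len γ ∧ g.len γ ≤ (R+1) * (n+1) := by
      by_contra hcon
      push Not at hcon
      apply hinf
      refine (g.fin g.o ((R+1)*n)).subset ?_
      rintro _ ⟨γ, hγ, rfl⟩
      have stp : ∀ x y, g.len y ≤ R → g.len x ≤ (R+1)*n → x ∈ K → y ∈ K → g.len (x * y) ≤ (R+1)*n := by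
        intro x y hy hx hxK hyK
        by_contra hlt
        have h1 := hcon (x*y) (mul_mem hxK hyK) (by omega)
        have h2 := g.len_mul x y
        rw [mul_add, mul_one] at h1
        omega
      have key : ∀ γ ∈ Subgroup.closure {s | s ∈ K ∧ g.len s ≤ R}, g.len γ ≤ (R+1)*n := by
        intro γ hγ
        induction hγ using Subgroup.closure_induction_right with
        | one => rw [len_one]; exact Nat.zero_le _
        | mul_right x hx y hy ih => exact stp x y hy.2 ih (hsub hx) hy.1
        | mul_inv_cancel x hx y hy ih =>
          exact stp x y⁻¹ (by rw [len_inv]; exact hy.2) ih (hsub hx) (inv_mem hy.1)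
      exact key γ (hR γ hγ)
    obtain ⟨γ, hγ, h1, h2⟩ := hex
    refine ncard_lt_ncard ?_ (g.ball_fin _ _)
    rw [ssubset_iff_of_subset]
    · refine ⟨γ • g.o, ⟨⟨γ, hγ, rfl⟩, h2⟩, ?_⟩
      rintro ⟨-, h3⟩
      have h3 : g.len γ ≤ _ := h3
      omega
    · rintro x ⟨hx, hl⟩
      exact ⟨hx, le_trans hl (Nat.mul_le_mul_left _ (by omega))⟩

lemma orb_fin {K : Subgroup Γ} (hb : g.BG K) (hp : g.PG 1 K) : (g.orb K).Finite := by
  by_contra hinf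
  obtain ⟨R, hR1, hR⟩ := g.gr_lin hb hinf
  obtain ⟨C, hC⟩ := hp
  obtain ⟨N, hN, h⟩ := hC (R * (2 * R * C + 1))
  obtain ⟨n, hn⟩ : ∃ n, n = N / R := ⟨_, rfl⟩
  have h2 : 2 * R * C + 1 ≤ n := by rw [hn, Nat.le_div_iff_mul_le (by omega), mul_comm]; exact hN
  have h3 : n ≤ g.gr K N := (hR n).trans (g.gr_mono le_rfl (by rw [hn]; exact Nat.mul_div_le _ _))
  have h4 : N ≤ 2 * R * n := by
    have := Nat.lt_mul_div_succ N (show 0 < R by omega)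
    rw [← hn] at this
    nlinarith
  rw [pow_one] at h
  have h5 : n * n ≤ (2 * R * C) * n := by
    calc n * n ≤ (g.gr K N)^2 := by nlinarith
      _ ≤ C * N := h
      _ ≤ C * (2 * R * n) := Nat.mul_le_mul_left _ h4
      _ = _ := by ring
  have := Nat.le_of_mul_le_mul_right h5 (by omega)
  omega

end Geo
end RotorWalk

namespace RotorWalk
set_option linter.unusedSectionVars false
namespace Geo
variable {Γ V : Type*} [Group Γ] [MulAction Γ V] (g : Geo Γ V)

structure Stg (H K K2 : Subgroup Γ) (φ : Γ → ℤ) : Prop where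
  le : K2 ≤ K
  nor : ∀ γ ∈ H, ∀ k ∈ K2, γ * k * γ⁻¹ ∈ K2
  add : ∀ x ∈ K2, ∀ y ∈ K2, φ (x * y) = φ x + φ y
  abs : ∀ γ ∈ H, ∀ k ∈ K2, (φ (γ * k * γ⁻¹)).natAbs = (φ k).natAbs
  kill : ∀ u ∈ K2, u • g.o = g.o → φ u = 0
  fin : {x | ∃ k ∈ K2, φ k = 0 ∧ k • g.o = x}.Finite
  cd : g.CD K2 K

/-- two homomorphisms exchanged by an automorphism -/
lemma abs_aux {K2 : Subgroup Γ} {φ : Γ → ℤ} (hadd : ∀ x ∈ K2, ∀ y ∈ K2, φ (x * y) = φ x + φ y)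
    (hz : ∀ x ∈ K2, ∀ n : ℤ, φ (x ^ n) = n * φ x)
    {γ : Γ} (h1 : ∀ k ∈ K2, γ * k * γ⁻¹ ∈ K2) (h2 : ∀ k ∈ K2, γ⁻¹ * k * γ ∈ K2)
    (h3 : ∀ k ∈ K2, φ k = 0 → φ (γ * k * γ⁻¹) = 0) (h4 : ∀ k ∈ K2, φ k = 0 → φ (γ⁻¹ * k * γ) = 0)
    {k : Γ} (hk : k ∈ K2) : (φ (γ * k * γ⁻¹)).natAbs = (φ k).natAbs := by
  classical
  by_cases hex : ∃ n : ℕ, 0 < n ∧ ∃ l ∈ K2, (φ l).natAbs = n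
  · obtain ⟨hd, l, hl, hld⟩ := Nat.find_spec hex
    have hmin : ∀ x ∈ K2, φ x ≠ 0 → Nat.find hex ≤ (φ x).natAbs := fun x hx h0 =>
      Nat.find_min' hex ⟨Int.natAbs_pos.2 h0, x, hx, rfl⟩
    obtain ⟨d, hdd⟩ : ∃ d, d = Nat.find hex := ⟨_, rfl⟩
    rw [← hdd] at hd hld hmin
    have hconj : ∀ x ∈ K2, ∀ n : ℤ, φ (γ * x ^ n * γ⁻¹) = n * φ (γ * x * γ⁻¹) := by
      intro x hx n
      rw [← conj_zpow, hz _ (h1 x hx)]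
    have hcross : ∀ x ∈ K2, ∀ y ∈ K2, φ y * φ (γ * x * γ⁻¹) = φ x * φ (γ * y * γ⁻¹) := by
      intro x hx y hy
      have e1 : φ (x ^ (φ y) * y ^ (- φ x)) = 0 := by
        rw [hadd _ (zpow_mem hx _) _ (zpow_mem hy _), hz x hx, hz y hy]; ring
      have e2 := h3 _ (mul_mem (zpow_mem hx _) (zpow_mem hy _)) e1
      have e3 : γ * (x ^ (φ y) * y ^ (- φ x)) * γ⁻¹ = (γ * x ^ (φ y) * γ⁻¹) * (γ * y ^ (- φ x) * γ⁻¹) := by group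
      rw [e3, hadd _ (h1 _ (zpow_mem hx _)) _ (h1 _ (zpow_mem hy _)), hconj x hx, hconj y hy] at e2
      linarith
    have hl2 := h2 l hl
    have e0 : γ * (γ⁻¹ * l * γ) * γ⁻¹ = l := by group
    have c1 := hcross _ hl2 l hl
    rw [e0] at c1
    have hlne : φ l ≠ 0 := by intro h; rw [h] at hld; simp at hld; omega
    have hl2ne : φ (γ⁻¹ * l * γ) ≠ 0 := by
      intro h
      have := h3 _ hl2 h
      rw [e0] at this; exact hlne this
    have hl3ne : φ (γ * l * γ⁻¹) ≠ 0 := by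
      intro h
      rw [h, mul_zero] at c1
      exact hlne (mul_self_eq_zero.1 c1)
    have m1 := hmin _ hl2 hl2ne
    have m2 := hmin _ (h1 l hl) hl3ne
    have c2 := congrArg Int.natAbs c1
    rw [Int.natAbs_mul, Int.natAbs_mul, hld] at c2
    have m3 : (φ (γ * l * γ⁻¹)).natAbs = d := by nlinarith
    have c3 := congrArg Int.natAbs (hcross k hk l hl)
    rw [Int.natAbs_mul, Int.natAbs_mul, m3, hld, mul_comm] at c3
    exact Nat.eq_of_mul_eq_mul_right hd c3
  · push Not at hex
    have hall : ∀ x ∈ K2, φ x = 0 := by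
      intro x hx
      by_contra h
      exact hex _ (Int.natAbs_pos.2 h) x hx rfl
    rw [hall k hk, hall _ (h1 k hk)]

lemma CD_trans {A B C : Subgroup Γ} (h1 : g.CD A B) (h2 : g.CD B C) : g.CD A C := by
  obtain ⟨c1, h1⟩ := h1
  obtain ⟨c2, h2⟩ := h2
  refine ⟨c2 + c1, fun γ hγ => ?_⟩
  obtain ⟨κ, hκ, e1⟩ := h2 γ hγ
  obtain ⟨μ, hμ, e2⟩ := h1 κ hκ
  exact ⟨μ, hμ, (g.tri _ (κ • g.o) _).trans (by omega)⟩

lemma zhom_bdd {K' : Subgroup Γ} {h : Γ → ℤ} {s : Γ} (z : g.ZHom K' h s) {k : Γ} (hk : k ∈ K') {B : ℕ}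
    (hB : ∀ n : ℕ, g.len (k^n) ≤ B) : h k = 0 := by
  have hf : (range (fun n : ℕ => k^n • g.o)).Finite := (g.fin g.o B).subset (by rintro _ ⟨n, rfl⟩; exact hB n)
  have hni : ¬ Function.Injective (fun n : ℕ => k^n • g.o) := fun hi => Set.infinite_range_of_injective hi hf
  rw [Function.Injective] at hni
  push Not at hni
  obtain ⟨i, j, hij, hne⟩ := hni
  have h1 := z.kill ((k^j)⁻¹ * k^i) (mul_mem (inv_mem (pow_mem hk _)) (pow_mem hk _)) (by
    have hij : k^i • g.o = k^j • g.o := hij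
    rw [mul_smul, hij, inv_smul_smul])
  rw [z.mul _ (inv_mem (pow_mem hk _)) _ (pow_mem hk _), z.map_inv (pow_mem hk _), z.map_pow hk, z.map_pow hk] at h1
  have h2 : ((i:ℤ) - j) * h k = 0 := by linarith
  rcases mul_eq_zero.1 h2 with h3 | h3
  · omega
  · exact h3

theorem stage {H : Subgroup Γ} {h : Γ → ℤ} {t : Γ} (z : g.ZHom H h t) (hb : g.BG z.ker) (hp : g.PG 3 z.ker) :
    ∃ K2 φ, g.Stg H z.ker K2 φ := by
  obtain ⟨K, hKd⟩ : ∃ K, K = z.ker := ⟨_, rfl⟩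
  have hKc : ∀ γ ∈ H, ∀ k ∈ K, γ * k * γ⁻¹ ∈ K := fun γ hγ k hk => by
    rw [hKd] at hk ⊢; exact z.conj_ker hγ hk
  rw [← hKd] at hb hp ⊢
  by_cases hinf : (g.orb K).Finite
  · refine ⟨⊥, fun _ => 0, bot_le, ?_, by simp, by simp, by simp, ?_, ?_⟩
    · intro γ _ k hk
      rw [Subgroup.mem_bot] at hk ⊢
      rw [hk]; group
    · refine hinf.subset ?_
      rintro _ ⟨k, hk, -, rfl⟩
      rw [Subgroup.mem_bot] at hk
      exact ⟨k, hk ▸ K.one_mem, rfl⟩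
    · obtain ⟨B, hB⟩ := (hinf.image (fun x => g.δ x g.o)).bddAbove
      refine ⟨B, fun γ hγ => ⟨1, Subgroup.mem_bot.2 rfl, ?_⟩⟩
      rw [one_smul]
      exact hB ⟨_, ⟨γ, hγ, rfl⟩, rfl⟩
  · obtain ⟨K', hle, hidx, h', s, z'⟩ := g.thmZ hb hinf _ (g.PG_poly hp)
    have hcd := g.CD_of_relIndex hle hidx
    have hb' := g.BG_of_CD hle hcd hb
    have hp' := g.PG_mono hle hp
    have hb2 := g.milnor z' hb' (g.PG_poly hp')
    have hp2 : g.PG 1 z'.ker := g.PG_ker z' hp'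
    have hfin := g.orb_fin hb2 hp2
    obtain ⟨B, hB⟩ := (hfin.image (fun x => g.δ g.o x)).bddAbove
    have hB : ∀ k ∈ z'.ker, g.len k ≤ B := fun k hk => hB ⟨_, ⟨k, hk, rfl⟩, rfl⟩
    obtain ⟨M, hM⟩ : ∃ M, M = (K'.relIndex K).factorial := ⟨_, rfl⟩
    have hM0 : 0 < M := hM ▸ Nat.factorial_pos _
    have hpow : ∀ k ∈ K, k ^ M ∈ K' := fun k hk =>
      (Subgroup.pow_mem_of_relIndex_ne_zero_of_dvd hidx hk
        (fun m h1 h2 => hM ▸ Nat.dvd_factorial h1 h2)).1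
    obtain ⟨K2, hK2⟩ : ∃ K2, K2 = Subgroup.closure {x | ∃ k ∈ K, x = k ^ M} := ⟨_, rfl⟩
    have hK2le : K2 ≤ K' := by
      rw [hK2, Subgroup.closure_le]
      rintro _ ⟨k, hk, rfl⟩
      exact hpow k hk
    have hnor : ∀ γ ∈ H, ∀ k ∈ K2, γ * k * γ⁻¹ ∈ K2 := by
      intro γ hγ k hk
      rw [hK2] at hk ⊢
      refine conj_closure ?_ hk
      rintro _ ⟨k, hk, rfl⟩
      refine Subgroup.subset_closure ⟨γ * k * γ⁻¹, hKc γ hγ k hk, ?_⟩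
      rw [conj_pow]
    have hzero : ∀ γ ∈ H, ∀ k ∈ K2, h' k = 0 → h' (γ * k * γ⁻¹) = 0 := by
      intro γ hγ k hk h0
      refine g.zhom_bdd z' (hK2le (hnor γ hγ k hk)) (B := B + 2 * g.len γ) ?_
      intro n
      rw [conj_pow]
      have e1 := g.len_mul (γ * k^n) γ⁻¹
      have e2 := g.len_mul γ (k^n)
      have e3 := hB (k^n) (pow_mem (show k ∈ z'.ker from ⟨hK2le hk, h0⟩) n)
      rw [len_inv] at e1
      omega
    refine ⟨K2, h', hK2le.trans hle, hnor, fun x hx y hy => z'.mul x (hK2le hx) y (hK2le hy), ?_, 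
      fun u hu => z'.kill u (hK2le hu), ?_, ?_⟩
    · intro γ hγ k hk
      refine abs_aux (fun x hx y hy => z'.mul x (hK2le hx) y (hK2le hy)) (fun x hx n => z'.map_zpow (hK2le hx) n)
        (hnor γ hγ) ?_ (hzero γ hγ) ?_ hk
      · intro k hk
        have := hnor γ⁻¹ (inv_mem hγ) k hk
        rwa [inv_inv] at this
      · intro k hk h0
        have := hzero γ⁻¹ (inv_mem hγ) k hk h0
        rwa [inv_inv] at this
    · refine hfin.subset ?_
      rintro _ ⟨k, hk, h0, rfl⟩
      exact ⟨k, ⟨hK2le hk, h0⟩, rfl⟩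
    · refine g.CD_trans ⟨M * g.len s + B, fun κ hκ => ?_⟩ hcd
      obtain ⟨q, hq⟩ : ∃ q, q = h' κ / (M : ℤ) := ⟨_, rfl⟩
      obtain ⟨r, hr⟩ : ∃ r, r = h' κ % (M : ℤ) := ⟨_, rfl⟩
      have hn : h' κ = q * M + r := by rw [hq, hr]; exact (Int.ediv_mul_add_emod _ _).symm
      have hr0 : 0 ≤ r := by rw [hr]; exact Int.emod_nonneg _ (by omega)
      have hr1 : r < M := by rw [hr]; exact Int.emod_lt_of_pos _ (by omega)
      refine ⟨(s ^ q) ^ M, ?_, ?_⟩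
      · rw [hK2]
        exact Subgroup.subset_closure ⟨s^q, zpow_mem (hle z'.mem) q, rfl⟩
      · rw [g.symm, δ_smul]
        have hk0 : (s ^ (h' κ))⁻¹ * κ ∈ z'.ker := by
          refine ⟨mul_mem (inv_mem (zpow_mem z'.mem _)) hκ, ?_⟩
          rw [z'.mul _ (inv_mem (zpow_mem z'.mem _)) _ hκ, z'.map_inv (zpow_mem z'.mem _), z'.map_zpow z'.mem, z'.one]; ring
        have e : ((s ^ q) ^ M)⁻¹ * κ = s ^ r * ((s ^ (h' κ))⁻¹ * κ) := by
          rw [hn, zpow_add, zpow_mul, zpow_natCast]; group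
        rw [e]
        have e1 := g.len_mul (s^r) ((s ^ (h' κ))⁻¹ * κ)
        have e2 := hB _ hk0
        have e3 := g.len_zpow s r
        have e4 := Nat.mul_le_mul_right (g.len s) (show r.natAbs ≤ M by omega)
        omega

end Geo
end RotorWalk

namespace RotorWalk
set_option linter.unusedSectionVars false
namespace Geo
variable {Γ V : Type*} [Group Γ] [MulAction Γ V] (g : Geo Γ V)

section fin
variable {H : Subgroup Γ} {h : Γ → ℤ} {t : Γ} (z : g.ZHom H h t) {K2 : Subgroup Γ} {φ : Γ → ℤ}
  (st : g.Stg H z.ker K2 φ)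
include st

lemma tconj (a : ℤ) {k : Γ} (hk : k ∈ K2) : t^a * k * (t^a)⁻¹ ∈ K2 := st.nor _ (zpow_mem z.mem a) k hk

/-- the subgroup `K₂⟨t⟩` -/
def G2' : Subgroup Γ where
  carrier := {x | ∃ k ∈ K2, ∃ a : ℤ, x = k * t^a}
  one_mem' := ⟨1, K2.one_mem, 0, by simp⟩
  mul_mem' := by
    rintro _ _ ⟨k, hk, a, rfl⟩ ⟨l, hl, b, rfl⟩
    refine ⟨k * (t^a * l * (t^a)⁻¹), mul_mem hk (g.tconj z st a hl), a + b, ?_⟩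
    rw [zpow_add]; group
  inv_mem' := by
    rintro _ ⟨k, hk, a, rfl⟩
    refine ⟨t^(-a) * k⁻¹ * (t^(-a))⁻¹, g.tconj z st _ (inv_mem hk), -a, ?_⟩
    group

lemma φ_one : φ 1 = 0 := st.kill 1 K2.one_mem (one_smul _ _)

lemma φ_inv {k : Γ} (hk : k ∈ K2) : φ k⁻¹ = - φ k := by
  have := st.add k hk _ (inv_mem hk)
  rw [mul_inv_cancel, g.φ_one z st] at this; omega

lemma h_mul_zpow {k : Γ} (hk : k ∈ K2) (a : ℤ) : h (k * t^a) = a := by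
  have := st.le hk
  rw [z.mul _ this.1 _ (zpow_mem z.mem _), this.2, z.map_zpow z.mem, z.one]; ring

lemma mem_H {x : Γ} (hx : x ∈ g.G2' z st) : x ∈ H := by
  obtain ⟨k, hk, a, rfl⟩ := hx
  exact mul_mem (st.le hk).1 (zpow_mem z.mem _)

end fin

/-- length function -/
def LL (h φ : Γ → ℤ) (t x : Γ) : ℕ := (h x).natAbs + (φ (x * t ^ (- h x))).natAbs

section fin2
variable {H : Subgroup Γ} {h : Γ → ℤ} {t : Γ} (z : g.ZHom H h t) {K2 : Subgroup Γ} {φ : Γ → ℤ}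
  (st : g.Stg H z.ker K2 φ)
include st

lemma LL_eq {k : Γ} (hk : k ∈ K2) (a : ℤ) : LL h φ t (k * t^a) = a.natAbs + (φ k).natAbs := by
  rw [LL, g.h_mul_zpow z st hk, zpow_neg, mul_inv_cancel_right]

lemma LL_mul {x y : Γ} (hx : x ∈ g.G2' z st) (hy : y ∈ g.G2' z st) :
    LL h φ t (x * y) ≤ LL h φ t x + LL h φ t y := by
  obtain ⟨k, hk, a, rfl⟩ := hx
  obtain ⟨l, hl, b, rfl⟩ := hy
  have e : k * t^a * (l * t^b) = (k * (t^a * l * (t^a)⁻¹)) * t^(a+b) := by rw [zpow_add]; group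
  have h1 := g.tconj z st a hl
  rw [e, g.LL_eq z st (mul_mem hk h1), g.LL_eq z st hk, g.LL_eq z st hl, st.add _ hk _ h1]
  have h2 := st.abs (t^a) (zpow_mem z.mem a) l hl
  have h3 := Int.natAbs_add_le a b
  have h4 := Int.natAbs_add_le (φ k) (φ (t^a * l * (t^a)⁻¹))
  omega

lemma LL_bdd (r : ℕ) : ∃ C, ∀ x ∈ g.G2' z st, g.len x ≤ r → LL h φ t x ≤ C := by
  have hf : ((fun s => LL h φ t s) '' {s | s ∈ g.G2' z st ∧ g.len s ≤ r}).Finite := by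
    refine finite_of_factor _ (fun s => s • g.o) _ ?_ ?_
    · refine (g.fin g.o r).subset ?_
      rintro _ ⟨s, hs, rfl⟩
      exact hs.2
    · rintro x ⟨hx, -⟩ y ⟨hy, -⟩ hxy
      have hxy : x • g.o = y • g.o := hxy
      have hfix : (y⁻¹ * x) • g.o = g.o := by rw [mul_smul, hxy, inv_smul_smul]
      have h1 := z.kill (y⁻¹ * x) (mul_mem (inv_mem (g.mem_H z st hy)) (g.mem_H z st hx)) hfix
      rw [z.mul _ (inv_mem (g.mem_H z st hy)) _ (g.mem_H z st hx), z.map_inv (g.mem_H z st hy)] at h1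
      obtain ⟨k, hk, a, rfl⟩ := hx
      obtain ⟨l, hl, b, rfl⟩ := hy
      rw [g.h_mul_zpow z st hk, g.h_mul_zpow z st hl] at h1
      obtain rfl : a = b := by omega
      show LL h φ t (k * t^a) = LL h φ t (l * t^a)
      rw [g.LL_eq z st hk, g.LL_eq z st hl]
      have e : (l * t^a)⁻¹ * (k * t^a) = t^(-a) * (l⁻¹ * k) * (t^(-a))⁻¹ := by group
      have h2 := mul_mem (inv_mem hl) hk
      rw [e] at hfix
      have h3 := st.kill _ (g.tconj z st _ h2) hfix
      have h4 := st.abs (t^(-a)) (zpow_mem z.mem _) _ h2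
      rw [h3, st.add _ (inv_mem hl) _ hk, g.φ_inv z st hl] at h4
      congr 2
      omega
  obtain ⟨M, hM⟩ := hf.bddAbove
  exact ⟨M, fun s hs h => hM ⟨s, ⟨hs, h⟩, rfl⟩⟩

lemma dense (hcd : g.CD H ⊤) : g.CD (g.G2' z st) ⊤ := by
  obtain ⟨c1, h1⟩ := hcd
  obtain ⟨c2, h2⟩ := st.cd
  refine ⟨c1 + c2, fun γ hγ => ?_⟩
  obtain ⟨κ, hκ, e1⟩ := h1 γ hγ
  have hk : t^(- h κ) * κ ∈ z.ker := by
    refine ⟨mul_mem (zpow_mem z.mem _) hκ, ?_⟩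
    rw [z.mul _ (zpow_mem z.mem _) _ hκ, z.map_zpow z.mem, z.one]; ring
  obtain ⟨k2, hk2, e2⟩ := h2 _ hk
  refine ⟨t^(h κ) * k2, ⟨t^(h κ) * k2 * (t^(h κ))⁻¹, g.tconj z st _ hk2, h κ, by group⟩, ?_⟩
  refine (g.tri _ (κ • g.o) _).trans (add_le_add e1 ?_)
  rw [← g.inv (t^(h κ)), smul_smul, smul_smul, ← mul_assoc, ← zpow_add, add_neg_cancel, zpow_zero, one_mul] at e2
  exact e2

lemma pts (c : ℕ) : ∃ F : ℕ, ∀ m : ℕ,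
    {v | ∃ x ∈ g.G2' z st, LL h φ t x ≤ m ∧ g.δ v (x • g.o) ≤ c}.Finite ∧
    {v | ∃ x ∈ g.G2' z st, LL h φ t x ≤ m ∧ g.δ v (x • g.o) ≤ c}.ncard ≤ (2 * m + 1)^2 * F := by
  have hW : {w | ∃ k ∈ K2, φ k = 0 ∧ g.δ (k • g.o) w ≤ c}.Finite := by
    refine (st.fin.biUnion (fun x _ => g.fin x c)).subset ?_
    rintro w ⟨k, hk, h0, hw⟩
    exact mem_biUnion (show k • g.o ∈ {x | ∃ k ∈ K2, φ k = 0 ∧ k • g.o = x} from ⟨k, hk, h0, rfl⟩) hw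
  obtain ⟨W, hWd⟩ : ∃ W, W = {w | ∃ k ∈ K2, φ k = 0 ∧ g.δ (k • g.o) w ≤ c} := ⟨_, rfl⟩
  rw [← hWd] at hW
  have hrep : ∀ v : ℤ, ∃ k, (∃ l ∈ K2, φ l = v) → k ∈ K2 ∧ φ k = v := by
    intro v
    by_cases hv : ∃ l ∈ K2, φ l = v
    · obtain ⟨l, h1, h2⟩ := hv
      exact ⟨l, fun _ => ⟨h1, h2⟩⟩
    · exact ⟨1, fun h => absurd h hv⟩
  choose rep hrep using hrep
  refine ⟨W.ncard, fun m => ?_⟩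
  have hI : ((Finset.Icc (-(m:ℤ)) m : Finset ℤ) : Set ℤ).ncard = 2 * m + 1 := by
    rw [ncard_coe_finset, Int.card_Icc]; omega
  have hsub : {v | ∃ x ∈ g.G2' z st, LL h φ t x ≤ m ∧ g.δ v (x • g.o) ≤ c} ⊆
      (fun q : ℤ × ℤ × V => t^q.1 • rep q.2.1 • q.2.2) ''
      (((Finset.Icc (-(m:ℤ)) m : Finset ℤ) : Set ℤ) ×ˢ (((Finset.Icc (-(m:ℤ)) m : Finset ℤ) : Set ℤ) ×ˢ W)) := by
    rintro v ⟨_, ⟨k, hk, a, rfl⟩, hL, hd⟩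
    rw [g.LL_eq z st hk] at hL
    obtain ⟨k', hk'd⟩ : ∃ k', k' = t^(-a) * k * (t^(-a))⁻¹ := ⟨_, rfl⟩
    have hk' : k' ∈ K2 := hk'd ▸ g.tconj z st (-a) hk
    have hφ : (φ k').natAbs = (φ k).natAbs := hk'd ▸ st.abs _ (zpow_mem z.mem _) k hk
    obtain ⟨hr1, hr2⟩ := hrep (φ k') ⟨k', hk', rfl⟩
    have e : k * t^a = t^a * (rep (φ k') * ((rep (φ k'))⁻¹ * k')) := by
      rw [mul_inv_cancel_left, hk'd]; group
    refine ⟨(a, φ k', (rep (φ k'))⁻¹ • (t^a)⁻¹ • v), ⟨?_, ?_, ?_⟩, ?_⟩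
    · show a ∈ ((Finset.Icc (-(m:ℤ)) m : Finset ℤ) : Set ℤ)
      rw [Finset.mem_coe, Finset.mem_Icc]; omega
    · show φ k' ∈ ((Finset.Icc (-(m:ℤ)) m : Finset ℤ) : Set ℤ)
      rw [Finset.mem_coe, Finset.mem_Icc]; omega
    · show (rep (φ k'))⁻¹ • (t^a)⁻¹ • v ∈ W
      rw [hWd]
      refine ⟨(rep (φ k'))⁻¹ * k', mul_mem (inv_mem hr1) hk', ?_, ?_⟩
      · rw [st.add _ (inv_mem hr1) _ hk', g.φ_inv z st hr1, hr2]; ring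
      · rw [g.symm, ← g.inv (rep (φ k')), smul_inv_smul, ← g.inv (t^a), smul_inv_smul, ← mul_smul, ← mul_smul,
          mul_assoc, ← e]
        exact hd
    · show t^a • rep (φ k') • (rep (φ k'))⁻¹ • (t^a)⁻¹ • v = v
      rw [smul_inv_smul, smul_inv_smul]
  have hfin := (((Finset.Icc (-(m:ℤ)) m).finite_toSet).prod (((Finset.Icc (-(m:ℤ)) m).finite_toSet).prod hW))
  refine ⟨(hfin.image _).subset hsub, ?_⟩
  refine (ncard_le_ncard hsub (hfin.image _)).trans ((ncard_image_le hfin).trans ?_)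
  rw [ncard_prod, ncard_prod, hI]
  exact le_of_eq (by ring)

theorem final (hcd : g.CD H ⊤) (hgeo : ∀ n γ, g.len γ ≤ n + 1 → ∃ γ', g.len γ' ≤ n ∧ g.len (γ'⁻¹ * γ) ≤ 1) :
    ∃ C, ∀ r ≥ 1, g.gr ⊤ r ≤ C * r^2 := by
  obtain ⟨c, hc⟩ := g.dense z st hcd
  obtain ⟨C0, hC0⟩ := g.LL_bdd z st (2 * c + 1)
  obtain ⟨F, hF⟩ := g.pts z st c
  have key : ∀ n γ, g.len γ ≤ n → ∀ κ ∈ g.G2' z st, g.δ (γ • g.o) (κ • g.o) ≤ c → LL h φ t κ ≤ C0 * (n + 1) := by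
    intro n
    induction n with
    | zero =>
      intro γ hγ κ hκ hd
      rw [g.len_eq_zero.1 (Nat.le_zero.1 hγ)] at hd
      rw [zero_add, mul_one]
      refine hC0 κ hκ ?_
      show g.δ g.o (κ • g.o) ≤ _
      omega
    | succ n ih =>
      intro γ hγ κ hκ hd
      obtain ⟨γ', h1, h2⟩ := hgeo n γ hγ
      obtain ⟨κ', hκ', hd'⟩ := hc γ' trivial
      have h3 := ih γ' h1 κ' hκ' hd'
      have h4 := g.LL_mul z st hκ' (mul_mem (inv_mem hκ') hκ)
      rw [mul_inv_cancel_left] at h4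
      have h5 := hC0 (κ'⁻¹ * κ) (mul_mem (inv_mem hκ') hκ) (by
        rw [← δ_smul]
        rw [← δ_smul] at h2
        have e1 := g.tri (κ' • g.o) (γ' • g.o) (κ • g.o)
        have e2 := g.tri (γ' • g.o) (γ • g.o) (κ • g.o)
        rw [g.symm] at hd'
        omega)
      rw [mul_add, mul_one]
      omega
  refine ⟨(4 * C0 + 1)^2 * F, fun r hr => ?_⟩
  have h1 : g.gr ⊤ r ≤ {v | ∃ x ∈ g.G2' z st, LL h φ t x ≤ C0 * (r + 1) ∧ g.δ v (x • g.o) ≤ c}.ncard := by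
    rw [gr]
    refine ncard_le_ncard ?_ ?_
    · rintro _ ⟨⟨γ, hγ, rfl⟩, hl⟩
      obtain ⟨κ, hκ, hd⟩ := hc γ hγ
      exact ⟨κ, hκ, key r γ hl κ hκ hd, hd⟩
    · exact (hF _).1
  refine (h1.trans (hF _).2).trans ?_
  calc (2 * (C0 * (r+1)) + 1)^2 * F ≤ ((4 * C0 + 1) * r)^2 * F := by
        refine Nat.mul_le_mul_right _ (Nat.pow_le_pow_left ?_ 2)
        nlinarith
    _ = _ := by ring

end fin2

theorem quad (hgeo : ∀ n γ, g.len γ ≤ n + 1 → ∃ γ', g.len γ' ≤ n ∧ g.len (γ'⁻¹ * γ) ≤ 1) (hp : g.PG 5 (⊤ : Subgroup Γ)) :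
    ∃ C, ∀ r ≥ 1, g.gr ⊤ r ≤ C * r^2 := by
  by_cases hinf : (g.orb ⊤).Finite
  · refine ⟨(g.orb ⊤).ncard, fun r hr => ?_⟩
    have h1 : g.gr ⊤ r ≤ (g.orb ⊤).ncard := ncard_le_ncard inter_subset_left hinf
    exact h1.trans (Nat.le_mul_of_pos_right _ (pow_pos hr 2))
  · have hb : g.BG ⊤ := by
      refine ⟨1, fun γ _ => ?_⟩
      have key : ∀ n γ, g.len γ ≤ n → γ ∈ Subgroup.closure {s | s ∈ (⊤ : Subgroup Γ) ∧ g.len s ≤ 1} := by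
        intro n
        induction n with
        | zero => intro γ hγ; exact Subgroup.subset_closure ⟨trivial, by omega⟩
        | succ n ih =>
          intro γ hγ
          obtain ⟨γ', h1, h2⟩ := hgeo n γ hγ
          have := mul_mem (ih γ' h1) (Subgroup.subset_closure (⟨trivial, h2⟩ : γ'⁻¹ * γ ∈ {s | s ∈ (⊤ : Subgroup Γ) ∧ g.len s ≤ 1}))
          rwa [mul_inv_cancel_left] at this
      exact key _ γ le_rfl
    obtain ⟨H, hle, hidx, h, t, z⟩ := g.thmZ hb hinf _ (g.PG_poly hp)
    have hcd := g.CD_of_relIndex hle hidx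
    have hb' := g.BG_of_CD hle hcd hb
    have hp' := g.PG_mono hle hp
    have hb2 := g.milnor z hb' (g.PG_poly hp')
    have hp2 : g.PG 3 z.ker := g.PG_ker z hp'
    obtain ⟨K2, φ, st⟩ := g.stage z hb2 hp2
    exact g.final z st hcd hgeo

end Geo
end RotorWalk

namespace RotorWalk
set_option linter.unusedSectionVars false
section glue
variable {V : Type*} [DecidableEq V] {G : SimpleGraph V} [G.LocallyFinite]

lemma geod_step (hconn : G.Connected) {x y : V} {n : ℕ} (h : G.dist x y = n + 1) :
    ∃ z, G.dist x z = n ∧ G.Adj z y := by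
  obtain ⟨p, hp⟩ := hconn.exists_walk_length_eq_dist y x
  rw [SimpleGraph.dist_comm, h] at hp
  cases p with
  | nil => simp at hp
  | @cons _ z _ hyz q =>
    rw [SimpleGraph.Walk.length_cons] at hp
    have h1 := SimpleGraph.dist_le q
    rw [SimpleGraph.dist_comm] at h1
    have h2 := hconn.dist_triangle (u := x) (v := z) (w := y)
    have h3 := SimpleGraph.dist_eq_one_iff_adj.2 hyz.symm
    exact ⟨z, by omega, hyz.symm⟩

lemma ball_finite (hconn : G.Connected) (x : V) (r : ℕ) : {y | G.dist x y ≤ r}.Finite := by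
  induction r with
  | zero =>
    refine (finite_singleton x).subset ?_
    intro y hy
    have hy : G.dist x y ≤ 0 := hy
    exact ((hconn.dist_eq_zero_iff).1 (Nat.le_zero.1 hy)).symm
  | succ r ih =>
    refine (ih.union (ih.biUnion (fun z _ => (G.neighborFinset z).finite_toSet))).subset ?_
    intro y hy
    have hy : G.dist x y ≤ r + 1 := hy
    rcases Nat.lt_or_ge (G.dist x y) (r+1) with h | h
    · exact Or.inl (Nat.lt_succ_iff.1 h)
    · obtain ⟨z, hz, hzy⟩ := geod_step hconn (le_antisymm hy h)
      refine Or.inr (mem_biUnion (show z ∈ {y | G.dist x y ≤ r} from hz.le) ?_)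
      simpa using hzy

lemma dist_aut_le (hconn : G.Connected) (γ : G ≃g G) (x y : V) : G.dist (γ x) (γ y) ≤ G.dist x y := by
  obtain ⟨p, hp⟩ := hconn.exists_walk_length_eq_dist x y
  have := SimpleGraph.dist_le (p.map γ.toHom)
  rw [SimpleGraph.Walk.length_map, hp] at this
  exact this

lemma dist_aut (hconn : G.Connected) (γ : G ≃g G) (x y : V) : G.dist (γ x) (γ y) = G.dist x y := by
  refine le_antisymm (dist_aut_le hconn γ x y) ?_
  have := dist_aut_le hconn γ.symm (γ x) (γ y)
  simpa using this

noncomputable def gGeo (hconn : G.Connected) (a : V) : Geo (G ≃g G) V where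
  δ := G.dist
  o := a
  self x := SimpleGraph.dist_self
  eq x y h := (hconn.dist_eq_zero_iff).1 h
  symm x y := SimpleGraph.dist_comm
  tri x y z := hconn.dist_triangle
  inv γ x y := dist_aut hconn γ x y
  fin x r := ball_finite hconn x r

lemma pretrans (hvt : VertexTransitive G) : MulAction.IsPretransitive (G ≃g G) V :=
  ⟨fun u v => hvt u v⟩

lemma gGeo_geo (hconn : G.Connected) (hvt : VertexTransitive G) (a : V) (n : ℕ) (γ : G ≃g G)
    (h : (gGeo hconn a).len γ ≤ n + 1) :
    ∃ γ', (gGeo hconn a).len γ' ≤ n ∧ (gGeo hconn a).len (γ'⁻¹ * γ) ≤ 1 := by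
  rcases Nat.lt_or_ge ((gGeo hconn a).len γ) (n+1) with h1 | h1
  · exact ⟨γ, Nat.lt_succ_iff.1 h1, by rw [inv_mul_cancel, Geo.len_one]; omega⟩
  · obtain ⟨z, hz, hzy⟩ := geod_step hconn (show G.dist a (γ • a) = n + 1 from le_antisymm h h1)
    obtain ⟨γ', rfl⟩ := hvt a z
    refine ⟨γ', hz.le, ?_⟩
    rw [← Geo.δ_smul]
    exact (SimpleGraph.dist_eq_one_iff_adj.2 hzy).le

lemma card_nb_aut (γ : G ≃g G) (x : V) : (G.neighborFinset (γ x)).card = (G.neighborFinset x).card := by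
  symm
  refine Finset.card_bij (fun y _ => γ y) ?_ ?_ ?_
  · intro y hy
    rw [SimpleGraph.mem_neighborFinset] at hy ⊢
    exact γ.map_adj_iff.2 hy
  · intro y _ y' _ h
    exact γ.injective h
  · intro y hy
    rw [SimpleGraph.mem_neighborFinset] at hy
    refine ⟨γ.symm y, ?_, by simp⟩
    rw [SimpleGraph.mem_neighborFinset, ← γ.map_adj_iff]
    simpa using hy

/-- the simple random walk as a homogeneous walk -/
noncomputable def gTW (hvt : VertexTransitive G) (a : V) (ha : ∃ y, G.Adj a y) : TW (G ≃g G) V where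
  nb x := G.neighborFinset x
  d := (G.neighborFinset a).card
  d_pos := by
    obtain ⟨y, hy⟩ := ha
    exact Finset.card_pos.2 ⟨y, by simpa using hy⟩
  card_nb x := by
    obtain ⟨γ, rfl⟩ := hvt a x
    exact card_nb_aut γ a
  symm x y h := by
    rw [SimpleGraph.mem_neighborFinset] at h ⊢; exact h.symm
  inv γ x y h := by
    rw [SimpleGraph.mem_neighborFinset] at h ⊢
    exact γ.map_adj_iff.2 h

lemma chain_even (hconn : G.Connected) (hvt : VertexTransitive G) (a : V) (ha : ∃ y, G.Adj a y) (k : ℕ) (y : V)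
    (h : G.dist a y = 2 * k) : (gTW hvt a ha).Chain2 a k y := by
  induction k generalizing y with
  | zero =>
    have e : y = a := ((hconn.dist_eq_zero_iff).1 (by omega)).symm
    rw [e]; exact .nil
  | succ k ih =>
    obtain ⟨z, hz, hzy⟩ := geod_step hconn (show G.dist a y = (2 * k + 1) + 1 by omega)
    obtain ⟨w, hw, hwz⟩ := geod_step hconn hz
    refine (ih w hw).cons ⟨z, ?_, ?_⟩
    · exact (SimpleGraph.mem_neighborFinset _ _ _).2 hwz
    · exact (SimpleGraph.mem_neighborFinset _ _ _).2 hzy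

lemma rpow_aux (x : ℝ) (hx : 0 ≤ x) : ((x^2) ^ (5/4:ℝ))^2 = x^5 := by
  have e : (x^2) ^ (5/4:ℝ) = x ^ (5/2:ℝ) := by
    rw [← Real.rpow_natCast x 2, ← Real.rpow_mul hx]; norm_num
  rw [e, ← Real.rpow_natCast (x ^ (5/2:ℝ)) 2, ← Real.rpow_mul hx, ← Real.rpow_natCast x 5]
  norm_num

lemma growth_aux (hconn : G.Connected) (hvt : VertexTransitive G) (a : V) (ha : ∃ y, G.Adj a y)
    (hno : ∀ c : ℝ, 0 < c → ∃ r : ℕ, 1 ≤ r ∧ ∀ s : Finset V, (∀ y ∈ s, ∃ k ≤ r, (gTW hvt a ha).Chain2 a k y) →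
      (s.card : ℝ) < c * ((r:ℝ)^2) ^ (5/4:ℝ)) : (gGeo hconn a).PG 5 ⊤ := by
  obtain ⟨d, hd⟩ : ∃ d, d = (gTW hvt a ha).d := ⟨_, rfl⟩
  refine ⟨(d+1)^2, fun N0 => ?_⟩
  obtain ⟨c, hc⟩ : ∃ c : ℝ, c = ((((N0:ℝ) + 1)^2) ^ (5/4:ℝ))⁻¹ := ⟨_, rfl⟩
  have hc0 : 0 < c := by rw [hc]; positivity
  have hc1 : c ≤ 1 := by
    rw [hc]
    refine inv_le_one_of_one_le₀ (Real.one_le_rpow ?_ (by norm_num))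
    have : (0:ℝ) ≤ N0 := Nat.cast_nonneg _
    nlinarith
  obtain ⟨r, hr1, hr⟩ := hno c hc0
  have hrN : N0 ≤ r := by
    by_contra hlt
    have h1 := hr {a} (by
      intro y hy
      rw [Finset.mem_singleton] at hy
      refine ⟨0, Nat.zero_le _, ?_⟩
      rw [hy]; exact .nil)
    have h2 : ((r:ℝ)^2) ^ (5/4:ℝ) ≤ (((N0:ℝ) + 1)^2) ^ (5/4:ℝ) := by
      refine Real.rpow_le_rpow (by positivity) ?_ (by norm_num)
      have : (r:ℝ) ≤ N0 := by exact_mod_cast (by omega : r ≤ N0)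
      have : (0:ℝ) ≤ r := Nat.cast_nonneg _
      gcongr
      linarith
    have h3 : (0:ℝ) < (((N0:ℝ) + 1)^2) ^ (5/4:ℝ) := by positivity
    have h4 := mul_le_mul_of_nonneg_left h2 hc0.le
    rw [hc, inv_mul_cancel₀ h3.ne', ← hc] at h4
    rw [Finset.card_singleton, Nat.cast_one] at h1
    linarith
  refine ⟨2 * r, by omega, ?_⟩
  have hEf : ({y | G.dist a y ≤ 2 * r ∧ ∃ k ≤ r, (gTW hvt a ha).Chain2 a k y}).Finite :=
    (ball_finite hconn a (2 * r)).subset (fun y hy => hy.1)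
  obtain ⟨s, hs⟩ : ∃ s, s = hEf.toFinset := ⟨_, rfl⟩
  have hsm : ∀ y, y ∈ s ↔ (G.dist a y ≤ 2 * r ∧ ∃ k ≤ r, (gTW hvt a ha).Chain2 a k y) := by
    intro y; rw [hs, Set.Finite.mem_toFinset]; rfl
  have h1 := hr s (fun y hy => ((hsm y).1 hy).2)
  have h2 : (gGeo hconn a).gr ⊤ (2 * r) ≤ (d + 1) * s.card := by
    have hsub : ((gGeo hconn a).orb ⊤ ∩ {x | (gGeo hconn a).δ (gGeo hconn a).o x ≤ 2 * r}) ⊆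
        ((s ∪ s.biUnion (fun z => (gTW hvt a ha).nb z) : Finset V) : Set V) := by
      rintro y ⟨-, hy⟩
      have hy : G.dist a y ≤ 2 * r := hy
      rw [Finset.mem_coe, Finset.mem_union]
      rcases Nat.even_or_odd' (G.dist a y) with ⟨k, hk | hk⟩
      · exact Or.inl ((hsm y).2 ⟨hy, k, by omega, chain_even hconn hvt a ha k y hk⟩)
      · obtain ⟨z, hz, hzy⟩ := geod_step hconn hk
        refine Or.inr (Finset.mem_biUnion.2 ⟨z, (hsm z).2 ⟨by omega, k, by omega, chain_even hconn hvt a ha k z hz⟩, ?_⟩)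
        exact (SimpleGraph.mem_neighborFinset _ _ _).2 hzy
    rw [Geo.gr]
    refine (ncard_le_ncard hsub (Finset.finite_toSet _)).trans ?_
    rw [ncard_coe_finset]
    refine (Finset.card_union_le _ _).trans ?_
    have := Finset.card_biUnion_le_card_mul s (fun z => (gTW hvt a ha).nb z) d
      (fun z _ => by rw [hd]; exact ((gTW hvt a ha).card_nb z).le)
    rw [add_mul, one_mul, mul_comm d]; omega
  have h3 : ((s.card : ℝ))^2 ≤ (r:ℝ)^5 := by
    rw [← rpow_aux r (Nat.cast_nonneg _)]
    refine pow_le_pow_left₀ (Nat.cast_nonneg _) (h1.le.trans ?_) 2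
    exact mul_le_of_le_one_left (by positivity) hc1
  have h4 : s.card^2 ≤ r^5 := by exact_mod_cast h3
  calc ((gGeo hconn a).gr ⊤ (2 * r))^2 ≤ ((d+1) * s.card)^2 := Nat.pow_le_pow_left h2 2
    _ = (d+1)^2 * s.card^2 := by ring
    _ ≤ (d+1)^2 * (2 * r)^5 := Nat.mul_le_mul_left _ (h4.trans (Nat.pow_le_pow_left (by omega) 5))

lemma green_bdd (htrans : TransientGraph G) (hvt : VertexTransitive G) (a : V) (ha : ∃ y, G.Adj a y) :
    ∃ K : ℝ, ∀ n, ∑ t ∈ Finset.range n, (gTW hvt a ha).p t a a ≤ K := by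
  have := pretrans hvt
  refine ⟨(green G ∅ a a).toReal, fun n => ?_⟩
  have h1 : ∑ t ∈ Finset.range n, srw G ∅ a t a ≤ green G ∅ a a := by
    have e : green G ∅ a a = ∑' t, srw G ∅ a t a := by simp [green]
    rw [e]; exact ENNReal.sum_le_tsum _
  simp only [srw_eq (gTW hvt a ha) (fun x => rfl)] at h1
  rw [← ENNReal.ofReal_sum_of_nonneg (fun t _ => (gTW hvt a ha).p_nonneg t a a)] at h1
  exact (ENNReal.ofReal_le_iff_le_toReal (htrans a a).ne).1 h1

theorem main_aux (hconn : G.Connected)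
    (htrans : TransientGraph G) (hvt : VertexTransitive G)
    (τ : V → V → V) (hτ : ValidMechanism G ∅ τ) (a : V) :
    ∃ C : ℝ≥0∞, 0 < C ∧ C ≠ ⊤ ∧
      ∀ ρ : V → V, ValidConfig G ∅ ρ → ∀ n : ℕ, 1 ≤ n → ∀ x : V,
        green G ∅ a x - C / (ENNReal.ofReal (Real.log n)) ^ 2 ≤
          (SvisT τ a ρ n x : ℝ≥0∞) / (n : ℝ≥0∞) := by
  by_cases ha : ∃ y, G.Adj a y
  swap
  · exact ⟨1, one_pos, ENNReal.one_ne_top, fun ρ hρ => absurd ⟨ρ a, hρ a (notMem_empty _)⟩ ha⟩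
  have := pretrans hvt
  by_cases hgr : ∃ c : ℝ, 0 < c ∧ ∀ r : ℕ, 1 ≤ r → ∃ s : Finset V, (∀ y ∈ s, ∃ k ≤ r, (gTW hvt a ha).Chain2 a k y) ∧
      c * ((r:ℝ)^2) ^ (5/4:ℝ) ≤ s.card
  · obtain ⟨c, hc, hg⟩ := hgr
    obtain ⟨C1, hC1⟩ := (gTW hvt a ha).heat_of_growth a c hc hg
    exact main_of_heat (gTW hvt a ha) (fun x => rfl) τ hτ a C1 hC1
  · exfalso
    push Not at hgr
    obtain ⟨C, hC⟩ := (gGeo hconn a).quad (gGeo_geo hconn hvt a) (growth_aux hconn hvt a ha hgr)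
    obtain ⟨K, hK⟩ := green_bdd htrans hvt a ha
    refine (gTW hvt a ha).recurrent a K hK (fun x => G.dist a x) SimpleGraph.dist_self ?_
      (fun r => (ball_finite hconn a r).toFinset) (fun r x => by rw [Set.Finite.mem_toFinset]; rfl) C ?_
    · intro x y hy
      have h1 := SimpleGraph.dist_eq_one_iff_adj.2 ((SimpleGraph.mem_neighborFinset _ _ _).1 hy)
      have h2 := hconn.dist_triangle (u := a) (v := x) (w := y)
      show G.dist a y ≤ G.dist a x + 1
      omega
    · intro r hr
      have h1 := hC r hr
      have h2 : (gGeo hconn a).gr ⊤ r = (ball_finite hconn a r).toFinset.card := by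
        rw [Geo.gr, ← ncard_eq_toFinset_card _ (ball_finite hconn a r)]
        congr 1
        ext y
        constructor
        · rintro ⟨-, h⟩; exact h
        · intro h
          obtain ⟨γ, hγ⟩ := hvt a y
          exact ⟨⟨γ, trivial, hγ⟩, h⟩
      rw [h2] at h1
      exact_mod_cast h1

end glue
end RotorWalk

namespace RotorWalk

variable {V : Type*} [DecidableEq V]

/-- quantitative Schramm bound: on a locally finite, transient,
vertex-transitive simple connected graph there is a constant `C > 0` such that for every
initial rotor configuration `ρ`, every `n ≥ 1`, and every vertex `x`,
`S_n(ρ,x)/n ≥ G(a,x) − C (log n)⁻²` (compared in `[0,∞]`). -/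
theorem occupation_rate_lower_bound_vertex_transitive
    {V : Type*} [DecidableEq V]
    (G : SimpleGraph V) [G.LocallyFinite] (hconn : G.Connected)
    (htrans : TransientGraph G) (hvt : VertexTransitive G)
    (τ : V → V → V) (hτ : ValidMechanism G ∅ τ) (a : V) :
    ∃ C : ℝ≥0∞, 0 < C ∧ C ≠ ⊤ ∧
      ∀ ρ : V → V, ValidConfig G ∅ ρ → ∀ n : ℕ, 1 ≤ n → ∀ x : V,
        green G ∅ a x - C / (ENNReal.ofReal (Real.log n)) ^ 2 ≤
          (SvisT τ a ρ n x : ℝ≥0∞) / (n : ℝ≥0∞) := by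
  exact main_aux hconn htrans hvt τ hτ a

end RotorWalk
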